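/- arXiv:1501.00829 — 2 statements merged into one kernel-verified Lean document; each statement's English description precedes it below -/
import Mathlib

section
/- (Theorem 3) There exists a double Walsh series ∑_{n,k=1}^∞ c_{n,k} W_n(x)W_k(y) with ∑_{n,k=1}^∞ |c_{n,k}|^q < ∞ for all q > 2, with the following property: for every ε > 0 there exists a measurable weight function μ(x,y) on T=[0,1]^2 with 0 < μ(x,y) ≤ 1 and |{(x,y) ∈ T : μ(x,y) ≠ 1}| < ε, such that for every f ∈ L^1_μ(T) (i.e. ∫∫_T |f|μ < ∞) there exists a subseries ∑_{q=1}^∞ ∑_{(k,ν) ∈ B_q} c_{k,ν}W_k(x)W_ν(y) (indexed by a subset of ℕ×ℕ) whose rectangular partial sums S_{n̄,m̄} and spherical partial sums S_R both converge to f in the metric of L^1_μ(T): ∫∫_T |S_{n̄,m̄} − f|·μ → 0 and ∫∫_T |S_R − f|·μ → 0. -/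
open MeasureTheory Real
open scoped ENNReal Classical

/-- The basic Rademacher function: 1-periodic, equal to `1` on `[0,1/2)` and `-1` on `[1/2,1)`. -/
noncomputable def rad0 (x : ℝ) : ℝ := if Int.fract x < 1/2 then 1 else -1

/-- The Rademacher functions `r_k(x) = r_0(2^k x)`. -/
noncomputable def rad (k : ℕ) (x : ℝ) : ℝ := rad0 (2 ^ k * x)

/-- The Walsh–Paley functions: `W_n = ∏ r_m` over the binary digits `m` of `n`. -/
noncomputable def walsh (n : ℕ) (x : ℝ) : ℝ :=
  ∏ m ∈ Finset.range (n + 1), if n.testBit m then rad m x else 1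

/-- The unit square `T = [0,1]²`. -/
def T : Set (ℝ × ℝ) := Set.Icc (0:ℝ) 1 ×ˢ Set.Icc (0:ℝ) 1

namespace DW

lemma rad_or (k : ℕ) (x : ℝ) : rad k x = 1 ∨ rad k x = -1 := by
  unfold rad rad0; split_ifs <;> simp

lemma rad_mul_self (k : ℕ) (x : ℝ) : rad k x * rad k x = 1 := by
  rcases rad_or k x with h | h <;> rw [h] <;> norm_num

lemma measurable_rad (k : ℕ) : Measurable (rad k) := by
  unfold rad rad0
  refine Measurable.ite ?_ measurable_const measurable_const
  exact measurableSet_lt (measurable_fract.comp (measurable_const.mul measurable_id)) measurable_const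

lemma rad_succ (k : ℕ) (x : ℝ) : rad (k + 1) x = rad k (2 * x) := by
  unfold rad; congr 1; ring

lemma rad_add_int (k : ℕ) (x t : ℝ) (z : ℤ) (h : 2 ^ k * t = z) : rad k (x + t) = rad k x := by
  unfold rad rad0
  rw [mul_add, h, Int.fract_add_intCast]

lemma rad_fract (k : ℕ) (x : ℝ) : rad k (Int.fract x) = rad k x := by
  have := rad_add_int k (Int.fract x) ⌊x⌋ (2 ^ k * ⌊x⌋) (by push_cast; ring)
  rw [← this, Int.fract_add_floor]

lemma rad0_half (x : ℝ) : rad0 (x + 1 / 2) = - rad0 x := by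
  unfold rad0
  have h0 := Int.fract_nonneg x
  have h1 := Int.fract_lt_one x
  have hx := Int.fract_add_floor x
  by_cases h : Int.fract x < 1 / 2
  · have : Int.fract (x + 1 / 2) = Int.fract x + 1 / 2 := by
      rw [Int.fract_eq_iff]
      refine ⟨by linarith, by linarith, ⌊x⌋, by linarith⟩
    rw [this, if_pos h, if_neg (by linarith)]
  · have : Int.fract (x + 1 / 2) = Int.fract x - 1 / 2 := by
      rw [Int.fract_eq_iff]
      refine ⟨by linarith, by linarith, ⌊x⌋ + 1, by push_cast; linarith⟩
    rw [this, if_neg h, if_pos (by linarith)]; norm_num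

lemma walsh_eq (n N : ℕ) (h : n < 2 ^ N) (x : ℝ) :
    walsh n x = ∏ m ∈ Finset.range N, if n.testBit m then rad m x else 1 := by
  have key : ∀ A, n < 2 ^ A → ∀ B, A ≤ B →
      (∏ m ∈ Finset.range A, if n.testBit m then rad m x else 1) =
      ∏ m ∈ Finset.range B, if n.testBit m then rad m x else 1 := by
    intro A hA B hAB
    apply Finset.prod_subset (Finset.range_mono hAB)
    intro m _ hm
    have : A ≤ m := by simpa using hm
    rw [Nat.testBit_lt_two_pow (lt_of_lt_of_le hA (Nat.pow_le_pow_right (by norm_num) this))]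
    simp
  unfold walsh
  have h2 : n < 2 ^ (n + 1) := lt_trans (Nat.lt_succ_self n) Nat.lt_two_pow_self
  rw [key _ h2 _ (le_max_left (n+1) N), key _ h _ (le_max_right (n+1) N)]

lemma walsh_mul (n m : ℕ) (x : ℝ) : walsh n x * walsh m x = walsh (n ^^^ m) x := by
  obtain ⟨N, hn, hm⟩ : ∃ N, n < 2 ^ N ∧ m < 2 ^ N :=
    ⟨n + m, lt_of_lt_of_le Nat.lt_two_pow_self (Nat.pow_le_pow_right (by norm_num) (by omega)),
      lt_of_lt_of_le Nat.lt_two_pow_self (Nat.pow_le_pow_right (by norm_num) (by omega))⟩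
  rw [walsh_eq n N hn, walsh_eq m N hm, walsh_eq _ N (Nat.xor_lt_two_pow hn hm),
    ← Finset.prod_mul_distrib]
  refine Finset.prod_congr rfl fun i _ => ?_
  rw [Nat.testBit_xor]
  cases n.testBit i <;> cases m.testBit i <;> simp [rad_mul_self]

lemma walsh_zero (x : ℝ) : walsh 0 x = 1 := by simp [walsh]

lemma walsh_mul_self (n : ℕ) (x : ℝ) : walsh n x * walsh n x = 1 := by
  rw [walsh_mul, Nat.xor_self, walsh_zero]

lemma abs_walsh (n : ℕ) (x : ℝ) : |walsh n x| = 1 := by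
  have := walsh_mul_self n x
  rcases mul_self_eq_one_iff.1 this with h | h <;> rw [h] <;> simp

lemma measurable_walsh (n : ℕ) : Measurable (walsh n) := by
  unfold walsh
  refine Finset.measurable_prod _ fun m _ => ?_
  split_ifs
  · exact measurable_rad m
  · exact measurable_const

lemma walsh_add (M j k : ℕ) (hk : k < 2 ^ M) (x : ℝ) :
    walsh (2 ^ M * j + k) x = walsh (2 ^ M * j) x * walsh k x := by
  rw [walsh_mul]; congr 1
  apply Nat.eq_of_testBit_eq
  intro i
  rw [Nat.testBit_xor, Nat.testBit_two_pow_mul_add _ hk, Nat.testBit_two_pow_mul]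
  by_cases h : i < M
  · have h' : ¬ (M ≤ i) := by omega
    simp [h, h']
  · have : k.testBit i = false :=
      Nat.testBit_lt_two_pow (lt_of_lt_of_le hk (Nat.pow_le_pow_right (by norm_num) (by omega)))
    simp [h, this]; omega

lemma walsh_two_pow (M : ℕ) (x : ℝ) : walsh (2 ^ M) x = rad M x := by
  rw [walsh_eq (2 ^ M) (M + 1) (Nat.pow_lt_pow_right (by norm_num) (by omega)),
    Finset.prod_range_succ, Finset.prod_eq_one]
  · simp
  · intro i hi
    have : i < M := by simpa using hi
    rw [Nat.testBit_two_pow_of_ne (by omega)]; simp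

lemma walsh_periodic (n : ℕ) : Function.Periodic (walsh n) 1 := by
  intro x
  unfold walsh
  refine Finset.prod_congr rfl fun m _ => ?_
  rw [rad_add_int m x 1 (2 ^ m) (by push_cast; ring)]

lemma walsh_anti (n : ℕ) (hn : n ≠ 0) : ∃ t : ℝ, ∀ x, walsh n (x + t) = - walsh n x := by
  obtain ⟨m, hm⟩ : ∃ m, n.testBit m = true := Nat.exists_testBit_of_ne_zero hn
  have hex : ∃ m, n.testBit m = true := ⟨m, hm⟩
  set m := Nat.find hex
  have h1 : n.testBit m = true := Nat.find_spec hex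
  have h2 : ∀ i < m, ¬ n.testBit i = true := fun i hi => Nat.find_min hex hi
  refine ⟨1 / 2 ^ (m + 1), fun x => ?_⟩
  have hmn : m ∈ Finset.range (n + 1) := by
    rw [Finset.mem_range]
    have := Nat.ge_two_pow_of_testBit h1
    have := @Nat.lt_two_pow_self m
    omega
  unfold walsh
  rw [← Finset.mul_prod_erase _ _ hmn, ← Finset.mul_prod_erase _ _ hmn, ← neg_mul]
  congr 1
  · rw [if_pos h1, if_pos h1]
    unfold rad
    rw [← rad0_half]; congr 1; field_simp; ring
  · refine Finset.prod_congr rfl fun i hi => ?_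
    by_cases hi2 : n.testBit i = true
    · rw [if_pos hi2, if_pos hi2]
      have hne : i ≠ m := (Finset.mem_erase.1 hi).1
      have hge : m ≤ i := by
        by_contra h; exact h2 i (by omega) hi2
      obtain ⟨d, rfl⟩ : ∃ d, i = m + 1 + d := ⟨i - (m + 1), by omega⟩
      refine rad_add_int _ _ _ (2 ^ d) ?_
      push_cast; rw [pow_add]; field_simp
    · rw [if_neg hi2, if_neg hi2]

lemma intervalIntegral_walsh (n : ℕ) (hn : n ≠ 0) : ∫ x in (0:ℝ)..1, walsh n x = 0 := by
  obtain ⟨t, ht⟩ := walsh_anti n hn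
  have h1 : ∫ x in (0:ℝ)..1, walsh n (x + t) = ∫ x in (0:ℝ)..1, walsh n x := by
    rw [intervalIntegral.integral_comp_add_right (fun x => walsh n x)]
    have := (walsh_periodic n).intervalIntegral_add_eq t 0
    rw [zero_add] at *
    rw [add_comm 1 t]; exact this
  simp only [ht, intervalIntegral.integral_neg] at h1
  linarith

lemma integral_walsh (n : ℕ) : ∫ x in Set.Icc (0:ℝ) 1, walsh n x = if n = 0 then 1 else 0 := by
  rw [integral_Icc_eq_integral_Ioc, ← intervalIntegral.integral_of_le (by norm_num)]
  split_ifs with h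
  · subst h; simp [walsh_zero]
  · exact intervalIntegral_walsh n h

lemma agree_close (L : ℕ) : ∀ x t : ℝ, 0 ≤ x → x < 1 → 0 ≤ t → t < 1 →
    (∀ m < L, rad m x = rad m t) → |x - t| ≤ (1 / 2) ^ L := by
  induction L with
  | zero =>
    intro x t h1 h2 h3 h4 _
    rw [abs_le]; constructor <;> simp <;> linarith
  | succ L ih =>
    intro x t h1 h2 h3 h4 h
    have h0 := h 0 (by omega)
    have hf : ⌊2 * x⌋ = ⌊2 * t⌋ := by
      unfold rad rad0 at h0
      simp only [pow_zero, one_mul] at h0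
      rw [Int.fract_eq_self.2 ⟨h1, h2⟩, Int.fract_eq_self.2 ⟨h3, h4⟩] at h0
      by_cases hx : x < 1 / 2 <;> by_cases hT : t < 1 / 2
      · rw [Int.floor_eq_zero_iff.2 ⟨by linarith, by linarith⟩,
          Int.floor_eq_zero_iff.2 ⟨by linarith, by linarith⟩]
      · rw [if_pos hx, if_neg hT] at h0; norm_num at h0
      · rw [if_neg hx, if_pos hT] at h0; norm_num at h0
      · have a1 : ⌊2 * x⌋ = 1 := by
          rw [Int.floor_eq_iff]; constructor <;> push_cast <;> linarith
        have a2 : ⌊2 * t⌋ = 1 := by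
          rw [Int.floor_eq_iff]; constructor <;> push_cast <;> linarith
        rw [a1, a2]
    have := ih (Int.fract (2 * x)) (Int.fract (2 * t)) (Int.fract_nonneg _) (Int.fract_lt_one _)
      (Int.fract_nonneg _) (Int.fract_lt_one _) (fun m hm => by
        rw [rad_fract, rad_fract, ← rad_succ, ← rad_succ]; exact h _ (by omega))
    have e : Int.fract (2 * x) - Int.fract (2 * t) = 2 * (x - t) := by
      unfold Int.fract; rw [hf]; ring
    rw [e, abs_mul, abs_of_pos (by norm_num : (0:ℝ) < 2)] at this
    rw [pow_succ]; linarith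

lemma dirichlet (M s : ℕ) (x y : ℝ) :
    ∑ j ∈ Finset.range (2 ^ s), walsh (2 ^ M * j) x * walsh (2 ^ M * j) y =
      ∏ m ∈ Finset.range s, (1 + rad (M + m) x * rad (M + m) y) := by
  induction s with
  | zero => simp [walsh_zero]
  | succ s ih =>
    rw [pow_succ, mul_two, Finset.sum_range_add, Finset.prod_range_succ, ← ih, mul_add, mul_one,
      Finset.sum_mul]
    congr 1
    refine Finset.sum_congr rfl fun j hj => ?_
    have hj : j < 2 ^ s := by simpa using hj
    have e : 2 ^ M * (2 ^ s + j) = 2 ^ (M + s) * 1 + 2 ^ M * j := by ring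
    have hlt : 2 ^ M * j < 2 ^ (M + s) := by
      rw [pow_add]; exact Nat.mul_lt_mul_of_pos_left hj (by positivity)
    rw [e, walsh_add _ _ _ hlt, walsh_add _ _ _ hlt, mul_one, walsh_two_pow, walsh_two_pow]
    ring


/-- product Walsh functions -/
noncomputable def e (z : ℕ × ℕ) (p : ℝ × ℝ) : ℝ := walsh z.1 p.1 * walsh z.2 p.2

/-- Lebesgue measure on the unit square -/
noncomputable def tau : Measure (ℝ × ℝ) := volume.restrict T

lemma tau_eq : tau = ((volume : Measure ℝ).restrict (Set.Icc 0 1)).prod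
    ((volume : Measure ℝ).restrict (Set.Icc 0 1)) := by
  rw [Measure.prod_restrict]; rfl

instance : IsProbabilityMeasure tau := by
  have : IsProbabilityMeasure ((volume : Measure ℝ).restrict (Set.Icc 0 1)) := by
    constructor; simp
  rw [tau_eq]; infer_instance

lemma abs_e (z : ℕ × ℕ) (p : ℝ × ℝ) : |e z p| = 1 := by
  unfold e; rw [abs_mul, abs_walsh, abs_walsh, one_mul]

lemma measurable_e (z : ℕ × ℕ) : Measurable (e z) :=
  ((measurable_walsh _).comp measurable_fst).mul ((measurable_walsh _).comp measurable_snd)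

/-- partial sums -/
noncomputable def ps (G : Finset (ℕ × ℕ)) (r : ℕ × ℕ → ℝ) (p : ℝ × ℝ) : ℝ := ∑ z ∈ G, r z * e z p

lemma measurable_ps (G : Finset (ℕ × ℕ)) (r : ℕ × ℕ → ℝ) : Measurable (ps G r) :=
  Finset.measurable_sum _ fun z _ => measurable_const.mul (measurable_e z)

lemma abs_ps_le (G : Finset (ℕ × ℕ)) (r : ℕ × ℕ → ℝ) (p : ℝ × ℝ) : |ps G r p| ≤ ∑ z ∈ G, |r z| := by
  refine (Finset.abs_sum_le_sum_abs _ _).trans (le_of_eq ?_)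
  refine Finset.sum_congr rfl fun z _ => ?_
  rw [abs_mul, abs_e, mul_one]

lemma integrable_of_bdd {ν : Measure (ℝ × ℝ)} [IsFiniteMeasure ν] {g : ℝ × ℝ → ℝ} (hg : Measurable g)
    (C : ℝ) (h : ∀ p, |g p| ≤ C) : Integrable g ν :=
  Integrable.of_bound hg.aestronglyMeasurable C (Filter.Eventually.of_forall h)

lemma integrable_ps {ν : Measure (ℝ × ℝ)} [IsFiniteMeasure ν] (G : Finset (ℕ × ℕ)) (r : ℕ × ℕ → ℝ) :
    Integrable (ps G r) ν := integrable_of_bdd (measurable_ps G r) _ (abs_ps_le G r)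

lemma integral_e (z : ℕ × ℕ) : ∫ p, e z p ∂tau = if z = 0 then 1 else 0 := by
  unfold e
  rw [tau_eq, integral_prod_mul (f := walsh z.1) (g := walsh z.2), integral_walsh, integral_walsh]
  rcases z with ⟨a, b⟩
  by_cases h1 : a = 0 <;> by_cases h2 : b = 0 <;> simp [h1, h2]

lemma e_mul (z w : ℕ × ℕ) (p : ℝ × ℝ) : e z p * e w p = e (z.1 ^^^ w.1, z.2 ^^^ w.2) p := by
  unfold e; simp only [← walsh_mul]; ring

lemma integral_e_mul (z w : ℕ × ℕ) : ∫ p, e z p * e w p ∂tau = if z = w then 1 else 0 := by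
  simp only [e_mul, integral_e]
  congr 1
  rcases z with ⟨a, b⟩; rcases w with ⟨c, d⟩
  simp only [Prod.mk_eq_zero, Prod.mk.injEq, Nat.xor_eq_zero_iff]

lemma integrable_e_mul (z w : ℕ × ℕ) : Integrable (fun p => e z p * e w p) tau :=
  integrable_of_bdd ((measurable_e z).mul (measurable_e w)) 1 fun p => by
    rw [abs_mul, abs_e, abs_e, one_mul]

lemma integral_ps_sq (G : Finset (ℕ × ℕ)) (r : ℕ × ℕ → ℝ) :
    ∫ p, ps G r p ^ 2 ∂tau = ∑ z ∈ G, r z ^ 2 := by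
  have : ∀ p, ps G r p ^ 2 = ∑ z ∈ G, ∑ w ∈ G, (r z * r w) * (e z p * e w p) := by
    intro p
    unfold ps
    rw [sq, Finset.sum_mul_sum]
    refine Finset.sum_congr rfl fun z _ => Finset.sum_congr rfl fun w _ => by ring
  simp only [this]
  rw [integral_finsetSum _ fun z _ => integrable_finsetSum _ fun w _ =>
    (integrable_e_mul z w).const_mul _]
  refine Finset.sum_congr rfl fun z hz => ?_
  rw [integral_finsetSum _ fun w _ => (integrable_e_mul z w).const_mul _]
  simp only [integral_const_mul, integral_e_mul]
  simp [hz, sq]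

lemma integral_abs_ps_le (G : Finset (ℕ × ℕ)) (r : ℕ × ℕ → ℝ) (l : ℝ) (hl : 0 < l)
    (h : ∑ z ∈ G, r z ^ 2 ≤ l ^ 2) : ∫ p, |ps G r p| ∂tau ≤ l := by
  have hi2 : Integrable (fun p => ps G r p ^ 2) tau :=
    integrable_of_bdd ((measurable_ps G r).pow_const 2) ((∑ z ∈ G, |r z|) ^ 2) fun p => by
      rw [abs_pow]; exact pow_le_pow_left₀ (abs_nonneg _) (abs_ps_le G r p) 2
  have h1 : ∫ p, |ps G r p| ∂tau ≤ ∫ p, (1 / (2 * l)) * ps G r p ^ 2 + l / 2 ∂tau := by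
    refine integral_mono (integrable_ps G r).abs ((hi2.const_mul _).add (integrable_const _)) ?_
    intro p
    have := sq_nonneg (|ps G r p| - l)
    have e1 : (1 / (2 * l)) * ps G r p ^ 2 + l / 2 - |ps G r p| =
      (1 / (2 * l)) * (|ps G r p| - l) ^ 2 := by
      rw [← sq_abs (ps G r p)]; field_simp; ring
    have : 0 ≤ (1 / (2 * l)) * (|ps G r p| - l) ^ 2 := by positivity
    simp only
    linarith
  rw [integral_add (hi2.const_mul _) (integrable_const _), integral_const_mul, integral_ps_sq] at h1
  simp only [integral_const, probReal_univ, smul_eq_mul, one_mul] at h1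
  have h2 : (1 / (2 * l)) * ∑ z ∈ G, r z ^ 2 ≤ (1 / (2 * l)) * l ^ 2 := by gcongr
  have h3 : (1 / (2 * l)) * l ^ 2 = l / 2 := by field_simp
  linarith

/-- bad sets -/
def bad (M s : ℕ) : Set (ℝ × ℝ) := {p | ∀ m < s, rad (M + m) p.1 = rad (M + m) p.2}

lemma measurableSet_bad (M s : ℕ) : MeasurableSet (bad M s) := by
  have : bad M s = ⋂ m, ⋂ (_ : m < s), {p | rad (M + m) p.1 = rad (M + m) p.2} := by
    ext p; simp [bad]
  rw [this]
  refine MeasurableSet.iInter fun m => MeasurableSet.iInter fun _ => ?_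
  exact measurableSet_eq_fun ((measurable_rad _).comp measurable_fst)
    ((measurable_rad _).comp measurable_snd)

/-- diagonal kernel -/
noncomputable def ker (M s : ℕ) (p : ℝ × ℝ) : ℝ := ∑ j ∈ Finset.range (2 ^ s), e (2 ^ M * j, 2 ^ M * j) p

lemma ker_eq (M s : ℕ) (p : ℝ × ℝ) :
    ker M s p = ∏ m ∈ Finset.range s, (1 + rad (M + m) p.1 * rad (M + m) p.2) := by
  rw [← dirichlet]; rfl

lemma ker_of_notMem (M s : ℕ) (p : ℝ × ℝ) (h : p ∉ bad M s) : ker M s p = 0 := by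
  simp only [bad, Set.mem_ofPred_eq, not_forall] at h
  obtain ⟨m, hm, hne⟩ := h
  rw [ker_eq]
  refine Finset.prod_eq_zero (Finset.mem_range.2 hm) ?_
  rcases rad_or (M + m) p.1 with h1 | h1 <;> rcases rad_or (M + m) p.2 with h2 | h2 <;>
    simp_all

lemma ker_of_mem (M s : ℕ) (p : ℝ × ℝ) (h : p ∈ bad M s) : ker M s p = 2 ^ s := by
  rw [ker_eq]
  rw [Finset.prod_congr rfl (g := fun _ => (2:ℝ))]
  · simp
  · intro m hm
    rw [h m (Finset.mem_range.1 hm), rad_mul_self]; norm_num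

lemma tau_bad (M s : ℕ) : tau (bad M s) ≤ ENNReal.ofReal ((1 / 2) ^ s) := by
  have h_integ : ∫ p, ker M s p ∂tau = 1 := by
    unfold ker
    rw [integral_finsetSum]
    · simp only [integral_e, Prod.mk_eq_zero, and_self]
      have : ∀ j, (2 ^ M * j = 0) ↔ j = 0 := by intro j; simp
      simp [this]
    · intro j _
      exact integrable_of_bdd (measurable_e _) 1 fun p => (abs_e _ p).le
  have hnn : 0 ≤ ker M s := by
    intro p
    by_cases h : p ∈ bad M s
    · rw [ker_of_mem _ _ _ h]; simp
    · rw [ker_of_notMem _ _ _ h]; simp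
  have hI : Integrable (ker M s) tau := by
    unfold ker
    exact integrable_finsetSum _ fun j _ =>
      integrable_of_bdd (measurable_e _) 1 fun p => (abs_e _ p).le
  have := mul_meas_ge_le_integral_of_nonneg (Filter.Eventually.of_forall hnn) hI (2 ^ s)
  rw [h_integ] at this
  have hsub : bad M s ⊆ {x | 2 ^ s ≤ ker M s x} := fun p hp => (ker_of_mem _ _ _ hp).ge
  have h2 : tau.real (bad M s) ≤ tau.real {x | 2 ^ s ≤ ker M s x} := measureReal_mono hsub
  have h3 : tau.real (bad M s) ≤ (1 / 2) ^ s := by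
    rw [one_div, inv_pow, ← one_div, le_div_iff₀ (by positivity)]
    nlinarith [pow_pos (zero_lt_two (α := ℝ)) s]
  rw [← ofReal_measureReal]
  exact ENNReal.ofReal_le_ofReal h3

/-- boxes -/
def box (A B : ℕ) : Finset (ℕ × ℕ) := Finset.Ico A B ×ˢ Finset.Ico A B

lemma mem_box {A B : ℕ} {z : ℕ × ℕ} : z ∈ box A B ↔ (A ≤ z.1 ∧ z.1 < B) ∧ (A ≤ z.2 ∧ z.2 < B) := by
  simp [box]

/-- condition for sub-block support -/
def cond (M s : ℕ) (z : ℕ × ℕ) : Prop :=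
  z.1 / 2 ^ M = z.2 / 2 ^ M ∧ 1 ≤ z.1 / 2 ^ M ∧ z.1 / 2 ^ M < 2 ^ s

/-- coefficients of a sub-block -/
noncomputable def sb (a : ℕ × ℕ → ℝ) (M s : ℕ) (z : ℕ × ℕ) : ℝ :=
  if cond M s z then - a (z.1 % 2 ^ M, z.2 % 2 ^ M) else 0

lemma cond_box {M s : ℕ} {z : ℕ × ℕ} (h : cond M s z) : z ∈ box (2 ^ M) (2 ^ (M + s)) := by
  obtain ⟨h1, h2, h3⟩ := h
  have hp : 0 < 2 ^ M := by positivity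
  rw [mem_box, pow_add]
  have h4 := (Nat.div_lt_iff_lt_mul hp).1 h3
  have h5 := (Nat.le_div_iff_mul_le hp).1 h2
  rw [h1] at h2 h3
  have h6 := (Nat.div_lt_iff_lt_mul hp).1 h3
  have h7 := (Nat.le_div_iff_mul_le hp).1 h2
  rw [mul_comm (2 ^ M)]
  omega

lemma sb_box {a : ℕ × ℕ → ℝ} {M s : ℕ} {z : ℕ × ℕ} (h : sb a M s z ≠ 0) :
    z ∈ box (2 ^ M) (2 ^ (M + s)) := by
  apply cond_box
  by_contra hc
  exact h (if_neg hc)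

lemma sum_cond (M s : ℕ) (F : Finset (ℕ × ℕ)) (hM : ∀ z ∈ F, z.1 < 2 ^ M ∧ z.2 < 2 ^ M)
    (a : ℕ × ℕ → ℝ) (hF : ∀ z, z ∉ F → a z = 0)
    (φ : ℕ × ℕ → ℝ → ℝ) (hφ : ∀ z, φ z 0 = 0) :
    ∑ z ∈ box (2 ^ M) (2 ^ (M + s)), φ z (sb a M s z) =
      ∑ j ∈ Finset.Ico 1 (2 ^ s), ∑ k ∈ F, φ (2 ^ M * j + k.1, 2 ^ M * j + k.2) (- a k) := by
  rw [← Finset.sum_product']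
  symm
  have hp : 0 < 2 ^ M := by positivity
  have hd : ∀ j k, k < 2 ^ M → (2 ^ M * j + k) / 2 ^ M = j ∧ (2 ^ M * j + k) % 2 ^ M = k := by
    intro j k hk
    rw [Nat.mul_add_div hp, Nat.div_eq_of_lt hk, Nat.mul_add_mod, Nat.mod_eq_of_lt hk]; simp
  have hcond : ∀ w ∈ Finset.Ico 1 (2 ^ s) ×ˢ F,
      cond M s (2 ^ M * w.1 + w.2.1, 2 ^ M * w.1 + w.2.2) := by
    intro w hw
    rw [Finset.mem_product, Finset.mem_Ico] at hw
    obtain ⟨h1, h2⟩ := hM _ hw.2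
    simp only [cond, (hd w.1 _ h1).1, (hd w.1 _ h2).1]
    exact ⟨trivial, hw.1⟩
  refine Finset.sum_of_injOn (fun w => (2 ^ M * w.1 + w.2.1, 2 ^ M * w.1 + w.2.2)) ?_ ?_ ?_ ?_
  · rintro ⟨j, k1, k2⟩ hw ⟨j', k1', k2'⟩ hw' heq
    simp only [Prod.mk.injEq] at heq
    have hw := Finset.mem_coe.1 hw
    have hw' := Finset.mem_coe.1 hw'
    rw [Finset.mem_product] at hw hw'
    obtain ⟨h1, h2⟩ := hM _ hw.2
    obtain ⟨h1', h2'⟩ := hM _ hw'.2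
    simp only at h1 h2 h1' h2'
    have e1 := hd j _ h1
    have e2 := hd j _ h2
    have e3 := hd j' _ h1'
    have e4 := hd j' _ h2'
    rw [heq.1] at e1
    rw [heq.2] at e2
    simp only [Prod.mk.injEq]
    exact ⟨e1.1.symm.trans e3.1, e1.2.symm.trans e3.2, e2.2.symm.trans e4.2⟩
  · intro w hw
    exact Finset.mem_coe.2 (cond_box (hcond w (Finset.mem_coe.1 hw)))
  · intro z _ hz
    have : sb a M s z = 0 := by
      unfold sb
      split_ifs with hc
      · rw [hF, neg_zero]
        intro hzF
        apply hz
        refine ⟨(z.1 / 2 ^ M, (z.1 % 2 ^ M, z.2 % 2 ^ M)), ?_, ?_⟩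
        · rw [Finset.mem_coe, Finset.mem_product, Finset.mem_Ico]
          exact ⟨hc.2, hzF⟩
        · simp only
          ext
          · simp only; exact Nat.div_add_mod _ _
          · simp only; rw [hc.1]; exact Nat.div_add_mod _ _
      · rfl
    rw [this, hφ]
  · intro w hw
    have := hcond w hw
    rw [Finset.mem_product] at hw
    obtain ⟨h1, h2⟩ := hM _ hw.2
    simp only [sb, if_pos this, (hd w.1 _ h1).2, (hd w.1 _ h2).2]

lemma ps_sb (M s : ℕ) (F : Finset (ℕ × ℕ)) (hM : ∀ z ∈ F, z.1 < 2 ^ M ∧ z.2 < 2 ^ M)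
    (a : ℕ × ℕ → ℝ) (hF : ∀ z, z ∉ F → a z = 0) (p : ℝ × ℝ) (hp : p ∉ bad M s) :
    ps (box (2 ^ M) (2 ^ (M + s))) (sb a M s) p = ps F a p := by
  unfold ps
  rw [sum_cond M s F hM a hF (fun z t => t * e z p) (by simp)]
  have h1 : ∀ j ∈ Finset.Ico 1 (2 ^ s), ∑ k ∈ F, (- a k) * e (2 ^ M * j + k.1, 2 ^ M * j + k.2) p
      = e (2 ^ M * j, 2 ^ M * j) p * (- ∑ k ∈ F, a k * e k p) := by
    intro j _
    rw [← Finset.sum_neg_distrib, Finset.mul_sum]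
    refine Finset.sum_congr rfl fun k hk => ?_
    obtain ⟨h1, h2⟩ := hM _ hk
    unfold e
    simp only
    rw [walsh_add _ _ _ h1, walsh_add _ _ _ h2]; ring
  rw [Finset.sum_congr rfl h1, ← Finset.sum_mul]
  have h2 := ker_of_notMem M s p hp
  unfold ker at h2
  rw [Finset.range_eq_Ico, Finset.sum_eq_sum_Ico_succ_bot (by positivity)] at h2
  have h3 : e (2 ^ M * 0, 2 ^ M * 0) p = 1 := by simp [e, walsh_zero]
  rw [h3] at h2
  have h4 : ∑ j ∈ Finset.Ico 1 (2 ^ s), e (2 ^ M * j, 2 ^ M * j) p = -1 := by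
    simp only [zero_add] at h2; linarith
  rw [h4]; ring

lemma sum_sb_rpow (M s : ℕ) (F : Finset (ℕ × ℕ)) (hM : ∀ z ∈ F, z.1 < 2 ^ M ∧ z.2 < 2 ^ M)
    (a : ℕ × ℕ → ℝ) (hF : ∀ z, z ∉ F → a z = 0) (q : ℝ) (hq : 0 < q) :
    ∑ z ∈ box (2 ^ M) (2 ^ (M + s)), |sb a M s z| ^ q ≤ 2 ^ s * ∑ k ∈ F, |a k| ^ q := by
  rw [sum_cond M s F hM a hF (fun z t => |t| ^ q) (by simp [Real.zero_rpow hq.ne'])]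
  simp only [abs_neg, Finset.sum_const, Nat.card_Ico, nsmul_eq_mul]
  have : 0 ≤ ∑ k ∈ F, |a k| ^ q := Finset.sum_nonneg fun k _ => by positivity
  apply mul_le_mul_of_nonneg_right _ this
  have h : ((2 ^ s - 1 : ℕ) : ℝ) ≤ ((2 ^ s : ℕ) : ℝ) := Nat.cast_le.2 (Nat.sub_le _ _)
  simpa using h


/-- lower sets of positive indices -/
def Low (G : Finset (ℕ × ℕ)) : Prop :=
  ∀ z ∈ G, ∀ w : ℕ × ℕ, 1 ≤ w.1 → w.1 ≤ z.1 → 1 ≤ w.2 → w.2 ≤ z.2 → w ∈ G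

lemma split_low (G : Finset (ℕ × ℕ)) (hG : Low G) (A B : ℕ → ℕ) (hA : ∀ i, 1 ≤ A i)
    (hAB : ∀ i, A i < B i) (hBA : ∀ i, B i ≤ A (i + 1)) :
    ∃ j, (∀ i < j, box (A i) (B i) ⊆ G) ∧ ¬ box (A j) (B j) ⊆ G ∧
      (∀ i, j < i → ∀ z ∈ G, z ∉ box (A i) (B i)) := by
  have hAi : ∀ i, i < A i := by
    intro i
    induction i with
    | zero => exact hA 0
    | succ i ih => have := hAB i; have := hBA i; omega
  have hmono : Monotone A := monotone_nat_of_le_succ fun i => (hAB i).le.trans (hBA i)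
  have hex : ∃ j, ¬ box (A j) (B j) ⊆ G := by
    refine ⟨G.sup Prod.fst, fun h => ?_⟩
    have h1 : (A (G.sup Prod.fst), A (G.sup Prod.fst)) ∈ G :=
      h (mem_box.2 ⟨⟨le_rfl, hAB _⟩, ⟨le_rfl, hAB _⟩⟩)
    have h2 := Finset.le_sup (f := Prod.fst) h1
    have h3 := hAi (G.sup Prod.fst)
    simp only at h2
    omega
  refine ⟨Nat.find hex, fun i hi => ?_, Nat.find_spec hex, fun i hi z hz hzb => ?_⟩
  · have := Nat.find_min hex hi
    simpa using this
  · apply Nat.find_spec hex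
    intro w hw
    have h1 := hmono (show Nat.find hex + 1 ≤ i from hi)
    have h2 := hBA (Nat.find hex)
    have h3 := hA (Nat.find hex)
    rw [mem_box] at hw hzb
    exact hG z hz w (by omega) (by omega) (by omega) (by omega)

lemma sum_cases {ι : Type*} (S : Finset ι) (b : ι → ℝ)
    (h : ∀ i ∈ S, ∀ j ∈ S, b i ≠ 0 → b j ≠ 0 → i = j) :
    (∑ i ∈ S, b i = 0) ∨ ∃ i ∈ S, ∑ i ∈ S, b i = b i := by
  by_cases hz : ∃ i ∈ S, b i ≠ 0
  · obtain ⟨i, hi, hb⟩ := hz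
    right
    refine ⟨i, hi, Finset.sum_eq_single_of_mem i hi fun j hj hji => ?_⟩
    by_contra hbj
    exact hji (h j hj i hi hbj hb)
  · left
    push Not at hz
    exact Finset.sum_eq_zero hz

lemma rpow_sum_le {ι : Type*} (S : Finset ι) (b : ι → ℝ)
    (h : ∀ i ∈ S, ∀ j ∈ S, b i ≠ 0 → b j ≠ 0 → i = j) (q : ℝ) (hq : 0 < q) :
    |∑ i ∈ S, b i| ^ q ≤ ∑ i ∈ S, |b i| ^ q := by
  rcases sum_cases S b h with h0 | ⟨i, hi, h0⟩
  · rw [h0, abs_zero, Real.zero_rpow hq.ne']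
    exact Finset.sum_nonneg fun i _ => by positivity
  · rw [h0]
    exact Finset.single_le_sum (f := fun i => |b i| ^ q) (fun i _ => by positivity) hi

lemma sum_le_sum_supp (G S : Finset (ℕ × ℕ)) (f : ℕ × ℕ → ℝ) (h0 : ∀ z, 0 ≤ f z)
    (h : ∀ z, f z ≠ 0 → z ∈ S) : ∑ z ∈ G, f z ≤ ∑ z ∈ S, f z := by
  have h1 : ∑ z ∈ G.filter (fun z => z ∈ S), f z = ∑ z ∈ G, f z :=
    Finset.sum_filter_of_ne fun z _ hz => h z hz
  rw [← h1]
  refine Finset.sum_le_sum_of_subset_of_nonneg (fun z hz => (Finset.mem_filter.1 hz).2)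
    fun z _ _ => h0 z

lemma ps_of_supp (G S : Finset (ℕ × ℕ)) (r : ℕ × ℕ → ℝ) (h : ∀ z, r z ≠ 0 → z ∈ S) (hS : S ⊆ G)
    (p : ℝ × ℝ) : ps G r p = ps S r p := by
  unfold ps
  symm
  refine Finset.sum_subset hS fun z _ hz => ?_
  have : r z = 0 := by by_contra h0; exact hz (h z h0)
  rw [this, zero_mul]

lemma ps_of_disj (G S : Finset (ℕ × ℕ)) (r : ℕ × ℕ → ℝ) (h : ∀ z, r z ≠ 0 → z ∈ S)
    (hS : ∀ z ∈ G, z ∉ S) (p : ℝ × ℝ) : ps G r p = 0 := by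
  unfold ps
  refine Finset.sum_eq_zero fun z hz => ?_
  have : r z = 0 := by by_contra h0; exact hS z hz (h z h0)
  rw [this, zero_mul]

lemma exists_t (n : ℕ) (A A2 Aq : ℝ) : ∃ t : ℕ, A ≤ 2 ^ t ∧
    2 ^ (n + 1) * A2 * ((2:ℝ) ^ t)⁻¹ ≤ ((1 / 2) ^ n) ^ 2 ∧
    2 ^ (n + 1) * Aq * ((2:ℝ) ^ t) ^ (-(1 / ((n:ℝ) + 1))) ≤ (1 / 2) ^ n := by
  have h1 : Filter.Tendsto (fun t : ℕ => (2:ℝ) ^ t) Filter.atTop Filter.atTop :=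
    tendsto_pow_atTop_atTop_of_one_lt (by norm_num)
  have h2 := (tendsto_inv_atTop_zero.comp h1).const_mul (2 ^ (n + 1) * A2)
  have h3 := ((tendsto_rpow_neg_atTop (show (0:ℝ) < 1 / ((n:ℝ) + 1) by positivity)).comp
    h1).const_mul (2 ^ (n + 1) * Aq)
  rw [mul_zero] at h2 h3
  have e1 := h1.eventually_ge_atTop A
  have e2 := h2.eventually_le_const (show (0:ℝ) < ((1 / 2) ^ n) ^ 2 by positivity)
  have e3 := h3.eventually_le_const (show (0:ℝ) < (1 / 2) ^ n by positivity)
  exact (e1.and (e2.and e3)).exists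

lemma block (F : Finset (ℕ × ℕ)) (a : ℕ × ℕ → ℝ) (hF : ∀ z, z ∉ F → a z = 0) (N n : ℕ) :
    ∃ (N' : ℕ) (c : ℕ × ℕ → ℝ) (D : Set (ℝ × ℝ)), N < N' ∧ (∀ z, c z ≠ 0 → z ∈ box N N') ∧
      MeasurableSet D ∧ tau D ≤ ENNReal.ofReal ((1 / 2) ^ n) ∧ (∀ z, |c z| ≤ 1) ∧
      ∑ z ∈ box N N', |c z| ^ (2 + 1 / ((n:ℝ) + 1)) ≤ (1 / 2) ^ n ∧
      (∀ G, Low G → ∃ θ : ℝ, 0 ≤ θ ∧ θ ≤ 1 ∧ ∃ r : ℕ × ℕ → ℝ, ∫ p, |ps G r p| ∂tau ≤ (1 / 2) ^ n ∧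
        ∀ p, p ∉ D → ps G c p = θ * ps F a p + ps G r p) ∧
      ∀ G, box N N' ⊆ G → ∀ p, p ∉ D → ps G c p = ps F a p := by
  set q : ℝ := 2 + 1 / ((n:ℝ) + 1) with hq
  have hq0 : 0 < q := by positivity
  obtain ⟨t, ht1, ht2, ht3⟩ := exists_t n (∑ k ∈ F, |a k|) (∑ k ∈ F, |a k| ^ (2:ℝ))
    (∑ k ∈ F, |a k| ^ q)
  set K : ℕ := 2 ^ t with hK
  have hKr : (K:ℝ) = 2 ^ t := by rw [hK]; push_cast; rfl
  have hKpos : (0:ℝ) < K := by rw [hKr]; positivity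
  set s := t + n + 1 with hs
  set M0 := N + F.sup Prod.fst + F.sup Prod.snd with hM0
  set M : ℕ → ℕ := fun i => M0 + i * s with hM
  have hMF : ∀ i, ∀ z ∈ F, z.1 < 2 ^ M i ∧ z.2 < 2 ^ M i := by
    intro i z hz
    have h1 := Finset.le_sup (f := Prod.fst) hz
    have h2 := Finset.le_sup (f := Prod.snd) hz
    have h3 := @Nat.lt_two_pow_self (M i)
    have h4 : M0 ≤ M i := Nat.le_add_right _ _
    omega
  have hMs : ∀ i, M i + s = M (i + 1) := by intro i; simp only [hM]; ring
  have hMmono : Monotone M := monotone_nat_of_le_succ fun i => by rw [← hMs]; omega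
  have hNM : N ≤ 2 ^ M 0 := by
    have h3 := @Nat.lt_two_pow_self (M 0)
    have h4 : M0 ≤ M 0 := Nat.le_add_right _ _
    omega
  have hboxsub : ∀ i < K, box (2 ^ M i) (2 ^ (M i + s)) ⊆ box N (2 ^ M K) := by
    intro i hi z hz
    have h1 : 2 ^ M 0 ≤ 2 ^ M i := Nat.pow_le_pow_right (by norm_num) (hMmono (Nat.zero_le i))
    have h2 : 2 ^ (M i + s) ≤ 2 ^ M K := by
      rw [hMs]; exact Nat.pow_le_pow_right (by norm_num) (hMmono hi)
    rw [mem_box] at hz ⊢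
    omega
  have huniq : ∀ z i j, sb a (M i) s z ≠ 0 → sb a (M j) s z ≠ 0 → i = j := by
    have : ∀ z i j, i < j → sb a (M i) s z ≠ 0 → sb a (M j) s z ≠ 0 → False := by
      intro z i j hij h1 h2
      have b1 := mem_box.1 (sb_box h1)
      have b2 := mem_box.1 (sb_box h2)
      have h2 : 2 ^ (M i + s) ≤ 2 ^ M j := by
        rw [hMs]; exact Nat.pow_le_pow_right (by norm_num) (hMmono hij)
      omega
    intro z i j h1 h2
    rcases lt_trichotomy i j with h | h | h
    · exact (this z i j h h1 h2).elim
    · exact h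
    · exact (this z j i h h2 h1).elim
  set c : ℕ × ℕ → ℝ := fun z => (K:ℝ)⁻¹ * ∑ i ∈ Finset.range K, sb a (M i) s z with hc
  have hcsupp : ∀ z, c z ≠ 0 → z ∈ box N (2 ^ M K) := by
    intro z hz
    have : ∑ i ∈ Finset.range K, sb a (M i) s z ≠ 0 := by
      intro h0; apply hz; simp only [hc, h0, mul_zero]
    obtain ⟨i, hi, hne⟩ := Finset.exists_ne_zero_of_sum_ne_zero this
    exact hboxsub i (Finset.mem_range.1 hi) (sb_box hne)
  have hps : ∀ G p, ps G c p = (K:ℝ)⁻¹ * ∑ i ∈ Finset.range K, ps G (sb a (M i) s) p := by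
    intro G p
    unfold ps
    rw [Finset.sum_comm, Finset.mul_sum]
    refine Finset.sum_congr rfl fun z _ => ?_
    simp only [hc]
    rw [← Finset.sum_mul]; ring
  have hAnn : 0 ≤ ∑ k ∈ F, |a k| := Finset.sum_nonneg fun _ _ => abs_nonneg _
  have hsble : ∀ i z, |sb a (M i) s z| ≤ ∑ k ∈ F, |a k| := by
    intro i z
    unfold sb
    split_ifs with h
    · rw [abs_neg]
      set w := (z.1 % 2 ^ M i, z.2 % 2 ^ M i)
      by_cases hw : w ∈ F
      · exact Finset.single_le_sum (f := fun k => |a k|) (fun _ _ => abs_nonneg _) hw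
      · rw [hF _ hw, abs_zero]; exact hAnn
    · rw [abs_zero]; exact hAnn
  set D : Set (ℝ × ℝ) := ⋃ i ∈ Finset.range K, bad (M i) s with hD
  have hDi : ∀ p, p ∉ D → ∀ i < K, p ∉ bad (M i) s := by
    intro p hp i hi hb
    exact hp (Set.mem_biUnion (Finset.mem_coe.2 (Finset.mem_range.2 hi)) hb)
  refine ⟨2 ^ M K, c, D, ?_, hcsupp, ?_, ?_, ?_, ?_, ?_, ?_⟩
  · have h3 := @Nat.lt_two_pow_self (M K)
    have h4 : M0 ≤ M K := Nat.le_add_right _ _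
    omega
  · exact Finset.measurableSet_biUnion _ fun i _ => measurableSet_bad _ _
  · refine (measure_biUnion_finset_le _ _).trans ?_
    refine (Finset.sum_le_sum fun i _ => tau_bad (M i) s).trans ?_
    rw [Finset.sum_const, Finset.card_range, nsmul_eq_mul, ← ENNReal.ofReal_natCast,
      ← ENNReal.ofReal_mul hKpos.le]
    apply ENNReal.ofReal_le_ofReal
    rw [hKr, hs, pow_add, pow_add, ← mul_assoc, ← mul_assoc, ← mul_pow]
    norm_num
  · intro z
    simp only [hc]
    rw [abs_mul, abs_inv, abs_of_pos hKpos, inv_mul_le_iff₀ hKpos, mul_one, hKr]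
    refine le_trans ?_ ht1
    rcases sum_cases (Finset.range K) (fun i => sb a (M i) s z)
      (fun i _ j _ => huniq z i j) with h0 | ⟨i, _, h0⟩
    · rw [h0, abs_zero]; exact hAnn
    · rw [h0]; exact hsble i z
  · have h1 : ∀ z, |c z| ^ q ≤ (K:ℝ) ^ (-q) * ∑ i ∈ Finset.range K, |sb a (M i) s z| ^ q := by
      intro z
      simp only [hc]
      rw [abs_mul, abs_inv, abs_of_pos hKpos, Real.mul_rpow (by positivity) (abs_nonneg _),
        Real.inv_rpow hKpos.le, ← Real.rpow_neg hKpos.le]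
      exact mul_le_mul_of_nonneg_left (rpow_sum_le _ _ (fun i _ j _ => huniq z i j) q hq0)
        (by positivity)
    have h2 : ∀ i ∈ Finset.range K, ∑ z ∈ box N (2 ^ M K), |sb a (M i) s z| ^ q ≤
        2 ^ s * ∑ k ∈ F, |a k| ^ q := by
      intro i _
      refine le_trans ?_ (sum_sb_rpow (M i) s F (hMF i) a hF q hq0)
      refine sum_le_sum_supp _ _ _ (fun z => by positivity) fun z hz => ?_
      apply sb_box (a := a)
      intro h0; apply hz; rw [h0, abs_zero, Real.zero_rpow hq0.ne']
    calc ∑ z ∈ box N (2 ^ M K), |c z| ^ q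
        ≤ ∑ z ∈ box N (2 ^ M K), (K:ℝ) ^ (-q) * ∑ i ∈ Finset.range K, |sb a (M i) s z| ^ q :=
          Finset.sum_le_sum fun z _ => h1 z
      _ = (K:ℝ) ^ (-q) * ∑ i ∈ Finset.range K, ∑ z ∈ box N (2 ^ M K), |sb a (M i) s z| ^ q := by
          rw [← Finset.mul_sum, Finset.sum_comm]
      _ ≤ (K:ℝ) ^ (-q) * ∑ i ∈ Finset.range K, 2 ^ s * ∑ k ∈ F, |a k| ^ q :=
          mul_le_mul_of_nonneg_left (Finset.sum_le_sum h2) (by positivity)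
      _ = 2 ^ (n + 1) * (∑ k ∈ F, |a k| ^ q) * ((2:ℝ) ^ t) ^ (-(1 / ((n:ℝ) + 1))) := by
          rw [Finset.sum_const, Finset.card_range, nsmul_eq_mul]
          have e1 : (K:ℝ) ^ (-q) = (K:ℝ) ^ (-(1 / ((n:ℝ) + 1))) * ((K:ℝ) ^ 2)⁻¹ := by
            rw [← Real.rpow_natCast, ← Real.rpow_neg hKpos.le, ← Real.rpow_add hKpos]
            congr 1; rw [hq]; push_cast; ring
          have e2 : (2:ℝ) ^ s = K * 2 ^ (n + 1) := by rw [hKr, hs]; ring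
          rw [e1, e2, ← hKr]
          field_simp
      _ ≤ (1 / 2) ^ n := ht3
  · intro G hG
    obtain ⟨j, hj1, _, hj3⟩ := split_low G hG (fun i => 2 ^ M i) (fun i => 2 ^ (M i + s))
      (fun i => Nat.one_le_two_pow) (fun i => Nat.pow_lt_pow_right (by norm_num) (by omega))
      (fun i => by rw [hMs])
    refine ⟨(K:ℝ)⁻¹ * ∑ i ∈ Finset.range K, if i < j then 1 else 0, ?_, ?_,
      fun z => if j < K then (K:ℝ)⁻¹ * sb a (M j) s z else 0, ?_, ?_⟩
    · refine mul_nonneg (by positivity) (Finset.sum_nonneg fun i _ => ?_)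
      split_ifs <;> norm_num
    · rw [inv_mul_le_iff₀ hKpos, mul_one]
      have : ∑ i ∈ Finset.range K, (if i < j then (1:ℝ) else 0) ≤ ∑ i ∈ Finset.range K, (1:ℝ) :=
        Finset.sum_le_sum fun i _ => by split_ifs <;> norm_num
      simpa using this
    · apply integral_abs_ps_le _ _ _ (by positivity)
      refine le_trans ?_ ht2
      have h1 : ∀ z, (if j < K then (K:ℝ)⁻¹ * sb a (M j) s z else 0) ^ 2 ≤
          ((K:ℝ)⁻¹) ^ 2 * |sb a (M j) s z| ^ (2:ℝ) := by
        intro z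
        split_ifs
        · rw [mul_pow, ← sq_abs (sb a (M j) s z)]; norm_cast
        · rw [zero_pow (by norm_num)]; positivity
      calc ∑ z ∈ G, (if j < K then (K:ℝ)⁻¹ * sb a (M j) s z else 0) ^ 2
          ≤ ∑ z ∈ G, ((K:ℝ)⁻¹) ^ 2 * |sb a (M j) s z| ^ (2:ℝ) := Finset.sum_le_sum fun z _ => h1 z
        _ = ((K:ℝ)⁻¹) ^ 2 * ∑ z ∈ G, |sb a (M j) s z| ^ (2:ℝ) := by rw [Finset.mul_sum]
        _ ≤ ((K:ℝ)⁻¹) ^ 2 * (2 ^ s * ∑ k ∈ F, |a k| ^ (2:ℝ)) := by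
          refine mul_le_mul_of_nonneg_left ?_ (by positivity)
          refine le_trans ?_ (sum_sb_rpow (M j) s F (hMF j) a hF 2 (by norm_num))
          refine sum_le_sum_supp _ _ _ (fun z => by positivity) fun z hz => ?_
          apply sb_box (a := a)
          intro h0; apply hz; rw [h0, abs_zero, Real.zero_rpow (by norm_num)]
        _ = 2 ^ (n + 1) * (∑ k ∈ F, |a k| ^ (2:ℝ)) * ((2:ℝ) ^ t)⁻¹ := by
          have e2 : (2:ℝ) ^ s = K * 2 ^ (n + 1) := by rw [hKr, hs]; ring
          rw [e2, ← hKr]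
          field_simp
    · intro p hp
      have h1 : ∀ i ∈ Finset.range K, ps G (sb a (M i) s) p =
          (if i < j then 1 else 0) * ps F a p + (if i = j then ps G (sb a (M j) s) p else 0) := by
        intro i hi
        have hi := Finset.mem_range.1 hi
        rcases lt_trichotomy i j with h | h | h
        · rw [if_pos h, if_neg (by omega), one_mul, add_zero,
            ps_of_supp G _ _ (fun z hz => sb_box hz) (hj1 i h),
            ps_sb _ _ F (hMF i) a hF p (hDi p hp i hi)]
        · subst h; simp
        · rw [if_neg (by omega), if_neg (by omega), zero_mul, add_zero,
            ps_of_disj G _ _ (fun z hz => sb_box hz) (hj3 i h)]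
      rw [hps, Finset.sum_congr rfl h1, Finset.sum_add_distrib, ← Finset.sum_mul, mul_add, mul_assoc]
      congr 1
      rw [Finset.sum_ite_eq']
      simp only [Finset.mem_range]
      split_ifs
      · unfold ps; rw [Finset.mul_sum]
        exact Finset.sum_congr rfl fun z _ => by ring
      · simp [ps]
  · intro G hG p hp
    have h1 : ∀ i ∈ Finset.range K, ps G (sb a (M i) s) p = ps F a p := by
      intro i hi
      have hi := Finset.mem_range.1 hi
      rw [ps_of_supp G _ _ (fun z hz => sb_box hz) ((hboxsub i hi).trans hG),
            ps_sb _ _ F (hMF i) a hF p (hDi p hp i hi)]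
    rw [hps, Finset.sum_congr rfl h1, Finset.sum_const, Finset.card_range, nsmul_eq_mul]
    field_simp


lemma greedy {X : Type*} [NormedAddCommGroup X] (N : ℕ → ℕ) (hN1 : 1 ≤ N 0)
    (hN : ∀ i, N i < N (i + 1)) (v : ℕ → ℕ × ℕ → X)
    (hv : ∀ n z, v n z ≠ 0 → z ∈ box (N n) (N (n + 1))) (f : ℕ → X) (n0 : ℕ) (η : ℕ → ℝ)
    (hη : Filter.Tendsto η Filter.atTop (nhds 0))
    (hdense : ∀ x : X, ∀ δ : ℝ, 0 < δ → ∀ m : ℕ, ∃ n, m ≤ n ∧ ‖x - f n‖ < δ)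
    (hpart : ∀ n, n0 ≤ n → ∀ G, Low G → ‖∑ z ∈ G, v n z‖ ≤ ‖f n‖ + η n)
    (hfull : ∀ n, n0 ≤ n → ∀ G, box (N n) (N (n + 1)) ⊆ G → ‖∑ z ∈ G, v n z - f n‖ ≤ η n)
    (x : X) : ∃ J : Set ℕ, ∀ ε : ℝ, 0 < ε → ∃ N0 : ℕ, 1 ≤ N0 ∧ ∀ G, Low G → (N0, N0) ∈ G →
      ∀ I : ℕ, (∀ z ∈ G, z.1 < I) →
      ‖∑ n ∈ (Finset.range I).filter (fun n => n ∈ J), ∑ z ∈ G, v n z - x‖ < ε := by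
  have hNmono : StrictMono N := strictMono_nat_of_lt_succ hN
  have hd : ∀ (y : X) (j m : ℕ), ∃ n, m ≤ n ∧ ‖y - f n‖ < 1 / ((j:ℝ) + 1) :=
    fun y j m => hdense y _ (by positivity) m
  choose φ hφ1 hφ2 using hd
  set Q : ℕ → X := fun n => ∑ z ∈ box (N n) (N (n + 1)), v n z with hQ
  set st : ℕ → X × ℕ := fun j => Nat.rec (x, n0)
    (fun j s => (s.1 - Q (φ s.1 j s.2), φ s.1 j s.2 + 1)) j with hst
  set nn : ℕ → ℕ := fun j => φ (st j).1 j (st j).2 with hnn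
  set g : ℕ → X := fun j => (st j).1 with hg
  have hg0 : g 0 = x := rfl
  have hgs : ∀ j, g (j + 1) = g j - Q (nn j) := fun j => rfl
  have hst2 : ∀ j, (st (j + 1)).2 = nn j + 1 := fun j => rfl
  have hnns : ∀ j, nn j < nn (j + 1) := by
    intro j
    have := hφ1 (st (j + 1)).1 (j + 1) (st (j + 1)).2
    rw [hst2] at this
    exact this
  have hmono : StrictMono nn := strictMono_nat_of_lt_succ hnns
  have hn0 : ∀ j, n0 ≤ nn j := by
    intro j
    exact (hφ1 (st 0).1 0 (st 0).2).trans (hmono.monotone (Nat.zero_le j))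
  have hclose : ∀ j, ‖g j - f (nn j)‖ < 1 / ((j:ℝ) + 1) := fun j => hφ2 (st j).1 j (st j).2
  have hgsum : ∀ j, g j = x - ∑ i ∈ Finset.range j, Q (nn i) := by
    intro j
    induction j with
    | zero => simp [hg0]
    | succ j ih => rw [hgs, ih, Finset.sum_range_succ]; abel
  have hone : Filter.Tendsto (fun j : ℕ => 1 / ((j:ℝ) + 1)) Filter.atTop (nhds 0) :=
    tendsto_one_div_add_atTop_nhds_zero_nat
  have hηn : Filter.Tendsto (fun j => η (nn j)) Filter.atTop (nhds 0) :=
    hη.comp hmono.tendsto_atTop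
  have hgnext : ∀ j, ‖g (j + 1)‖ ≤ 1 / ((j:ℝ) + 1) + η (nn j) := by
    intro j
    have h1 := hfull (nn j) (hn0 j) _ (Finset.Subset.refl _)
    have h2 : g (j + 1) = (g j - f (nn j)) - (Q (nn j) - f (nn j)) := by rw [hgs]; abel
    rw [h2]
    exact (norm_sub_le _ _).trans (add_le_add (hclose j).le h1)
  have hgt : Filter.Tendsto (fun j => ‖g j‖) Filter.atTop (nhds 0) := by
    rw [← Filter.tendsto_add_atTop_iff_nat 1]
    refine squeeze_zero (fun _ => norm_nonneg _) hgnext ?_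
    simpa using hone.add hηn
  have hbound : Filter.Tendsto (fun j : ℕ => ‖g j‖ + (‖g j‖ + 1 / ((j:ℝ) + 1) + η (nn j)))
      Filter.atTop (nhds 0) := by
    simpa using hgt.add ((hgt.add hone).add hηn)
  refine ⟨Set.range nn, fun ε hε => ?_⟩
  obtain ⟨j0, hj0⟩ := Filter.eventually_atTop.1 (hbound.eventually_lt_const hε)
  refine ⟨N (nn j0 + 1), hN1.trans (hNmono.monotone (Nat.zero_le _)), fun G hG hmem I hI => ?_⟩
  obtain ⟨j, hj1, hj2, hj3⟩ := split_low G hG (fun i => N (nn i)) (fun i => N (nn i + 1))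
    (fun i => hN1.trans (hNmono.monotone (Nat.zero_le _))) (fun i => hN _)
    (fun i => hNmono.monotone (hnns i))
  have hjj : j0 ≤ j := by
    by_contra hlt
    apply hj2
    intro w hw
    have h1 : N (nn j + 1) ≤ N (nn j0 + 1) :=
      hNmono.monotone (by have := hmono (show j < j0 by omega); omega)
    have h2 : 1 ≤ N (nn j) := hN1.trans (hNmono.monotone (Nat.zero_le _))
    have hw := mem_box.1 hw
    exact hG _ hmem w (by omega) (by simp only; omega) (by omega) (by simp only; omega)
  set h : ℕ → X := fun n => ∑ z ∈ G, v n z with hh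
  have hdisj : ∀ n, (∀ z ∈ G, z ∉ box (N n) (N (n + 1))) → h n = 0 := by
    intro n hz
    refine Finset.sum_eq_zero fun z hzG => ?_
    by_contra h0
    exact hz z hzG (hv n z h0)
  have hbig : ∀ n, I ≤ n → h n = 0 := by
    intro n hn
    refine hdisj n fun z hz hzb => ?_
    have h1 := hI z hz
    have h2 := mem_box.1 hzb
    have h3 := hNmono.le_apply (x := n)
    omega
  have hlate : ∀ i, j < i → h (nn i) = 0 := fun i hi => hdisj _ (hj3 i hi)
  have hearly : ∀ i < j, h (nn i) = Q (nn i) := by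
    intro i hi
    symm
    refine Finset.sum_subset (hj1 i hi) fun z _ hz => ?_
    by_contra h0
    exact hz (hv _ z h0)
  have hsum : ∑ n ∈ (Finset.range I).filter (fun n => n ∈ Set.range nn), h n =
      ∑ i ∈ Finset.range (j + 1), h (nn i) := by
    rw [← Finset.sum_image (f := h) (s := Finset.range (j + 1)) (g := nn)
      (fun a _ b _ hab => hmono.injective hab)]
    apply Finset.sum_congr_of_eq_on_inter
    · intro n hn hn2
      obtain ⟨i, rfl⟩ := (Finset.mem_filter.1 hn).2
      apply hlate
      by_contra hc
      exact hn2 (Finset.mem_image_of_mem _ (Finset.mem_range.2 (by omega)))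
    · intro n hn hn2
      obtain ⟨i, _, rfl⟩ := Finset.mem_image.1 hn
      apply hbig
      by_contra hc
      exact hn2 (Finset.mem_filter.2 ⟨Finset.mem_range.2 (by omega), i, rfl⟩)
    · intro n _ _; rfl
  have hfin : ∑ n ∈ (Finset.range I).filter (fun n => n ∈ Set.range nn), h n - x =
      h (nn j) - g j := by
    rw [hsum, Finset.sum_range_succ, Finset.sum_congr rfl
      (fun i hi => hearly i (Finset.mem_range.1 hi)), hgsum]
    abel
  have hfnn : ‖f (nn j)‖ ≤ ‖g j‖ + 1 / ((j:ℝ) + 1) := by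
    have : f (nn j) = g j - (g j - f (nn j)) := by abel
    rw [this]
    exact (norm_sub_le _ _).trans (add_le_add le_rfl (hclose j).le)
  rw [hfin]
  have h1 := norm_sub_le (h (nn j)) (g j)
  have h2 := hpart (nn j) (hn0 j) G hG
  have h3 := hj0 j hjj
  simp only [hh] at h1 ⊢
  linarith


lemma kernel_eq (L : ℕ) (p p' : ℝ × ℝ) :
    ∑ z ∈ box 0 (2 ^ L), e z p * e z p' = ker 0 L (p.1, p'.1) * ker 0 L (p.2, p'.2) := by
  unfold ker box e
  rw [Finset.sum_mul_sum, Finset.sum_product]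
  simp only [pow_zero, one_mul, Finset.range_eq_Ico]
  refine Finset.sum_congr rfl fun i _ => Finset.sum_congr rfl fun j _ => by ring

lemma ker_nonneg (M s : ℕ) (p : ℝ × ℝ) : 0 ≤ ker M s p := by
  by_cases h : p ∈ bad M s
  · rw [ker_of_mem _ _ _ h]; positivity
  · rw [ker_of_notMem _ _ _ h]

lemma ae_tau : ∀ᵐ p ∂tau, (0 ≤ p.1 ∧ p.1 < 1) ∧ (0 ≤ p.2 ∧ p.2 < 1) := by
  have h : ∀ᵐ x ∂((volume : Measure ℝ).restrict (Set.Icc 0 1)), 0 ≤ x ∧ x < 1 := by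
    rw [← Measure.restrict_congr_set (Ico_ae_eq_Icc (μ := volume) (a := (0:ℝ)) (b := 1))]
    exact ae_restrict_mem measurableSet_Ico
  rw [tau_eq]
  exact (Measure.quasiMeasurePreserving_fst.ae h).and (Measure.quasiMeasurePreserving_snd.ae h)

lemma approx_cont (g : ℝ × ℝ → ℝ) (hg : Continuous g) (hc : HasCompactSupport g) (η : ℝ) (hη : 0 < η) :
    ∃ L : ℕ, ∃ α : ℕ × ℕ → ℝ, ∀ p : ℝ × ℝ, (0 ≤ p.1 ∧ p.1 < 1) ∧ (0 ≤ p.2 ∧ p.2 < 1) →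
      |g p - ps (box 0 (2 ^ L)) α p| ≤ η := by
  have huc : UniformContinuous g := hc.uniformContinuous_of_continuous hg
  obtain ⟨δ, hδ, hgδ⟩ := Metric.uniformContinuous_iff.1 huc η hη
  obtain ⟨L, hL⟩ := exists_pow_lt_of_lt_one hδ (show (1/2:ℝ) < 1 by norm_num)
  obtain ⟨C, hC⟩ := hc.exists_bound_of_continuous hg
  refine ⟨L, fun z => ∫ p, g p * e z p ∂tau, fun p hp => ?_⟩
  set kk : ℝ × ℝ → ℝ := fun p' => ∑ z ∈ box 0 (2 ^ L), e z p * e z p' with hkk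
  have hkk' : kk = ps (box 0 (2 ^ L)) (fun z => e z p) := rfl
  have hkm : Measurable kk := by rw [hkk']; exact measurable_ps _ _
  have hkb : ∀ p', |kk p'| ≤ ∑ z ∈ box 0 (2 ^ L), |e z p| := by
    rw [hkk']; exact abs_ps_le _ _
  have hki : Integrable kk tau := integrable_of_bdd hkm _ hkb
  have hC0 : 0 ≤ C := (norm_nonneg _).trans (hC 0)
  have hgki : Integrable (fun p' => g p' * kk p') tau :=
    integrable_of_bdd (hg.measurable.mul hkm) (C * ∑ z ∈ box 0 (2 ^ L), |e z p|) fun p' => by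
      rw [abs_mul]
      exact mul_le_mul (hC p') (hkb p') (abs_nonneg _) hC0
  have hk1 : ∫ p', kk p' ∂tau = 1 := by
    simp only [hkk]
    rw [integral_finsetSum _ fun z _ => (integrable_of_bdd (measurable_e z) 1
      fun p => (abs_e z p).le).const_mul _]
    simp only [integral_const_mul, integral_e]
    have : (0 : ℕ × ℕ) ∈ box 0 (2 ^ L) := by rw [mem_box]; simp
    simp only [mul_ite, mul_one, mul_zero, Finset.sum_ite_eq', this, if_true]
    simp [e, walsh_zero]
  have hps : ps (box 0 (2 ^ L)) (fun z => ∫ p, g p * e z p ∂tau) p = ∫ p', g p' * kk p' ∂tau := by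
    unfold ps
    simp only [hkk, Finset.mul_sum]
    rw [integral_finsetSum]
    · refine Finset.sum_congr rfl fun z _ => ?_
      rw [← integral_mul_const]
      congr 1; ext p'; ring
    · intro z _
      refine integrable_of_bdd (hg.measurable.mul ((measurable_e z).const_mul _)) C fun p' => ?_
      rw [abs_mul, abs_mul, abs_e, abs_e, one_mul, mul_one]; exact hC p'
  have hkn : ∀ p', 0 ≤ kk p' := fun p' => by
    simp only [hkk, kernel_eq]; exact mul_nonneg (ker_nonneg _ _ _) (ker_nonneg _ _ _)
  have e1 : g p - ∫ p', g p' * kk p' ∂tau = ∫ p', (g p - g p') * kk p' ∂tau := by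
    simp only [sub_mul]
    rw [integral_sub (hki.const_mul _) hgki, integral_const_mul, hk1, mul_one]
  rw [hps, e1]
  calc |∫ p', (g p - g p') * kk p' ∂tau| ≤ ∫ p', η * kk p' ∂tau := by
        rw [← Real.norm_eq_abs]
        refine norm_integral_le_of_norm_le (hki.const_mul η) ?_
        filter_upwards [ae_tau] with p' hp'
        rw [Real.norm_eq_abs, abs_mul, abs_of_nonneg (hkn p')]
        by_cases h0 : kk p' = 0
        · rw [h0]; simp
        · refine mul_le_mul_of_nonneg_right ?_ (hkn p')
          simp only [hkk, kernel_eq] at h0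
          have h1 : (p.1, p'.1) ∈ bad 0 L := by
            by_contra hb; apply h0; rw [ker_of_notMem _ _ _ hb, zero_mul]
          have h2 : (p.2, p'.2) ∈ bad 0 L := by
            by_contra hb; apply h0; rw [ker_of_notMem _ _ _ hb, mul_zero]
          have c1 := agree_close L p.1 p'.1 hp.1.1 hp.1.2 hp'.1.1 hp'.1.2
            (fun m hm => by have := h1 m hm; simpa using this)
          have c2 := agree_close L p.2 p'.2 hp.2.1 hp.2.2 hp'.2.1 hp'.2.2
            (fun m hm => by have := h2 m hm; simpa using this)
          have : dist p p' < δ := by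
            rw [Prod.dist_eq, Real.dist_eq, Real.dist_eq]
            exact lt_of_le_of_lt (max_le c1 c2) hL
          have := hgδ this
          rw [Real.dist_eq] at this
          exact this.le
    _ = η := by rw [integral_const_mul, hk1, mul_one]

/-- Walsh polynomial with rational coefficients -/
noncomputable def poly (a : (ℕ × ℕ) →₀ ℚ) : ℝ × ℝ → ℝ := ps a.support (fun z => (a z : ℝ))

lemma dense_poly (ν : Measure (ℝ × ℝ)) [IsFiniteMeasure ν] (hν : ν ≪ tau) (g : ℝ × ℝ → ℝ)
    (hg : Integrable g ν) (δ : ℝ) (hδ : 0 < δ) :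
    ∃ a : (ℕ × ℕ) →₀ ℚ, ∫ p, |g p - poly a p| ∂ν < δ := by
  obtain ⟨g1, hcs, hle, hcont, h_integ⟩ :=
    hg.exists_hasCompactSupport_integral_sub_le (show 0 < δ / 3 by positivity)
  set V := ν.real Set.univ with hV
  have hV0 : 0 ≤ V := measureReal_nonneg
  set η := δ / (3 * (V + 1)) with hη
  have hη0 : 0 < η := by positivity
  obtain ⟨L, α, hα⟩ := approx_cont g1 hcont hcs η hη0
  set S := box 0 (2 ^ L) with hS
  have hSc : 0 < ((S.card : ℝ) + 1) := by positivity
  have hrat : ∀ z, ∃ r : ℚ, |α z - r| < η / ((S.card : ℝ) + 1) := by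
    intro z
    obtain ⟨r, hr1, hr2⟩ := exists_rat_btwn (show α z < α z + η / ((S.card : ℝ) + 1) by
      have : 0 < η / ((S.card : ℝ) + 1) := by positivity
      linarith)
    refine ⟨r, ?_⟩
    rw [abs_lt]; constructor <;> linarith
  choose r hr using hrat
  set a : (ℕ × ℕ) →₀ ℚ := Finsupp.onFinset S (fun z => if z ∈ S then r z else 0) (by
    intro z hz; by_contra h; simp [h] at hz) with ha
  have hapoly : ∀ p, poly a p = ps S (fun z => (r z : ℝ)) p := by
    intro p
    unfold poly
    rw [← ps_of_supp S a.support (fun z => (a z : ℝ)) (fun z hz => by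
      rw [Finsupp.mem_support_iff]; intro h0; apply hz; rw [h0]; simp)
      (Finsupp.support_onFinset_subset)]
    unfold ps
    refine Finset.sum_congr rfl fun z hz => ?_
    simp [ha, hz]
  have hdiff : ∀ p, |ps S α p - poly a p| ≤ η := by
    intro p
    have : ps S α p - poly a p = ps S (fun z => α z - r z) p := by
      rw [hapoly]; unfold ps; rw [← Finset.sum_sub_distrib]
      exact Finset.sum_congr rfl fun z _ => by ring
    rw [this]
    refine (abs_ps_le _ _ _).trans ?_
    refine (Finset.sum_le_sum fun z _ => (hr z).le).trans ?_
    rw [Finset.sum_const, nsmul_eq_mul]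
    rw [mul_div_assoc', div_le_iff₀ hSc]
    nlinarith
  refine ⟨a, ?_⟩
  have hpi : Integrable (poly a) ν := integrable_ps _ _
  have h2 : ∫ p, |g p - poly a p| ∂ν ≤ ∫ p, (‖g p - g1 p‖ + 2 * η) ∂ν := by
    refine integral_mono_ae (hg.sub hpi).abs ((hg.sub h_integ).norm.add (integrable_const _)) ?_
    filter_upwards [hν.ae_le ae_tau] with p hp
    have h1 := hα p hp
    have h2 := hdiff p
    have e : g p - poly a p = (g p - g1 p) + ((g1 p - ps S α p) + (ps S α p - poly a p)) := by ring
    rw [e, Real.norm_eq_abs]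
    have h3 := abs_add_le (g p - g1 p) ((g1 p - ps S α p) + (ps S α p - poly a p))
    have h4 := abs_add_le (g1 p - ps S α p) (ps S α p - poly a p)
    linarith
  have hni : Integrable (fun p => ‖g p - g1 p‖) ν := (hg.sub h_integ).norm
  rw [integral_add hni (integrable_const _), integral_const, smul_eq_mul] at h2
  have h3 : V * (2 * η) < 2 * δ / 3 := by
    rw [hη]
    rw [show V * (2 * (δ / (3 * (V + 1)))) = (2 * δ / 3) * (V / (V + 1)) by field_simp]
    have : V / (V + 1) < 1 := by rw [div_lt_one (by positivity)]; linarith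
    nlinarith
  rw [← hV] at h2
  linarith


lemma exists_blocks : ∃ (P : ℕ → (ℕ × ℕ) →₀ ℚ) (N : ℕ → ℕ) (c : ℕ → ℕ × ℕ → ℝ)
    (D : ℕ → Set (ℝ × ℝ)), (∀ a m, ∃ n, m ≤ n ∧ P n = a) ∧ 1 ≤ N 0 ∧ (∀ n, N n < N (n + 1)) ∧
    (∀ n z, c n z ≠ 0 → z ∈ box (N n) (N (n + 1))) ∧
    (∀ n, MeasurableSet (D n)) ∧ (∀ n, tau (D n) ≤ ENNReal.ofReal ((1 / 2) ^ n)) ∧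
    (∀ n z, |c n z| ≤ 1) ∧
    (∀ n : ℕ, ∑ z ∈ box (N n) (N (n + 1)), |c n z| ^ (2 + 1 / ((n:ℝ) + 1)) ≤ (1 / 2) ^ n) ∧
    (∀ n G, Low G → ∃ θ : ℝ, 0 ≤ θ ∧ θ ≤ 1 ∧ ∃ r : ℕ × ℕ → ℝ,
      ∫ p, |ps G r p| ∂tau ≤ (1 / 2) ^ n ∧
        ∀ p, p ∉ D n → ps G (c n) p = θ * poly (P n) p + ps G r p) ∧
    ∀ n G, box (N n) (N (n + 1)) ⊆ G → ∀ p, p ∉ D n → ps G (c n) p = poly (P n) p := by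
  obtain ⟨en, hen⟩ := exists_surjective_nat ((ℕ × ℕ) →₀ ℚ)
  set P : ℕ → (ℕ × ℕ) →₀ ℚ := fun n => en (Nat.unpair n).1 with hP
  have hb := fun n N => block (P n).support (fun z => (P n z : ℝ)) (fun z hz => by
    rw [Finsupp.notMem_support_iff.1 hz]; simp) N n
  choose N' c D h1 h2 h3 h4 h5 h6 h7 h8 using hb
  set Ns : ℕ → ℕ := fun n => Nat.rec 1 (fun n N => N' n N) n with hNs
  refine ⟨P, Ns, fun n => c n (Ns n), fun n => D n (Ns n), ?_, le_rfl, fun n => h1 n (Ns n),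
    fun n => h2 n (Ns n), fun n => h3 n (Ns n), fun n => h4 n (Ns n), fun n => h5 n (Ns n),
    fun n => h6 n (Ns n), fun n => h7 n (Ns n), fun n => h8 n (Ns n)⟩
  intro a m
  obtain ⟨i, rfl⟩ := hen a
  refine ⟨Nat.pair i m, Nat.right_le_pair i m, ?_⟩
  simp [hP]

lemma exists_weight (D : ℕ → Set (ℝ × ℝ)) (hD : ∀ n, MeasurableSet (D n))
    (hDt : ∀ n, tau (D n) ≤ ENNReal.ofReal ((1 / 2) ^ n)) (w : ℕ → ℝ) (hw0 : ∀ n, 0 < w n)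
    (hw1 : ∀ n, w n ≤ 1) (n0 : ℕ) : ∃ μ : ℝ × ℝ → ℝ, Measurable μ ∧ (∀ p, 0 < μ p ∧ μ p ≤ 1) ∧
      (∀ p, (∀ n, n0 ≤ n → p ∉ D n) → μ p = 1) ∧
      ∀ᵐ p ∂tau, ∀ n, n0 ≤ n → p ∈ D n → μ p ≤ w n := by
  set Z : Set (ℝ × ℝ) := Filter.limsup D Filter.atTop with hZ
  have hZm : MeasurableSet Z := MeasurableSet.measurableSet_limsup hD
  set u : ℕ → ℝ × ℝ → ℝ := fun n p => if n0 ≤ n ∧ p ∈ D n then w n else 1 with hu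
  have hum : ∀ n, Measurable (u n) := by
    intro n
    refine Measurable.ite ?_ measurable_const measurable_const
    by_cases h : n0 ≤ n
    · simpa [h] using hD n
    · simp [h]
  have hu0 : ∀ n p, 0 < u n p := by
    intro n p; simp only [hu]; split_ifs
    · exact hw0 n
    · exact one_pos
  have hu1 : ∀ n p, u n p ≤ 1 := by
    intro n p; simp only [hu]; split_ifs
    · exact hw1 n
    · exact le_rfl
  have hbdd : ∀ p, BddBelow (Set.range fun n => u n p) := by
    intro p; refine ⟨0, ?_⟩; rintro _ ⟨n, rfl⟩; exact (hu0 n p).le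
  have hsum : ∑' n, tau (D n) ≠ ∞ := by
    refine ne_top_of_le_ne_top ?_ (ENNReal.tsum_le_tsum hDt)
    rw [← ENNReal.ofReal_tsum_of_nonneg (fun n => by positivity) summable_geometric_two]
    exact ENNReal.ofReal_ne_top
  refine ⟨fun p => if p ∈ Z then 1 else ⨅ n, u n p, ?_, ?_, ?_, ?_⟩
  · exact Measurable.ite hZm measurable_const (Measurable.iInf hum)
  · intro p
    simp only
    split_ifs with hp
    · exact ⟨one_pos, le_rfl⟩
    · refine ⟨?_, (ciInf_le (hbdd p) 0).trans (hu1 0 p)⟩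
      have hev : ∃ m, ∀ n, m ≤ n → p ∉ D n := by
        by_contra hc
        push Not at hc
        apply hp
        rw [hZ, Filter.mem_limsup_iff_frequently_mem, Filter.frequently_atTop]
        exact hc
      obtain ⟨m, hm⟩ := hev
      have hpos : 0 < ∏ n ∈ Finset.range m, u n p := Finset.prod_pos fun n _ => hu0 n p
      refine lt_of_lt_of_le hpos (le_ciInf fun n => ?_)
      by_cases hn : n < m
      · rw [← Finset.mul_prod_erase _ _ (Finset.mem_range.2 hn)]
        refine mul_le_of_le_one_right (hu0 n p).le ?_
        exact Finset.prod_le_one (fun i _ => (hu0 i p).le) fun i _ => hu1 i p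
      · have : u n p = 1 := by
          simp only [hu]; rw [if_neg]; rintro ⟨_, h⟩; exact hm n (by omega) h
        rw [this]
        exact Finset.prod_le_one (fun i _ => (hu0 i p).le) fun i _ => hu1 i p
  · intro p hp
    simp only
    split_ifs
    · rfl
    · have : ∀ n, u n p = 1 := by
        intro n; simp only [hu]; rw [if_neg]; rintro ⟨h1, h2⟩; exact hp n h1 h2
      simp [this]
  · filter_upwards [ae_eventually_notMem hsum] with p hp n hn hpn
    have hpZ : p ∉ Z := by
      rw [hZ, Filter.mem_limsup_iff_frequently_mem]
      simpa [Filter.not_frequently] using hp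
    rw [if_neg hpZ]
    refine (ciInf_le (hbdd p) n).trans ?_
    simp only [hu]; rw [if_pos ⟨hn, hpn⟩]

/-- glued coefficients -/
noncomputable def ct (c : ℕ → ℕ × ℕ → ℝ) (z : ℕ × ℕ) : ℝ := ∑ n ∈ Finset.range (z.1 + 1), c n z

lemma box_uniq (N : ℕ → ℕ) (hN : ∀ n, N n < N (n + 1))
    (z : ℕ × ℕ) (i j : ℕ) (hi : z ∈ box (N i) (N (i + 1)))
    (hj : z ∈ box (N j) (N (j + 1))) : i = j := by
  have hm : StrictMono N := strictMono_nat_of_lt_succ hN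
  have hi := mem_box.1 hi
  have hj := mem_box.1 hj
  rcases lt_trichotomy i j with h | h | h
  · have := hm.monotone (show i + 1 ≤ j from h); omega
  · exact h
  · have := hm.monotone (show j + 1 ≤ i from h); omega

lemma c_zero (N : ℕ → ℕ) (hN : ∀ n, N n < N (n + 1)) (c : ℕ → ℕ × ℕ → ℝ)
    (hc : ∀ n z, c n z ≠ 0 → z ∈ box (N n) (N (n + 1)))
    (z : ℕ × ℕ) (n : ℕ) (h : z.1 < n) : c n z = 0 := by
  have hm : StrictMono N := strictMono_nat_of_lt_succ hN
  by_contra h0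
  have h1 := mem_box.1 (hc n z h0)
  have h2 := hm.le_apply (x := n)
  omega

lemma ct_eq (N : ℕ → ℕ) (hN : ∀ n, N n < N (n + 1)) (c : ℕ → ℕ × ℕ → ℝ)
    (hc : ∀ n z, c n z ≠ 0 → z ∈ box (N n) (N (n + 1)))
    (z : ℕ × ℕ) (I : ℕ) (h : z.1 < I) : ct c z = ∑ n ∈ Finset.range I, c n z := by
  unfold ct
  refine Finset.sum_subset (Finset.range_mono h) fun n _ hn => ?_
  apply c_zero N hN c hc
  simpa using hn

lemma ct_B (N : ℕ → ℕ) (hN : ∀ n, N n < N (n + 1)) (c : ℕ → ℕ × ℕ → ℝ)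
    (hc : ∀ n z, c n z ≠ 0 → z ∈ box (N n) (N (n + 1)))
    (J : Set ℕ) (z : ℕ × ℕ) (I : ℕ) (h : z.1 < I) :
    (if z ∈ {z : ℕ × ℕ | ∃ n ∈ J, z ∈ box (N n) (N (n + 1))} then ct c z else 0) =
      ∑ n ∈ (Finset.range I).filter (fun n => n ∈ J), c n z := by
  split_ifs with hz
  · obtain ⟨n, hnJ, hzn⟩ := hz
    have h0 : ∀ m, m ≠ n → c m z = 0 := by
      intro m hm
      by_contra hne
      exact hm (box_uniq N hN z m n (hc m z hne) hzn)
    have hnI : n < I := by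
      have h1 := mem_box.1 hzn
      have h2 := (strictMono_nat_of_lt_succ hN).le_apply (x := n)
      omega
    rw [ct_eq N hN c hc z I h, Finset.sum_eq_single_of_mem n (Finset.mem_range.2 hnI)
      (fun m _ hm => h0 m hm), Finset.sum_eq_single_of_mem n
      (Finset.mem_filter.2 ⟨Finset.mem_range.2 hnI, hnJ⟩) (fun m _ hm => h0 m hm)]
  · symm
    refine Finset.sum_eq_zero fun n hn => ?_
    by_contra hne
    exact hz ⟨n, (Finset.mem_filter.1 hn).2, hc n z hne⟩

lemma summable_ct (N : ℕ → ℕ) (hN : ∀ n, N n < N (n + 1)) (c : ℕ → ℕ × ℕ → ℝ)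
    (hc : ∀ n z, c n z ≠ 0 → z ∈ box (N n) (N (n + 1)))
    (hc1 : ∀ n z, |c n z| ≤ 1)
    (hcs : ∀ n : ℕ, ∑ z ∈ box (N n) (N (n + 1)), |c n z| ^ (2 + 1 / ((n:ℝ) + 1)) ≤ (1 / 2) ^ n)
    (q : ℝ) (hq : 2 < q) : Summable (fun z => |ct c z| ^ q) := by
  set β : ℕ → ℝ := fun n => ∑ z ∈ box (N n) (N (n + 1)), |c n z| ^ q with hβ
  have hβ0 : ∀ n, 0 ≤ β n := fun n => Finset.sum_nonneg fun z _ => by positivity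
  have hβs : Summable β := by
    have hev : ∀ᶠ n : ℕ in Filter.atTop, 1 / ((n:ℝ) + 1) < q - 2 :=
      tendsto_one_div_add_atTop_nhds_zero_nat.eventually_lt_const (by linarith)
    refine Summable.of_norm_bounded_eventually_nat summable_geometric_two ?_
    filter_upwards [hev] with n hn
    rw [Real.norm_eq_abs, abs_of_nonneg (hβ0 n)]
    refine le_trans (Finset.sum_le_sum fun z _ => ?_) (hcs n)
    by_cases h0 : c n z = 0
    · rw [h0, abs_zero, Real.zero_rpow (by linarith), Real.zero_rpow (by positivity)]
    · exact Real.rpow_le_rpow_of_exponent_ge (abs_pos.2 h0) (hc1 n z) (by linarith)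
  refine summable_of_sum_le (c := ∑' n, β n) (fun z => by positivity) fun G => ?_
  set I := G.sup Prod.fst + 1
  calc ∑ z ∈ G, |ct c z| ^ q ≤ ∑ z ∈ G, ∑ n ∈ Finset.range I, |c n z| ^ q := by
        refine Finset.sum_le_sum fun z hz => ?_
        have : z.1 < I := Nat.lt_succ_of_le (Finset.le_sup (f := Prod.fst) hz)
        rw [ct_eq N hN c hc z I this]
        exact rpow_sum_le _ _ (fun i _ j _ hi hj =>
          box_uniq N hN z i j (hc i z hi) (hc j z hj)) q (by linarith)
    _ = ∑ n ∈ Finset.range I, ∑ z ∈ G, |c n z| ^ q := Finset.sum_comm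
    _ ≤ ∑ n ∈ Finset.range I, β n := by
        refine Finset.sum_le_sum fun n _ => ?_
        refine sum_le_sum_supp _ _ _ (fun z => by positivity) fun z hz => ?_
        apply hc
        intro h0; apply hz; rw [h0, abs_zero, Real.zero_rpow (by linarith)]
    _ ≤ ∑' n, β n := hβs.sum_le_tsum _ fun n _ => hβ0 n



lemma integral_wt (μ : ℝ × ℝ → ℝ) (hm : Measurable μ) (h0 : ∀ p, 0 < μ p ∧ μ p ≤ 1)
    (g : ℝ × ℝ → ℝ) :
    ∫ p, g p ∂(tau.withDensity (fun p => ENNReal.ofReal (μ p))) = ∫ p, g p * μ p ∂tau := by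
  rw [integral_withDensity_eq_integral_toReal_smul hm.ennreal_ofReal
    (Filter.Eventually.of_forall fun _ => ENNReal.ofReal_lt_top)]
  refine integral_congr_ae (Filter.Eventually.of_forall fun p => ?_)
  simp only [smul_eq_mul]
  rw [ENNReal.toReal_ofReal (h0 p).1.le, mul_comm]

lemma integrable_wt (μ : ℝ × ℝ → ℝ) (hm : Measurable μ) (h0 : ∀ p, 0 < μ p ∧ μ p ≤ 1)
    (g : ℝ × ℝ → ℝ) :
    Integrable g (tau.withDensity (fun p => ENNReal.ofReal (μ p))) ↔
      Integrable (fun p => g p * μ p) tau := by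
  rw [integrable_withDensity_iff_integrable_smul' hm.ennreal_ofReal
    (Filter.Eventually.of_forall fun _ => ENNReal.ofReal_lt_top)]
  refine integrable_congr (Filter.Eventually.of_forall fun p => ?_)
  simp only [smul_eq_mul]
  rw [ENNReal.toReal_ofReal (h0 p).1.le, mul_comm]

lemma norm_toL1_sub (ν : Measure (ℝ × ℝ)) (g h : ℝ × ℝ → ℝ) (hg : Integrable g ν)
    (hh : Integrable h ν) : ‖hg.toL1 g - hh.toL1 h‖ = ∫ p, |g p - h p| ∂ν := by
  rw [← Integrable.toL1_sub, L1.norm_of_fun_eq_integral_norm]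
  rfl

lemma sum_toL1 (ν : Measure (ℝ × ℝ)) [IsFiniteMeasure ν] (he : ∀ z, Integrable (e z) ν)
    (G : Finset (ℕ × ℕ)) (r : ℕ × ℕ → ℝ) :
    ∑ z ∈ G, r z • (he z).toL1 (e z) = (integrable_ps (ν := ν) G r).toL1 (ps G r) := by
  induction G using Finset.induction_on with
  | empty =>
    rw [Finset.sum_empty]
    symm
    have : ps ∅ r = 0 := by funext p; simp [ps]
    rw [Integrable.toL1_eq_toL1_iff _ 0 _ (integrable_zero _ _ _) |>.2 (by rw [this])]
    exact Integrable.toL1_zero _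
  | insert a G ha ih =>
    rw [Finset.sum_insert ha, ih, ← Integrable.toL1_smul, ← Integrable.toL1_add]
    rw [Integrable.toL1_eq_toL1_iff]
    refine Filter.Eventually.of_forall fun p => ?_
    simp [ps, Finset.sum_insert ha]


lemma core (P : ℕ → (ℕ × ℕ) →₀ ℚ) (N : ℕ → ℕ) (c : ℕ → ℕ × ℕ → ℝ)
    (D : ℕ → Set (ℝ × ℝ)) (hP : ∀ a m, ∃ n, m ≤ n ∧ P n = a) (hN1 : 1 ≤ N 0)
    (hN : ∀ n, N n < N (n + 1))
    (hc : ∀ n z, c n z ≠ 0 → z ∈ box (N n) (N (n + 1)))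
    (hlow : ∀ n G, Low G → ∃ θ : ℝ, 0 ≤ θ ∧ θ ≤ 1 ∧ ∃ r : ℕ × ℕ → ℝ,
      ∫ p, |ps G r p| ∂tau ≤ (1 / 2) ^ n ∧
        ∀ p, p ∉ D n → ps G (c n) p = θ * poly (P n) p + ps G r p)
    (hbig : ∀ n G, box (N n) (N (n + 1)) ⊆ G → ∀ p, p ∉ D n → ps G (c n) p = poly (P n) p)
    (μ : ℝ × ℝ → ℝ) (hm : Measurable μ) (h0 : ∀ p, 0 < μ p ∧ μ p ≤ 1) (n0 : ℕ)
    (hae : ∀ᵐ p ∂tau, ∀ n, n0 ≤ n → p ∈ D n →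
      μ p * (∑ z ∈ box (N n) (N (n + 1)), |c n z| + ∑ z ∈ (P n).support, |(P n z : ℝ)|)
        ≤ (1 / 2) ^ n)
    (f : ℝ × ℝ → ℝ) (hf : Measurable f) (hfi : Integrable (fun p => |f p| * μ p) tau) :
    ∃ J : Set ℕ, ∀ ε : ℝ, 0 < ε → ∃ N0 : ℕ, 1 ≤ N0 ∧ ∀ G, Low G → (N0, N0) ∈ G →
      ∫ p, |ps G (fun z => if z ∈ {z : ℕ × ℕ | ∃ n ∈ J, z ∈ box (N n) (N (n + 1))}
        then ct c z else 0) p - f p| * μ p ∂tau < ε := by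
  set ν : Measure (ℝ × ℝ) := tau.withDensity (fun p => ENNReal.ofReal (μ p)) with hν
  have hμi : Integrable μ tau := integrable_of_bdd hm 1 fun p => by
    rw [abs_of_pos (h0 p).1]; exact (h0 p).2
  haveI : IsFiniteMeasure ν := isFiniteMeasure_withDensity_ofReal hμi.2
  have hac : ν ≪ tau := withDensity_absolutelyContinuous _ _
  have hIν : ∀ g : ℝ × ℝ → ℝ, ∫ p, g p ∂ν = ∫ p, g p * μ p ∂tau := integral_wt μ hm h0
  have hfν : Integrable f ν := by
    rw [hν, integrable_wt μ hm h0]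
    refine hfi.mono' (hf.mul hm).aestronglyMeasurable (Filter.Eventually.of_forall fun p => ?_)
    rw [Real.norm_eq_abs, abs_mul, abs_of_pos (h0 p).1]
  have he : ∀ z, Integrable (e z) ν := fun z =>
    integrable_of_bdd (measurable_e z) 1 fun p => (abs_e z p).le
  have hpol : ∀ a, Integrable (poly a) ν := fun a => integrable_ps _ _
  have habs : ∀ n G p, |ps G (c n) p| ≤ ∑ z ∈ box (N n) (N (n + 1)), |c n z| := by
    intro n G p
    refine (abs_ps_le G (c n) p).trans ?_
    exact sum_le_sum_supp _ _ _ (fun z => abs_nonneg _) fun z hz => hc n z (abs_ne_zero.1 hz)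
  have hpabs : ∀ n p, |poly (P n) p| ≤ ∑ z ∈ (P n).support, |(P n z : ℝ)| :=
    fun n p => abs_ps_le _ _ p
  have hbm : ∀ g : ℝ × ℝ → ℝ, Integrable g ν → Integrable (fun p => |g p| * μ p) tau := by
    intro g hg
    exact (integrable_wt μ hm h0 _).1 hg.abs
  have hconst : ∀ n : ℕ, Integrable (fun _ : ℝ × ℝ => ((1:ℝ) / 2) ^ n) tau :=
    fun n => integrable_const _
  have hci : ∀ n : ℕ, ∫ _ : ℝ × ℝ, ((1:ℝ) / 2) ^ n ∂tau = (1 / 2) ^ n := by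
    intro n; simp
  set v : ℕ → ℕ × ℕ → (ℝ × ℝ →₁[ν] ℝ) := fun n z => c n z • (he z).toL1 (e z) with hv
  set F : ℕ → (ℝ × ℝ →₁[ν] ℝ) := fun n => (hpol (P n)).toL1 (poly (P n)) with hF
  have hnorm : ∀ (g : ℝ × ℝ → ℝ) (hg : Integrable g ν), ‖hg.toL1 g‖ = ∫ p, |g p| * μ p ∂tau := by
    intro g hg
    rw [L1.norm_of_fun_eq_integral_norm, hIν]
    rfl
  obtain ⟨J, hJ⟩ := greedy N hN1 hN v (fun n z h => hc n z fun h' => h (by simp [hv, h'])) F n0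
    (fun n => 2 * (1 / 2) ^ n)
    (by simpa using (tendsto_pow_atTop_nhds_zero_of_lt_one (r := (1/2:ℝ)) (by norm_num)
      (by norm_num)).const_mul 2)
    (by
      intro x δ hδ m
      obtain ⟨a, ha⟩ := dense_poly ν hac x (L1.integrable_coeFn x) δ hδ
      obtain ⟨n, hmn, hn⟩ := hP a m
      refine ⟨n, hmn, ?_⟩
      have hx : x = (L1.integrable_coeFn x).toL1 x := (Integrable.toL1_coeFn x _).symm
      rw [hx]
      simp only [hF]
      rw [norm_toL1_sub, hn]
      exact ha)
    (by
      intro n hn G hG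
      obtain ⟨θ, hθ0, hθ1, r, hr, hform⟩ := hlow n G hG
      rw [sum_toL1 ν he G (c n), hnorm]
      simp only [hF]
      rw [hnorm]
      have hi1 := hbm _ (hpol (P n))
      have hi2 : Integrable (fun p => |ps G r p|) tau := (integrable_ps G r).abs
      calc ∫ p, |ps G (c n) p| * μ p ∂tau
          ≤ ∫ p, (|poly (P n) p| * μ p + |ps G r p|) + (1 / 2) ^ n ∂tau := by
            refine integral_mono_ae (hbm _ (integrable_ps _ _)) ((hi1.add hi2).add (hconst n)) ?_
            filter_upwards [hae] with p hp
            obtain ⟨hp0, hp1⟩ := h0 p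
            have hpw : (0:ℝ) < (1 / 2) ^ n := by positivity
            have a1 := abs_nonneg (poly (P n) p)
            have a2 := abs_nonneg (ps G r p)
            have a3 := abs_nonneg (ps G (c n) p)
            by_cases hpD : p ∈ D n
            · have h1 := hp n hn hpD
              have h2 := habs n G p
              have h3 := hpabs n p
              have h4 : |ps G (c n) p| * μ p ≤ (1 / 2) ^ n := by
                refine le_trans ?_ h1
                rw [mul_comm]
                exact mul_le_mul_of_nonneg_left (by linarith) hp0.le
              have h5 : 0 ≤ |poly (P n) p| * μ p := by positivity
              linarith
            · have h1 : |ps G (c n) p| ≤ |poly (P n) p| + |ps G r p| := by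
                rw [hform p hpD]
                refine (abs_add_le _ _).trans ?_
                rw [abs_mul, abs_of_nonneg hθ0]
                have := mul_le_of_le_one_left a1 hθ1
                linarith
              have h2 := mul_le_mul_of_nonneg_right h1 hp0.le
              have h3 := mul_le_of_le_one_right a2 hp1
              rw [add_mul] at h2
              linarith
        _ = (∫ p, |poly (P n) p| * μ p ∂tau + ∫ p, |ps G r p| ∂tau) + (1 / 2) ^ n := by
            have hi3 : Integrable (fun p => |poly (P n) p| * μ p + |ps G r p|) tau := hi1.add hi2
            rw [integral_add hi3 (hconst n), integral_add hi1 hi2, hci]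
        _ ≤ _ := by linarith)
    (by
      intro n hn G hG
      rw [sum_toL1 ν he G (c n)]
      simp only [hF]
      rw [norm_toL1_sub, hIν]
      have hpw : (0:ℝ) < (1 / 2) ^ n := by positivity
      calc ∫ p, |ps G (c n) p - poly (P n) p| * μ p ∂tau ≤ ∫ _p, (1 / 2) ^ n ∂tau := by
            refine integral_mono_ae (hbm (fun p => ps G (c n) p - poly (P n) p)
              ((integrable_ps _ _).sub (hpol _))) (hconst n) ?_
            filter_upwards [hae] with p hp
            obtain ⟨hp0, hp1⟩ := h0 p
            by_cases hpD : p ∈ D n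
            · have h1 := hp n hn hpD
              have h2 := habs n G p
              have h3 := hpabs n p
              refine le_trans ?_ h1
              rw [mul_comm]
              exact mul_le_mul_of_nonneg_left ((abs_sub _ _).trans (by linarith)) hp0.le
            · rw [hbig n G hG p hpD, sub_self, abs_zero, zero_mul]
              exact hpw.le
        _ = (1 / 2) ^ n := hci n
        _ ≤ 2 * (1 / 2) ^ n := by linarith)
    (hfν.toL1 f)
  refine ⟨J, fun ε hε => ?_⟩
  obtain ⟨N0, h1N, hN0⟩ := hJ ε hε
  refine ⟨N0, h1N, fun G hG hGN => ?_⟩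
  have hI : ∀ z ∈ G, z.1 < G.sup Prod.fst + 1 := fun z hz =>
    Nat.lt_succ_of_le (Finset.le_sup (f := Prod.fst) hz)
  have := hN0 G hG hGN _ hI
  have hs : ∑ n ∈ (Finset.range (G.sup Prod.fst + 1)).filter (fun n => n ∈ J), ∑ z ∈ G, v n z =
      ∑ z ∈ G, (if z ∈ {z : ℕ × ℕ | ∃ n ∈ J, z ∈ box (N n) (N (n + 1))}
        then ct c z else 0) • (he z).toL1 (e z) := by
    rw [Finset.sum_comm]
    refine Finset.sum_congr rfl fun z hz => ?_
    rw [ct_B N hN c hc J z _ (hI z hz), Finset.sum_smul]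
  rw [hs, sum_toL1 ν he G (fun z => if z ∈ {z : ℕ × ℕ | ∃ n ∈ J, z ∈ box (N n) (N (n + 1))}
        then ct c z else 0), norm_toL1_sub, hIν] at this
  exact this

lemma union_small (D : ℕ → Set (ℝ × ℝ)) (hD : ∀ n, MeasurableSet (D n))
    (hDt : ∀ n, tau (D n) ≤ ENNReal.ofReal ((1 / 2) ^ n)) (ε : ℝ) (hε : 0 < ε) :
    ∃ n0, ∀ μ : ℝ × ℝ → ℝ, (∀ p, (∀ n, n0 ≤ n → p ∉ D n) → μ p = 1) →
      volume {p ∈ T | μ p ≠ 1} < ENNReal.ofReal ε := by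
  obtain ⟨n0, hn0⟩ := exists_pow_lt_of_lt_one (show 0 < ε / 2 by positivity)
    (show (1 / 2 : ℝ) < 1 by norm_num)
  refine ⟨n0, fun μ hμ => ?_⟩
  have hsub : {p ∈ T | μ p ≠ 1} ⊆ (⋃ n, D (n0 + n)) ∩ T := by
    rintro p ⟨hpT, hp⟩
    refine ⟨?_, hpT⟩
    by_contra hcon
    apply hp
    apply hμ
    intro n hn hpn
    apply hcon
    exact Set.mem_iUnion.2 ⟨n - n0, by rwa [Nat.add_sub_cancel' hn]⟩
  have hs : Summable fun n : ℕ => ((1:ℝ) / 2) ^ (n0 + n) := by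
    simp_rw [pow_add]
    exact summable_geometric_two.mul_left _
  calc volume {p ∈ T | μ p ≠ 1} ≤ volume ((⋃ n, D (n0 + n)) ∩ T) := measure_mono hsub
    _ = tau (⋃ n, D (n0 + n)) := by
        rw [tau, Measure.restrict_apply (MeasurableSet.iUnion fun n => hD _)]
    _ ≤ ∑' n, tau (D (n0 + n)) := measure_iUnion_le _
    _ ≤ ∑' n, ENNReal.ofReal ((1 / 2) ^ (n0 + n)) := ENNReal.tsum_le_tsum fun n => hDt _
    _ = ENNReal.ofReal (∑' n : ℕ, (1 / 2) ^ (n0 + n)) :=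
        (ENNReal.ofReal_tsum_of_nonneg (fun n => by positivity) hs).symm
    _ < ENNReal.ofReal ε := by
        rw [ENNReal.ofReal_lt_ofReal_iff hε]
        simp_rw [pow_add]
        rw [tsum_mul_left, tsum_geometric_two]
        linarith

lemma low_rect (n m : ℕ) : Low (Finset.Icc 1 n ×ˢ Finset.Icc 1 m) := by
  intro z hz w h1 h2 h3 h4
  simp only [Finset.mem_product, Finset.mem_Icc] at hz ⊢
  omega

lemma low_disc (R : ℝ) : Low ((Finset.Icc 1 ⌊R⌋₊ ×ˢ Finset.Icc 1 ⌊R⌋₊).filter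
                (fun kν => ((kν.1 ^ 2 + kν.2 ^ 2 : ℕ) : ℝ) ≤ R ^ 2)) := by
  intro z hz w h1 h2 h3 h4
  simp only [Finset.mem_filter, Finset.mem_product, Finset.mem_Icc] at hz ⊢
  refine ⟨by omega, le_trans ?_ hz.2⟩
  exact_mod_cast Nat.add_le_add (Nat.pow_le_pow_left h2 2) (Nat.pow_le_pow_left h4 2)


end DW

/-- Theorem 3: there exists a double Walsh series, with coefficients in `ℓ^q` for every
`q > 2`, which is universal concerning subseries in every weighted space `L¹_μ([0,1]²)`
for suitable weights `μ` equal to `1` off a set of measure `< ε`, with convergence in the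
sense of both rectangular and spherical partial sums. -/
theorem theorem_three : ∃ c : ℕ → ℕ → ℝ,
    (∀ q : ℝ, 2 < q → Summable (fun p : ℕ × ℕ => |c p.1 p.2| ^ q)) ∧
    ∀ ε : ℝ, 0 < ε → ∃ μ : ℝ × ℝ → ℝ, Measurable μ ∧
      (∀ p ∈ T, 0 < μ p ∧ μ p ≤ 1) ∧
      volume {p ∈ T | μ p ≠ 1} < ENNReal.ofReal ε ∧
      ∀ f : ℝ × ℝ → ℝ, Measurable f →
        IntegrableOn (fun p => |f p| * μ p) T →
        ∃ B : Set (ℕ × ℕ),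
          Filter.Tendsto (fun nm : ℕ × ℕ =>
            ∫ p in T, |(∑ k ∈ Finset.Icc 1 nm.1, ∑ ν ∈ Finset.Icc 1 nm.2,
              (if (k, ν) ∈ B then c k ν else 0) * walsh k p.1 * walsh ν p.2) - f p| * μ p)
            Filter.atTop (nhds 0) ∧
          Filter.Tendsto (fun R : ℝ =>
            ∫ p in T, |(∑ kν ∈ (Finset.Icc 1 ⌊R⌋₊ ×ˢ Finset.Icc 1 ⌊R⌋₊).filter
                (fun kν => ((kν.1 ^ 2 + kν.2 ^ 2 : ℕ) : ℝ) ≤ R ^ 2),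
              (if kν ∈ B then c kν.1 kν.2 else 0) * walsh kν.1 p.1 * walsh kν.2 p.2) - f p| * μ p)
            Filter.atTop (nhds 0) := by
  obtain ⟨P, N, c, D, hP, hN1, hN, hc, hD, hDt, hc1, hcs, hlow, hbig⟩ := DW.exists_blocks
  refine ⟨fun k ν => DW.ct c (k, ν), fun q hq => DW.summable_ct N hN c hc hc1 hcs q hq, ?_⟩
  intro ε hε
  obtain ⟨n0, hn0⟩ := DW.union_small D hD hDt ε hε
  set A : ℕ → ℝ := fun n => ∑ z ∈ DW.box (N n) (N (n + 1)), |c n z| +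
    ∑ z ∈ (P n).support, |(P n z : ℝ)| with hA
  have hA0 : ∀ n, 0 ≤ A n := fun n => add_nonneg (Finset.sum_nonneg fun _ _ => abs_nonneg _)
    (Finset.sum_nonneg fun _ _ => abs_nonneg _)
  have hpw : ∀ n : ℕ, (0:ℝ) < (1 / 2) ^ n := fun n => by positivity
  obtain ⟨μ, hm, h0, h1, hae⟩ := DW.exists_weight D hD hDt (fun n => (1 / 2) ^ n / (1 + A n))
    (fun n => div_pos (hpw n) (by linarith [hA0 n]))
    (fun n => by
      rw [div_le_one (by linarith [hA0 n])]
      have : ((1:ℝ) / 2) ^ n ≤ 1 := pow_le_one₀ (by norm_num) (by norm_num)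
      linarith [hA0 n]) n0
  refine ⟨μ, hm, fun p _ => h0 p, hn0 μ h1, fun f hf hfi => ?_⟩
  obtain ⟨J, hJ⟩ := DW.core P N c D hP hN1 hN hc hlow hbig μ hm h0 n0 (by
    filter_upwards [hae] with p hp n hn hpD
    have h2 := hp n hn hpD
    rw [le_div_iff₀ (by linarith [hA0 n])] at h2
    have h3 := (h0 p).1
    change μ p * A n ≤ _
    linarith) f hf hfi
  refine ⟨{z : ℕ × ℕ | ∃ n ∈ J, z ∈ DW.box (N n) (N (n + 1))}, ?_, ?_⟩
  · rw [Metric.tendsto_nhds]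
    intro δ hδ
    obtain ⟨N0, h1N, hN0⟩ := hJ δ hδ
    filter_upwards [Filter.eventually_ge_atTop ((N0, N0) : ℕ × ℕ)] with nm hnm
    have hnm1 : N0 ≤ nm.1 := hnm.1
    have hnm2 : N0 ≤ nm.2 := hnm.2
    have key := hN0 _ (DW.low_rect nm.1 nm.2) (by
      simp only [Finset.mem_product, Finset.mem_Icc]; omega)
    rw [Real.dist_eq, sub_zero, abs_of_nonneg (integral_nonneg fun p =>
      mul_nonneg (abs_nonneg _) (h0 p).1.le)]
    simp only [DW.ps, DW.e, Finset.sum_product, ← mul_assoc] at key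
    exact key
  · rw [Metric.tendsto_nhds]
    intro δ hδ
    obtain ⟨N0, h1N, hN0⟩ := hJ δ hδ
    filter_upwards [Filter.eventually_ge_atTop ((2 * N0 : ℕ) : ℝ)] with R hR
    have hN0R : 2 * N0 ≤ ⌊R⌋₊ := Nat.le_floor hR
    have key := hN0 _ (DW.low_disc R) (by
      simp only [Finset.mem_filter, Finset.mem_product, Finset.mem_Icc]
      refine ⟨by omega, ?_⟩
      push_cast at hR ⊢
      have : (0:ℝ) ≤ N0 := Nat.cast_nonneg _
      nlinarith)
    rw [Real.dist_eq, sub_zero, abs_of_nonneg (integral_nonneg fun p =>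
      mul_nonneg (abs_nonneg _) (h0 p).1.le)]
    simp only [DW.ps, DW.e, ← mul_assoc] at key
    exact key
end

section
/- (Theorem 4) There exists a double Walsh series ∑_{n,k=1}^∞ c_{n,k} W_n(x)W_k(y) with ∑_{n,k=1}^∞ |c_{n,k}|^q < ∞ for all q > 2, such that for every ε > 0 one can construct a measurable weight μ(x,y) with 0 < μ ≤ 1 on T=[0,1]^2 and |{(x,y) : μ(x,y) ≠ 1}| < ε, with the property that for every f ∈ L^1_μ(T) there is a bijection σ of ℕ×ℕ onto itself such that the rearranged series ∑ c_{σ(n,k)} W_{σ_1(n,k)}(x)W_{σ_2(n,k)}(y) converges to f in L^1_μ(T) in the sense of both spherical and rectangular partial sums. -/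
open MeasureTheory Real
open scoped ENNReal Classical

namespace WS

lemma rad0_add_one (x : ℝ) : rad0 (x + 1) = rad0 x := by simp [rad0]

lemma rad0_add_nat (x : ℝ) (n : ℕ) : rad0 (x + n) = rad0 x := by simp [rad0]

lemma rad0_add_half (x : ℝ) : rad0 (x + 1/2) = - rad0 x := by
  have h0 := Int.fract_nonneg x
  have h1 := Int.fract_lt_one x
  have hx : x = ⌊x⌋ + Int.fract x := (Int.floor_add_fract x).symm
  unfold rad0
  by_cases h : Int.fract x < 1/2
  · have : Int.fract (x + 1/2) = Int.fract x + 1/2 := by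
      rw [Int.fract_eq_iff]
      refine ⟨by linarith, by linarith, ⌊x⌋, by linarith⟩
    rw [this, if_neg (by linarith), if_pos h]
  · have : Int.fract (x + 1/2) = Int.fract x - 1/2 := by
      rw [Int.fract_eq_iff]
      refine ⟨by linarith, by linarith, ⌊x⌋ + 1, by push_cast; linarith⟩
    rw [this, if_pos (by linarith), if_neg h]; simp

lemma rad0_sq (x : ℝ) : rad0 x * rad0 x = 1 := by
  unfold rad0; split_ifs <;> norm_num

lemma rad_sq (k : ℕ) (x : ℝ) : rad k x * rad k x = 1 := rad0_sq _

lemma rad_shift (m j : ℕ) (x : ℝ) : rad (m + j) x = rad j (2 ^ m * x) := by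
  unfold rad; congr 1; ring

lemma measurable_rad (k : ℕ) : Measurable (rad k) := by
  unfold rad rad0
  refine Measurable.ite ?_ measurable_const measurable_const
  exact measurableSet_lt (by fun_prop) measurable_const

lemma measurable_walsh (n : ℕ) : Measurable (walsh n) := by
  unfold walsh
  refine Finset.measurable_fun_prod _ fun m _ => ?_
  split_ifs
  · exact measurable_rad m
  · exact measurable_const

lemma walsh_eq (n K : ℕ) (h : n < 2 ^ K) (x : ℝ) :
    walsh n x = ∏ m ∈ Finset.range K, if n.testBit m then rad m x else 1 := by
  unfold walsh
  have h2 : n < 2 ^ (n + 1) := n.lt_two_pow_self.trans (Nat.pow_lt_pow_right (by norm_num) (by omega))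
  have key : ∀ m J, n < 2 ^ J → J ≤ m → n.testBit m = false := fun m J hJ hm =>
    Nat.testBit_lt_two_pow (hJ.trans_le (Nat.pow_le_pow_right (by norm_num) hm))
  rcases le_total K (n + 1) with hK | hK
  · symm
    refine Finset.prod_subset (Finset.range_mono hK) fun m _ hm => ?_
    rw [key m K h (by simpa using hm)]; simp
  · refine Finset.prod_subset (Finset.range_mono hK) fun m _ hm => ?_
    rw [key m (n+1) h2 (by simpa using hm)]; simp

lemma walsh_add (m a b : ℕ) (h : a < 2 ^ m) (x : ℝ) :
    walsh (a + 2 ^ m * b) x = walsh a x * walsh b (2 ^ m * x) := by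
  have hb : b < 2 ^ b := b.lt_two_pow_self
  have h1 : a + 2 ^ m * b < 2 ^ (m + b) := by
    rw [pow_add]
    calc a + 2 ^ m * b < 2 ^ m + 2 ^ m * b := by omega
      _ = 2 ^ m * (b + 1) := by ring
      _ ≤ _ := Nat.mul_le_mul_left _ hb
  rw [walsh_eq _ _ h1, walsh_eq a m h, walsh_eq b b hb, Finset.prod_range_add]
  congr 1
  · refine Finset.prod_congr rfl fun j hj => ?_
    have hj' : j < m := by simpa using hj
    have : (a + 2 ^ m * b).testBit j = a.testBit j := by
      rw [add_comm, Nat.testBit_two_pow_mul_add _ h]; simp [hj']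
    rw [this]
  · refine Finset.prod_congr rfl fun j _ => ?_
    have : (a + 2 ^ m * b).testBit (m + j) = b.testBit j := by
      rw [add_comm, Nat.testBit_two_pow_mul_add _ h]; simp
    rw [this, rad_shift]

lemma walsh_zero (x : ℝ) : walsh 0 x = 1 := by simp [walsh]

lemma walsh_one (x : ℝ) : walsh 1 x = rad 0 x := by
  rw [walsh_eq 1 1 (by norm_num)]; simp

lemma walsh_top (p b : ℕ) (h : b < 2 ^ p) (x : ℝ) :
    walsh (2 ^ p + b) x = walsh b x * rad p x := by
  have := walsh_add p b 1 h x
  rw [mul_one, walsh_one, add_comm b] at this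
  rw [this, ← rad_shift]; simp

lemma walsh_xor (n m : ℕ) (x : ℝ) : walsh (n ^^^ m) x = walsh n x * walsh m x := by
  have hn : n < 2 ^ (n + m) := n.lt_two_pow_self.trans_le (Nat.pow_le_pow_right (by norm_num) (by omega))
  have hm : m < 2 ^ (n + m) := m.lt_two_pow_self.trans_le (Nat.pow_le_pow_right (by norm_num) (by omega))
  rw [walsh_eq _ _ (Nat.xor_lt_two_pow hn hm), walsh_eq _ _ hn, walsh_eq _ _ hm,
    ← Finset.prod_mul_distrib]
  refine Finset.prod_congr rfl fun j _ => ?_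
  rw [Nat.testBit_xor]
  cases n.testBit j <;> cases m.testBit j <;> simp [rad_sq]

lemma walsh_sq (n : ℕ) (x : ℝ) : walsh n x * walsh n x = 1 := by
  rw [← walsh_xor]; simp [walsh_zero]

lemma abs_walsh (n : ℕ) (x : ℝ) : |walsh n x| = 1 := by
  have := walsh_sq n x
  rw [← abs_mul_abs_self] at this
  nlinarith [abs_nonneg (walsh n x)]

lemma rad_periodic (k : ℕ) : Function.Periodic (rad k) 1 := by
  intro x
  unfold rad
  have : (2:ℝ) ^ k * (x + 1) = 2 ^ k * x + ((2 ^ k : ℕ) : ℝ) := by push_cast; ring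
  rw [this, rad0_add_nat]

lemma walsh_periodic (n : ℕ) : Function.Periodic (walsh n) 1 := by
  intro x
  unfold walsh
  refine Finset.prod_congr rfl fun m _ => ?_
  rw [rad_periodic m x]

lemma walsh_shift (n : ℕ) (hn : n ≠ 0) : ∃ h : ℝ, ∀ x, walsh n (x + h) = - walsh n x := by
  have hex : ∃ k, n.testBit k = true := Nat.exists_testBit_of_ne_zero hn
  set k := Nat.find hex with hk
  have hkt : n.testBit k = true := Nat.find_spec hex
  have hmin : ∀ m < k, n.testBit m = false := fun m hm => by
    simpa using Nat.find_min hex hm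
  refine ⟨(2 ^ (k + 1))⁻¹, fun x => ?_⟩
  have hkn : k ∈ Finset.range (n + 1) := by
    have := Nat.ge_two_pow_of_testBit hkt
    have := k.lt_two_pow_self
    simp; omega
  unfold walsh
  rw [← Finset.mul_prod_erase _ _ hkn, ← Finset.mul_prod_erase _ (fun m => if n.testBit m then rad m x else 1) hkn]
  rw [if_pos hkt, if_pos hkt]
  have h1 : rad k (x + (2 ^ (k + 1))⁻¹) = - rad k x := by
    unfold rad
    have : (2:ℝ) ^ k * (x + (2 ^ (k + 1))⁻¹) = 2 ^ k * x + 1/2 := by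
      field_simp; ring
    rw [this, rad0_add_half]
  rw [h1, neg_mul]
  congr 2
  refine Finset.prod_congr rfl fun m hm => ?_
  rw [Finset.mem_erase] at hm
  rcases lt_or_gt_of_ne hm.1 with h | h
  · rw [hmin m h]; simp
  · obtain ⟨d, rfl⟩ := Nat.exists_eq_add_of_lt h
    have : rad (k + d + 1) (x + (2 ^ (k + 1))⁻¹) = rad (k + d + 1) x := by
      unfold rad
      have : (2:ℝ) ^ (k + d + 1) * (x + (2 ^ (k + 1))⁻¹) = 2 ^ (k + d + 1) * x + ((2 ^ d : ℕ) : ℝ) := by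
        push_cast; field_simp; ring
      rw [this, rad0_add_nat]
    rw [this]

lemma integral_walsh (n : ℕ) (hn : n ≠ 0) : ∫ x in Set.Icc (0:ℝ) 1, walsh n x = 0 := by
  obtain ⟨h, hh⟩ := walsh_shift n hn
  rw [integral_Icc_eq_integral_Ioc, ← intervalIntegral.integral_of_le zero_le_one]
  have h1 : ∫ x in (0:ℝ)..1, walsh n (x + h) = ∫ x in (0:ℝ)..1, walsh n x := by
    rw [intervalIntegral.integral_comp_add_right]
    have := (walsh_periodic n).intervalIntegral_add_eq h 0
    rw [zero_add] at this
    rw [zero_add, add_comm 1 h, this]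
  simp_rw [hh, intervalIntegral.integral_neg] at h1
  linarith

/-- The double Walsh functions. -/
noncomputable def phi (s : ℕ × ℕ) (p : ℝ × ℝ) : ℝ := walsh s.1 p.1 * walsh s.2 p.2

lemma measurable_phi (s : ℕ × ℕ) : Measurable (phi s) :=
  ((measurable_walsh _).comp measurable_fst).mul ((measurable_walsh _).comp measurable_snd)

lemma abs_phi (s : ℕ × ℕ) (p : ℝ × ℝ) : |phi s p| = 1 := by
  simp [phi, abs_mul, abs_walsh]

lemma volume_T : volume T = 1 := by
  rw [T, Measure.volume_eq_prod, Measure.prod_prod]; simp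

instance : IsProbabilityMeasure (volume.restrict T) := ⟨by simp [volume_T]⟩

lemma measurableSet_T : MeasurableSet T := measurableSet_Icc.prod measurableSet_Icc

lemma integral_phi_mul (s t : ℕ × ℕ) :
    ∫ p in T, phi s p * phi t p = if s = t then 1 else 0 := by
  have h1 : ∀ n m : ℕ, ∫ x in Set.Icc (0:ℝ) 1, walsh n x * walsh m x = if n = m then 1 else 0 := by
    intro n m
    simp_rw [← walsh_xor]
    split_ifs with h
    · subst h; simp [walsh_zero]
    · exact integral_walsh _ (by simpa [Nat.xor_eq_zero_iff] using h)
  have : ∀ p : ℝ × ℝ, phi s p * phi t p =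
      (walsh s.1 p.1 * walsh t.1 p.1) * (walsh s.2 p.2 * walsh t.2 p.2) := by
    intro p; unfold phi; ring
  simp_rw [this]
  rw [T, Measure.volume_eq_prod, setIntegral_prod_mul (fun x => walsh s.1 x * walsh t.1 x)
    (fun x => walsh s.2 x * walsh t.2 x), h1, h1]
  by_cases h : s.1 = t.1 <;> by_cases h' : s.2 = t.2 <;> simp [h, h', Prod.ext_iff]

lemma measurable_sum_phi (V : Finset (ℕ × ℕ)) (c : ℕ × ℕ → ℝ) :
    Measurable (fun p => ∑ s ∈ V, c s * phi s p) :=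
  Finset.measurable_fun_sum _ fun s _ => (measurable_phi s).const_mul _

lemma abs_sum_phi_le (V : Finset (ℕ × ℕ)) (c : ℕ × ℕ → ℝ) (p : ℝ × ℝ) :
    |∑ s ∈ V, c s * phi s p| ≤ ∑ s ∈ V, |c s| := by
  refine (Finset.abs_sum_le_sum_abs _ _).trans (Finset.sum_le_sum fun s _ => ?_)
  rw [abs_mul, abs_phi, mul_one]

lemma integrable_of_bdd {ν : Measure (ℝ × ℝ)} [IsFiniteMeasure ν] {h : ℝ × ℝ → ℝ} (hm : Measurable h) (C : ℝ)
    (hC : ∀ p, |h p| ≤ C) : Integrable h ν :=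
  Integrable.of_bound hm.aestronglyMeasurable C (Filter.Eventually.of_forall hC)

lemma integrable_sum_phi {ν : Measure (ℝ × ℝ)} [IsFiniteMeasure ν] (V : Finset (ℕ × ℕ)) (c : ℕ × ℕ → ℝ) :
    Integrable (fun p => ∑ s ∈ V, c s * phi s p) ν :=
  integrable_of_bdd (measurable_sum_phi V c) _ (abs_sum_phi_le V c)

lemma integral_sq (V : Finset (ℕ × ℕ)) (c : ℕ × ℕ → ℝ) :
    ∫ p in T, (∑ s ∈ V, c s * phi s p) ^ 2 = ∑ s ∈ V, c s ^ 2 := by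
  have hInt2 : ∀ s t, Integrable (fun p => (c s * phi s p) * (c t * phi t p)) (volume.restrict T) := by
    intro s t
    refine integrable_of_bdd (((measurable_phi s).const_mul _).mul ((measurable_phi t).const_mul _))
      (|c s| * |c t|) fun p => ?_
    simp [abs_mul, abs_phi]
  simp_rw [pow_two, Finset.sum_mul_sum]
  rw [integral_finsetSum _ fun s _ => integrable_finsetSum _ fun t _ => hInt2 s t]
  refine Finset.sum_congr rfl fun s hs => ?_
  rw [integral_finsetSum _ fun t _ => hInt2 s t]
  have : ∀ t, ∫ p in T, (c s * phi s p) * (c t * phi t p) = if s = t then c s * c t else 0 := by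
    intro t
    have : ∀ p, (c s * phi s p) * (c t * phi t p) = (c s * c t) * (phi s p * phi t p) := by
      intro p; ring
    simp_rw [this]
    rw [integral_const_mul, integral_phi_mul]; simp
  simp_rw [this]
  simp [hs]

/-- The `L²` estimate giving smallness in `L¹`. -/
lemma integral_abs_le (V : Finset (ℕ × ℕ)) (c : ℕ × ℕ → ℝ) (d : ℝ) (hd : 0 < d)
    (h : ∑ s ∈ V, c s ^ 2 ≤ d ^ 2) : ∫ p in T, |∑ s ∈ V, c s * phi s p| ≤ d := by
  have hm := measurable_sum_phi V c
  have h2 : Integrable (fun p => (∑ s ∈ V, c s * phi s p) ^ 2) (volume.restrict T) := by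
    refine integrable_of_bdd (hm.pow_const 2) ((∑ s ∈ V, |c s|) ^ 2) fun p => ?_
    rw [abs_pow]
    exact pow_le_pow_left₀ (abs_nonneg _) (abs_sum_phi_le V c p) 2
  calc ∫ p in T, |∑ s ∈ V, c s * phi s p|
      ≤ ∫ p in T, (d / 2 + (2 * d)⁻¹ * (∑ s ∈ V, c s * phi s p) ^ 2) := by
        refine integral_mono (integrable_sum_phi V c).abs
          ((integrable_const _).add (h2.const_mul _)) fun p => ?_
        simp only
        set z := ∑ s ∈ V, c s * phi s p
        have : d / 2 + (2 * d)⁻¹ * z ^ 2 - |z| = (2 * d)⁻¹ * (d - |z|) ^ 2 := by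
          rw [sub_sq, sq_abs]; field_simp; ring
        have : 0 ≤ (2 * d)⁻¹ * (d - |z|) ^ 2 := by positivity
        linarith
    _ = d / 2 + (2 * d)⁻¹ * ∑ s ∈ V, c s ^ 2 := by
        rw [integral_add (integrable_const _) (h2.const_mul _), integral_const_mul, integral_sq]
        simp
    _ ≤ d / 2 + (2 * d)⁻¹ * d ^ 2 := by gcongr
    _ = d := by field_simp; norm_num

end WS


namespace WS

lemma kernel_prod (p : ℕ) (x t : ℝ) :
    ∑ b ∈ Finset.range (2 ^ p), walsh b x * walsh b t =
      ∏ j ∈ Finset.range p, (1 + rad j x * rad j t) := by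
  induction p with
  | zero => simp [walsh_zero]
  | succ p ih =>
    rw [pow_succ, mul_two, Finset.sum_range_add, Finset.prod_range_succ, ← ih, mul_add, mul_one,
      Finset.sum_mul]
    congr 1
    refine Finset.sum_congr rfl fun b hb => ?_
    rw [walsh_top p b (by simpa using hb), walsh_top p b (by simpa using hb)]
    ring

/-- Dirichlet kernel. -/
noncomputable def D (p : ℕ) (x : ℝ) : ℝ := ∑ b ∈ Finset.range (2 ^ p), walsh b x

lemma rad_zero (j : ℕ) : rad j 0 = 1 := by simp [rad, rad0]

lemma walsh_at_zero (n : ℕ) : walsh n 0 = 1 := by simp [walsh, rad_zero]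

lemma D_eq (p : ℕ) (x : ℝ) : D p x = ∏ j ∈ Finset.range p, (1 + rad j x) := by
  have := kernel_prod p x 0
  simpa [walsh_at_zero, rad_zero, D] using this

lemma D_values (p : ℕ) (x : ℝ) : D p x = 0 ∨ D p x = 2 ^ p := by
  rw [D_eq]
  induction p with
  | zero => simp
  | succ p ih =>
    rw [Finset.prod_range_succ]
    rcases ih with h | h
    · left; rw [h, zero_mul]
    · rw [h]
      unfold rad rad0
      split_ifs
      · right; ring
      · left; ring

lemma measurable_D (p : ℕ) : Measurable (D p) := by
  unfold D
  exact Finset.measurable_fun_sum _ fun b _ => measurable_walsh b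

/-- Exceptional sets. -/
def Ex (p m : ℕ) : Set (ℝ × ℝ) := {q | D p (2 ^ m * q.1) ≠ 0}

lemma measurableSet_Ex (p m : ℕ) : MeasurableSet (Ex p m) := by
  have : Measurable (fun q : ℝ × ℝ => D p (2 ^ m * q.1)) :=
    (measurable_D p).comp (measurable_fst.const_mul _)
  exact (measurableSet_eq_fun this measurable_const).compl

lemma measure_Ex (p m : ℕ) : (volume.restrict T) (Ex p m) = ENNReal.ofReal ((2 ^ p)⁻¹) := by
  have h1 : ∀ q : ℝ × ℝ, D p (2 ^ m * q.1) = (Ex p m).indicator (fun _ => (2:ℝ) ^ p) q := by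
    intro q
    by_cases h : q ∈ Ex p m
    · rw [Set.indicator_of_mem h]
      exact (D_values p _).resolve_left h
    · rw [Set.indicator_of_notMem h]
      simpa [Ex] using h
  have h2 : ∀ q : ℝ × ℝ, D p (2 ^ m * q.1) =
      ∑ b ∈ Finset.range (2 ^ p), phi (2 ^ m * b, 0) q * phi (0, 0) q := by
    intro q
    unfold D phi
    refine Finset.sum_congr rfl fun b _ => ?_
    have := walsh_add m 0 b (by positivity) q.1
    simp only [zero_add, walsh_zero, one_mul] at this
    simp [this, walsh_zero]
  have h3 : ∫ q in T, D p (2 ^ m * q.1) = 1 := by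
    simp_rw [h2]
    rw [integral_finsetSum]
    · simp_rw [integral_phi_mul]
      simp
    · intro b _
      refine integrable_of_bdd ((measurable_phi _).mul (measurable_phi _)) 1 fun q => ?_
      simp [abs_mul, abs_phi]
  simp_rw [h1] at h3
  rw [integral_indicator_const _ (measurableSet_Ex p m), smul_eq_mul] at h3
  have : (volume.restrict T).real (Ex p m) = (2 ^ p)⁻¹ := by
    field_simp; linarith
  rw [← this, ofReal_measureReal]

/-- Square of frequencies. -/
def Sq (M : ℕ) : Finset (ℕ × ℕ) := Finset.range (2 ^ M) ×ˢ Finset.range (2 ^ M)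

/-- Walsh polynomials. -/
noncomputable def g (M : ℕ) (γ : ℕ × ℕ → ℝ) (q : ℝ × ℝ) : ℝ := ∑ s ∈ Sq M, γ s * phi s q

/-- Spectrum of a sub-block. -/
noncomputable def S (M p m : ℕ) : Finset (ℕ × ℕ) :=
  (Sq M ×ˢ Finset.Ico 1 (2 ^ p)).image fun z : (ℕ × ℕ) × ℕ => (z.1.1 + 2 ^ m * z.2, z.1.2)

lemma sum_S (M p m : ℕ) (hm : M ≤ m) (F : ℕ × ℕ → ℝ) :
    ∑ s ∈ S M p m, F s = ∑ s ∈ Sq M, ∑ b ∈ Finset.Ico 1 (2 ^ p), F (s.1 + 2 ^ m * b, s.2) := by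
  unfold S
  rw [Finset.sum_image, Finset.sum_product]
  have h2 : 2 ^ M ≤ 2 ^ m := Nat.pow_le_pow_right (by norm_num) hm
  rintro ⟨⟨a, d⟩, b⟩ h ⟨⟨a', d'⟩, b'⟩ h' e
  simp only [Sq, Finset.coe_product, Set.mem_prod, Finset.mem_coe, Finset.mem_range] at h h'
  simp only [Prod.mk.injEq] at e ⊢
  obtain ⟨e1, e2⟩ := e
  have ha : a = a' := by
    have := congrArg (· % 2 ^ m) e1
    simpa [Nat.add_mul_mod_self_left, Nat.mod_eq_of_lt (h.1.1.trans_le h2),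
      Nat.mod_eq_of_lt (h'.1.1.trans_le h2)] using this
  subst ha
  refine ⟨⟨rfl, e2⟩, ?_⟩
  have : 2 ^ m * b = 2 ^ m * b' := by omega
  exact Nat.eq_of_mul_eq_mul_left (by positivity) this

lemma mem_S {M p m : ℕ} (hm : M ≤ m) {s : ℕ × ℕ} (hs : s ∈ S M p m) :
    2 ^ m ≤ s.1 ∧ s.1 < 2 ^ (m + p) := by
  unfold S at hs
  rw [Finset.mem_image] at hs
  obtain ⟨⟨⟨a, d⟩, b⟩, h, rfl⟩ := hs
  simp only [Sq, Finset.mem_product, Finset.mem_range, Finset.mem_Ico] at h ⊢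
  have h2 : 2 ^ M ≤ 2 ^ m := Nat.pow_le_pow_right (by norm_num) hm
  constructor
  · nlinarith [h.2.1, Nat.pos_of_ne_zero (pow_ne_zero m (two_ne_zero (α := ℕ)))]
  · rw [pow_add]
    calc a + 2 ^ m * b < 2 ^ m + 2 ^ m * b := by omega
      _ = 2 ^ m * (b + 1) := by ring
      _ ≤ _ := Nat.mul_le_mul_left _ h.2.2

/-- Unnormalised coefficients. -/
noncomputable def c0 (M : ℕ) (γ : ℕ × ℕ → ℝ) (s : ℕ × ℕ) : ℝ := - γ (s.1 % 2 ^ M, s.2)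

lemma mod_aux {M m a b : ℕ} (hm : M ≤ m) (ha : a < 2 ^ M) : (a + 2 ^ m * b) % 2 ^ M = a := by
  obtain ⟨d, rfl⟩ := Nat.exists_eq_add_of_le hm
  rw [pow_add, mul_assoc, Nat.add_mul_mod_self_left, Nat.mod_eq_of_lt ha]

lemma sum_S_c0 (M p m : ℕ) (hm : M ≤ m) (γ : ℕ × ℕ → ℝ) (q : ℝ × ℝ) (hq : q ∉ Ex p m) :
    ∑ s ∈ S M p m, c0 M γ s * phi s q = g M γ q := by
  have hD : D p (2 ^ m * q.1) = 0 := by simpa [Ex] using hq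
  have h1 : ∑ b ∈ Finset.Ico 1 (2 ^ p), walsh b (2 ^ m * q.1) = -1 := by
    have : (0:ℝ) = ∑ b ∈ Finset.Ico 0 (2 ^ p), walsh b (2 ^ m * q.1) := by
      rw [← hD, D, Finset.range_eq_Ico]
    rw [Finset.sum_eq_sum_Ico_succ_bot (by positivity), walsh_zero, zero_add] at this
    linarith
  rw [sum_S M p m hm, g]
  refine Finset.sum_congr rfl fun s hs => ?_
  have hs1 : s.1 < 2 ^ M := by simp [Sq] at hs; exact hs.1
  have hs2 : s.1 < 2 ^ m := hs1.trans_le (Nat.pow_le_pow_right (by norm_num) hm)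
  have : ∀ b, c0 M γ (s.1 + 2 ^ m * b, s.2) * phi (s.1 + 2 ^ m * b, s.2) q =
      - (γ s * phi s q) * walsh b (2 ^ m * q.1) := by
    intro b
    simp only [c0, phi, mod_aux hm hs1, walsh_add m s.1 b hs2]
    ring
  simp_rw [this]
  rw [← Finset.mul_sum, h1]; ring

lemma sum_S_mod (M p m : ℕ) (hm : M ≤ m) (h : ℕ × ℕ → ℝ) :
    ∑ s ∈ S M p m, h (s.1 % 2 ^ M, s.2) = ((2 ^ p - 1 : ℕ) : ℝ) * ∑ s ∈ Sq M, h s := by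
  rw [sum_S M p m hm, Finset.mul_sum]
  refine Finset.sum_congr rfl fun s hs => ?_
  have hs1 : s.1 < 2 ^ M := by simp [Sq] at hs; exact hs.1
  simp only [mod_aux hm hs1]
  simp

/-- Blocks. -/
noncomputable def Bl (M p M0 : ℕ) : ℕ → Finset (ℕ × ℕ)
  | 0 => ∅
  | n + 1 => Bl M p M0 n ∪ S M p (M0 + n * p)

/-- Exceptional sets of blocks. -/
def En (p M0 : ℕ) : ℕ → Set (ℝ × ℝ)
  | 0 => ∅
  | n + 1 => En p M0 n ∪ Ex p (M0 + n * p)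

lemma measurableSet_En (p M0 n : ℕ) : MeasurableSet (En p M0 n) := by
  induction n with
  | zero => exact MeasurableSet.empty
  | succ n ih => exact ih.union (measurableSet_Ex _ _)

lemma measure_En (p M0 n : ℕ) : (volume.restrict T) (En p M0 n) ≤ ENNReal.ofReal (n * (2 ^ p)⁻¹) := by
  induction n with
  | zero => simp [En]
  | succ n ih =>
    refine (measure_union_le _ _).trans ?_
    rw [measure_Ex]
    refine (add_le_add_left ih _).trans ?_
    rw [← ENNReal.ofReal_add (by positivity) (by positivity)]
    apply ENNReal.ofReal_le_ofReal
    push_cast; linarith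

lemma mem_Bl {M p M0 : ℕ} (hM : M ≤ M0) {n : ℕ} {s : ℕ × ℕ} (hs : s ∈ Bl M p M0 n) :
    2 ^ M0 ≤ s.1 ∧ s.1 < 2 ^ (M0 + n * p) := by
  induction n with
  | zero => simp [Bl] at hs
  | succ n ih =>
    rw [Bl, Finset.mem_union] at hs
    rcases hs with hs | hs
    · obtain ⟨h1, h2⟩ := ih hs
      refine ⟨h1, h2.trans_le (Nat.pow_le_pow_right (by norm_num) ?_)⟩
      rw [add_one_mul]; omega
    · obtain ⟨h1, h2⟩ := mem_S (by omega) hs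
      refine ⟨(Nat.pow_le_pow_right (by norm_num) (by omega)).trans h1, ?_⟩
      rw [add_one_mul, ← add_assoc]; exact h2

lemma Bl_lt_S {M p M0 : ℕ} (hM : M ≤ M0) {n : ℕ} {s t : ℕ × ℕ} (hs : s ∈ Bl M p M0 n)
    (ht : t ∈ S M p (M0 + n * p)) : s.1 < t.1 :=
  (mem_Bl hM hs).2.trans_le (mem_S (by omega) ht).1

lemma disj_Bl_S {M p M0 : ℕ} (hM : M ≤ M0) (n : ℕ) :
    Disjoint (Bl M p M0 n) (S M p (M0 + n * p)) := by
  rw [Finset.disjoint_left]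
  intro s hs ht
  exact lt_irrefl _ (Bl_lt_S hM hs ht)

lemma sum_Bl_mod (M p M0 : ℕ) (hM : M ≤ M0) (n : ℕ) (h : ℕ × ℕ → ℝ) :
    ∑ s ∈ Bl M p M0 n, h (s.1 % 2 ^ M, s.2) = n * (((2 ^ p - 1 : ℕ) : ℝ) * ∑ s ∈ Sq M, h s) := by
  induction n with
  | zero => simp [Bl]
  | succ n ih =>
    rw [Bl, Finset.sum_union (disj_Bl_S hM n), ih, sum_S_mod _ _ _ (by omega)]
    push_cast; ring

lemma sum_Bl_c0 (M p M0 : ℕ) (hM : M ≤ M0) (n : ℕ) (γ : ℕ × ℕ → ℝ) (q : ℝ × ℝ) (hq : q ∉ En p M0 n) :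
    ∑ s ∈ Bl M p M0 n, c0 M γ s * phi s q = n * g M γ q := by
  induction n with
  | zero => simp [Bl]
  | succ n ih =>
    rw [En, Set.mem_union, not_or] at hq
    rw [Bl, Finset.sum_union (disj_Bl_S hM n), ih hq.1, sum_S_c0 _ _ _ (by omega) _ _ hq.2]
    push_cast; ring

lemma initial_Bl (M p M0 : ℕ) (hM : M ≤ M0) (γ : ℕ × ℕ → ℝ) (v : ℕ ×ₗ ℕ) (n : ℕ) :
    ∃ i ≤ n, ∃ V : Finset (ℕ × ℕ), ∑ s ∈ V, c0 M γ s ^ 2 ≤ 2 ^ p * ∑ s ∈ Sq M, γ s ^ 2 ∧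
      ∀ q ∉ En p M0 n, ∑ s ∈ (Bl M p M0 n).filter (fun s => toLex s < v), c0 M γ s * phi s q =
        i * g M γ q + ∑ s ∈ V, c0 M γ s * phi s q := by
  induction n with
  | zero =>
    refine ⟨0, le_rfl, ∅, ?_, ?_⟩
    · simp only [Finset.sum_empty]; positivity
    · intro q _; simp [Bl]
  | succ n ih =>
    by_cases hex : ∃ t ∈ S M p (M0 + n * p), toLex t < v
    · obtain ⟨t, ht, htv⟩ := hex
      refine ⟨n, by omega, (S M p (M0 + n * p)).filter (fun s => toLex s < v), ?_, ?_⟩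
      · calc _ ≤ ∑ s ∈ S M p (M0 + n * p), c0 M γ s ^ 2 :=
              Finset.sum_le_sum_of_subset_of_nonneg (Finset.filter_subset _ _)
                fun _ _ _ => sq_nonneg _
          _ = ((2 ^ p - 1 : ℕ) : ℝ) * ∑ s ∈ Sq M, γ s ^ 2 := by
              rw [← sum_S_mod M p (M0 + n * p) (by omega)]
              refine Finset.sum_congr rfl fun s _ => ?_
              rw [c0, neg_sq]
          _ ≤ _ := by
              gcongr
              have : ((2 ^ p - 1 : ℕ) : ℝ) ≤ ((2 ^ p : ℕ) : ℝ) := by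
                exact_mod_cast Nat.sub_le _ _
              simp
      · intro q hq
        rw [En, Set.mem_union, not_or] at hq
        rw [Bl, Finset.filter_union, Finset.sum_union
          (Finset.disjoint_filter_filter (disj_Bl_S hM n)), ← sum_Bl_c0 M p M0 hM n γ q hq.1]
        congr 2
        refine Finset.filter_true_of_mem fun s hs => lt_trans ?_ htv
        rw [Prod.Lex.toLex_lt_toLex]
        exact Or.inl (Bl_lt_S hM hs ht)
    · push Not at hex
      obtain ⟨i, hi, V, hV, h⟩ := ih
      refine ⟨i, by omega, V, hV, fun q hq => ?_⟩
      rw [En, Set.mem_union, not_or] at hq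
      rw [← h q hq.1, Bl, Finset.filter_union, Finset.filter_false_of_mem (s := S _ _ _),
        Finset.union_empty]
      intro s hs
      exact not_lt.2 (hex s hs)

open Filter in
lemma block (M M0 : ℕ) (γ : ℕ × ℕ → ℝ) (δ : ℝ) (hδ : 0 < δ) :
    ∃ (B : Finset (ℕ × ℕ)) (c : ℕ × ℕ → ℝ) (E : Set (ℝ × ℝ)), MeasurableSet E ∧
      (volume.restrict T) E ≤ ENNReal.ofReal δ ∧ (∀ s ∈ B, 2 ^ M0 ≤ s.1) ∧
      ∑ s ∈ B, |c s| ^ (2 + δ) ≤ δ ∧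
      (∀ q ∉ E, ∑ s ∈ B, c s * phi s q = g M γ q) ∧
      ∀ v : ℕ ×ₗ ℕ, ∃ θ : ℝ, 0 ≤ θ ∧ θ ≤ 1 ∧ ∃ V : Finset (ℕ × ℕ),
        ∫ q in T, |∑ s ∈ V, c s * phi s q| ≤ δ ∧
        ∀ q ∉ E, ∑ s ∈ B.filter (fun s => toLex s < v), c s * phi s q =
          θ * g M γ q + ∑ s ∈ V, c s * phi s q := by
  obtain ⟨r, hr⟩ : ∃ r : ℕ, ((2:ℝ) ^ r)⁻¹ ≤ δ := by
    obtain ⟨r, hr⟩ := exists_pow_lt_of_lt_one hδ (show (1/2:ℝ) < 1 by norm_num)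
    refine ⟨r, ?_⟩
    rw [one_div, inv_pow] at hr
    exact hr.le
  set G2 := ∑ s ∈ Sq M, γ s ^ 2
  set Gq := ∑ s ∈ Sq M, |γ s| ^ (2 + δ)
  have hGq : 0 ≤ Gq := Finset.sum_nonneg fun s _ => by positivity
  have hN : Tendsto (fun j : ℕ => (2:ℝ) ^ j) atTop atTop :=
    tendsto_pow_atTop_atTop_of_one_lt (by norm_num)
  have l1 : Tendsto (fun j : ℕ => 2 ^ r * G2 * ((2:ℝ) ^ j)⁻¹) atTop (nhds 0) := by
    simpa using (tendsto_inv_atTop_zero.comp hN).const_mul (2 ^ r * G2)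
  have l2 : Tendsto (fun j : ℕ => 2 ^ r * Gq * ((2:ℝ) ^ j) ^ (-δ)) atTop (nhds 0) := by
    simpa using ((tendsto_rpow_neg_atTop hδ).comp hN).const_mul (2 ^ r * Gq)
  obtain ⟨j, hj1, hj2⟩ := ((l1.eventually (gt_mem_nhds (show 0 < δ ^ 2 by positivity))).and
    (l2.eventually (gt_mem_nhds hδ))).exists
  set N : ℕ := 2 ^ j with hNdef
  have hNpos : (0:ℝ) < N := by rw [hNdef]; positivity
  have hNr : (N:ℝ) = 2 ^ j := by rw [hNdef]; push_cast; rfl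
  rw [← hNr] at hj1 hj2
  set p := j + r
  have h2p : (2:ℝ) ^ p = N * 2 ^ r := by rw [hNr, ← pow_add]
  set M1 := max M M0
  have hM : M ≤ M1 := le_max_left _ _
  have hmul : ∀ (A : Finset (ℕ × ℕ)) q, ∑ s ∈ A, c0 M γ s / N * phi s q =
      (∑ s ∈ A, c0 M γ s * phi s q) / N := by
    intro A q
    rw [Finset.sum_div]
    exact Finset.sum_congr rfl fun s _ => by ring
  refine ⟨Bl M p M1 N, fun s => c0 M γ s / N, En p M1 N, measurableSet_En _ _ _, ?_, ?_, ?_, ?_, ?_⟩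
  · refine (measure_En _ _ _).trans (ENNReal.ofReal_le_ofReal ?_)
    rw [h2p]
    calc (N:ℝ) * ((N:ℝ) * 2 ^ r)⁻¹ = ((2:ℝ) ^ r)⁻¹ := by field_simp
      _ ≤ δ := hr
  · intro s hs
    exact (Nat.pow_le_pow_right (by norm_num) (le_max_right _ _)).trans (mem_Bl hM hs).1
  · have h1 : ∀ s, |c0 M γ s / N| ^ (2 + δ) =
        (fun s => |γ s| ^ (2 + δ)) (s.1 % 2 ^ M, s.2) * ((N:ℝ) ^ (2 + δ))⁻¹ := by
      intro s
      simp only [c0]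
      rw [abs_div, abs_neg, Nat.abs_cast, Real.div_rpow (abs_nonneg _) hNpos.le, div_eq_mul_inv]
    simp_rw [h1]
    rw [← Finset.sum_mul, sum_Bl_mod M p M1 hM N (fun s => |γ s| ^ (2 + δ))]
    have h2 : ((2 ^ p - 1 : ℕ) : ℝ) ≤ N * 2 ^ r := by
      have : ((2 ^ p - 1 : ℕ) : ℝ) ≤ ((2 ^ p : ℕ) : ℝ) := by
        exact_mod_cast Nat.sub_le _ _
      rw [← h2p]; simp
    calc _ ≤ N * ((N * 2 ^ r) * Gq) * ((N:ℝ) ^ (2 + δ))⁻¹ := by gcongr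
      _ = 2 ^ r * Gq * (N:ℝ) ^ (-δ) := by
        rw [Real.rpow_add hNpos, Real.rpow_neg hNpos.le]
        have : (N:ℝ) ^ (2:ℝ) = N * N := by
          rw [← pow_two]; exact_mod_cast Real.rpow_natCast (N:ℝ) 2
        rw [this]
        have : (N:ℝ) ^ δ ≠ 0 := (Real.rpow_pos_of_pos hNpos _).ne'
        field_simp
      _ ≤ δ := hj2.le
  · intro q hq
    rw [hmul, sum_Bl_c0 M p M1 hM N γ q hq]
    field_simp
  · intro v
    obtain ⟨i, hi, V, hV, h⟩ := initial_Bl M p M1 hM γ v N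
    refine ⟨i / N, by positivity, ?_, V, ?_, ?_⟩
    · rw [div_le_one hNpos]; exact_mod_cast hi
    · refine integral_abs_le V _ δ hδ ?_
      simp_rw [div_pow]
      rw [← Finset.sum_div, div_le_iff₀ (by positivity)]
      refine hV.trans ?_
      rw [h2p]
      have : N * 2 ^ r * G2 = (2 ^ r * G2 * (N:ℝ)⁻¹) * (N:ℝ) ^ 2 := by field_simp
      rw [this]
      gcongr
    · intro q hq
      rw [hmul, hmul, h q hq]
      field_simp
end WS


namespace WS

lemma exists_enum {J V : Type*} [LinearOrder V] [Infinite J] (key : J → V)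
    (hinj : Function.Injective key) (hfin : ∀ s, {s' | key s' < key s}.Finite) :
    ∃ τ : ℕ ≃ J, StrictMono (key ∘ τ) := by
  classical
  set e : J → ℕ := fun s => {s' | key s' < key s}.ncard with he
  have hlt : ∀ s t, key s < key t → e s < e t := by
    intro s t h
    refine Set.ncard_lt_ncard ⟨fun x hx => lt_trans hx h, fun hsub => ?_⟩ (hfin t)
    exact lt_irrefl _ (hsub (show s ∈ {s' | key s' < key t} from h))
  have hle : ∀ s t, e s < e t → key s < key t := by
    intro s t h
    by_contra hc
    rcases (not_lt.1 hc).lt_or_eq with h' | h'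
    · exact lt_asymm h (hlt _ _ h')
    · rw [hinj h'] at h; exact lt_irrefl _ h
  have einj : Function.Injective e := by
    intro s t h
    by_contra hne
    rcases lt_or_gt_of_ne (fun h' => hne (hinj h')) with h' | h'
    · exact (hlt _ _ h').ne h
    · exact (hlt _ _ h').ne' h
  have : Infinite (Set.range e) := (Set.infinite_range_of_injective einj).to_subtype
  let iso := Nat.Subtype.orderIsoOfNat (Set.range e)
  have hτ : ∀ n, e ((Equiv.ofInjective e einj).symm (iso n)) = iso n := fun n =>
    Equiv.apply_ofInjective_symm einj (iso n)
  refine ⟨iso.toEquiv.trans (Equiv.ofInjective e einj).symm, fun n m hnm => ?_⟩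
  apply hle
  change e ((Equiv.ofInjective e einj).symm (iso n)) < e ((Equiv.ofInjective e einj).symm (iso m))
  rw [hτ, hτ]
  exact iso.strictMono hnm

open Filter in
theorem rearr {J X : Type*} [LinearOrder J] [Countable J] [Infinite J] [NormedAddCommGroup X]
    (u : J → X) (B : ℕ → Finset J) (G : ℕ → X) (δ : ℕ → ℝ) (hδ : Tendsto δ atTop (nhds 0))
    (m0 : ℕ) (hdisj : ∀ i j, i ≠ j → Disjoint (B i) (B j))
    (hpre : ∀ k ≥ m0, ∀ v, ‖∑ s ∈ (B k).filter (fun s => s < v), u s‖ ≤ ‖G k‖ + δ k)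
    (hful : ∀ k ≥ m0, ‖∑ s ∈ B k, u s - G k‖ ≤ δ k)
    (hdense : ∀ (x : X) (ε : ℝ), 0 < ε → ∀ K : ℕ, ∃ k ≥ K, ‖x - G k‖ < ε)
    (hu : Tendsto (fun s => ‖u s‖) cofinite (nhds 0)) (F : X) :
    ∃ τ : ℕ ≃ J, Tendsto (fun n => ‖F - ∑ i ∈ Finset.range n, u (τ i)‖) atTop (nhds 0) := by
  classical
  obtain ⟨en⟩ : Nonempty (ℕ ≃ J) := nonempty_equiv_of_countable
  have pick : ∀ (t : ℕ) (U : Finset J), ∃ k, t ≤ k ∧ m0 ≤ k ∧ Disjoint U (B k) ∧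
      ‖(F - ∑ s ∈ U, u s) - G k‖ < (1/2) ^ t := by
    intro t U
    have h1 : ∀ᶠ k in atTop, ∀ s ∈ U, s ∉ B k := by
      rw [Filter.eventually_all_finset]
      intro s _
      by_cases h : ∃ i, s ∈ B i
      · obtain ⟨i, hi⟩ := h
        filter_upwards [eventually_gt_atTop i] with k hk hs
        exact Finset.disjoint_left.1 (hdisj i k hk.ne) hi hs
      · push Not at h
        exact Eventually.of_forall h
    obtain ⟨K, hK⟩ := eventually_atTop.1 h1
    obtain ⟨k, hk, hk'⟩ := hdense (F - ∑ s ∈ U, u s) ((1/2) ^ t) (by positivity) (max K (max t m0))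
    refine ⟨k, ?_, ?_, ?_, hk'⟩
    · exact (le_max_left _ _).trans ((le_max_right _ _).trans hk)
    · exact (le_max_right _ _).trans ((le_max_right _ _).trans hk)
    · rw [Finset.disjoint_left]
      exact hK k ((le_max_left _ _).trans hk)
  choose k hk1 hk2 hk3 hk4 using pick
  obtain ⟨US, US0, USs'⟩ : ∃ US : ℕ → Finset J, US 0 = ∅ ∧
      ∀ t, US (t + 1) = insert (en t) (US t) ∪ B (k t (insert (en t) (US t))) :=
    ⟨fun n => Nat.rec ∅ (fun t U => insert (en t) U ∪ B (k t (insert (en t) U))) n, rfl,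
      fun t => rfl⟩
  obtain ⟨κ, hκ⟩ : ∃ κ : ℕ → ℕ, ∀ t, κ t = k t (insert (en t) (US t)) := ⟨_, fun _ => rfl⟩
  have USs : ∀ t, US (t + 1) = insert (en t) (US t) ∪ B (κ t) := fun t => by rw [hκ, USs']
  have hκ1 : ∀ t, t ≤ κ t := fun t => by rw [hκ]; exact hk1 _ _
  have hκ2 : ∀ t, m0 ≤ κ t := fun t => by rw [hκ]; exact hk2 _ _
  have hκ3 : ∀ t, Disjoint (insert (en t) (US t)) (B (κ t)) := fun t => by rw [hκ]; exact hk3 _ _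
  have hκ4 : ∀ t, ‖(F - ∑ s ∈ insert (en t) (US t), u s) - G (κ t)‖ < (1/2) ^ t := fun t => by rw [hκ]; exact hk4 _ _
  have USmono : Monotone US := by
    refine monotone_nat_of_le_succ fun t => ?_
    rw [USs]
    exact (Finset.subset_insert _ _).trans Finset.subset_union_left
  have hex : ∀ s, ∃ t, s ∈ US (t + 1) := by
    intro s
    refine ⟨en.symm s, ?_⟩
    rw [USs]; simp
  obtain ⟨st, hst⟩ : ∃ st : J → ℕ, ∀ s t, s ∈ US t ↔ st s < t := by
    refine ⟨fun s => Nat.find (hex s), ?_⟩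
    intro s t
    constructor
    · intro h
      cases t with
      | zero => simp [US0] at h
      | succ t => exact Nat.lt_succ_of_le (Nat.find_min' (hex s) h)
    · intro h
      exact USmono (show Nat.find (hex s) + 1 ≤ t from h) (Nat.find_spec (hex s))
  let key : J → ℕ ×ₗ J := fun s => toLex (st s, s)
  have key_lt : ∀ s t, key s < key t ↔ st s < st t ∨ st s = st t ∧ s < t := by
    intro s t
    simp only [key, Prod.Lex.toLex_lt_toLex]
  obtain ⟨τ, hτ⟩ := exists_enum key
    (fun s t h => by
      have := congrArg (fun z => (ofLex z).2) h
      simpa [key] using this)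
    (fun s => by
      refine (US (st s + 1)).finite_toSet.subset fun s' hs' => ?_
      rw [Finset.mem_coe, hst]
      rcases (key_lt _ _).1 hs' with h | h <;> omega)
  refine ⟨τ, ?_⟩
  have hins : ∀ t, ‖F - ∑ s ∈ insert (en t) (US t), u s‖ ≤ ‖F - ∑ s ∈ US t, u s‖ + ‖u (en t)‖ := by
    intro t
    by_cases h : en t ∈ US t
    · rw [Finset.insert_eq_of_mem h]; exact le_add_of_nonneg_right (norm_nonneg _)
    · rw [Finset.sum_insert h, add_comm, ← sub_sub]; exact norm_sub_le _ _
  have hG : ∀ t, ‖G (κ t)‖ ≤ ‖F - ∑ s ∈ US t, u s‖ + ‖u (en t)‖ + (1/2) ^ t := by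
    intro t
    have := norm_sub_norm_le (G (κ t)) (F - ∑ s ∈ insert (en t) (US t), u s)
    rw [norm_sub_rev (G (κ t))] at this
    linarith [hins t, hκ4 t]
  have hr : ∀ t, ‖F - ∑ s ∈ US (t + 1), u s‖ ≤ (1/2) ^ t + δ (κ t) := by
    intro t
    rw [USs, Finset.sum_union (hκ3 t)]
    have : F - (∑ s ∈ insert (en t) (US t), u s + ∑ s ∈ B (κ t), u s) =
      ((F - ∑ s ∈ insert (en t) (US t), u s) - G (κ t)) - (∑ s ∈ B (κ t), u s - G (κ t)) := by abel
    rw [this]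
    exact (norm_sub_le _ _).trans (add_le_add (hκ4 t).le (hful _ (hκ2 t)))
  have hκlim : Tendsto κ atTop atTop := tendsto_atTop_mono hκ1 tendsto_id
  have hpow : Tendsto (fun t : ℕ => (1/2 : ℝ) ^ t) atTop (nhds 0) :=
    tendsto_pow_atTop_nhds_zero_of_lt_one (by norm_num) (by norm_num)
  have hrlim : Tendsto (fun t => ‖F - ∑ s ∈ US t, u s‖) atTop (nhds 0) := by
    rw [← tendsto_add_atTop_iff_nat 1]
    refine squeeze_zero (fun _ => norm_nonneg _) hr ?_
    simpa using hpow.add (hδ.comp hκlim)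
  have hulim : Tendsto (fun t => ‖u (en t)‖) atTop (nhds 0) := by
    have := hu.comp en.injective.tendsto_cofinite
    rwa [Nat.cofinite_eq_atTop] at this
  have hstlim : Tendsto (fun n => st (τ n)) atTop atTop := by
    rw [tendsto_atTop]
    intro t
    have h1 : ∀ᶠ s in cofinite, t ≤ st s := by
      refine (US t).finite_toSet.subset fun s hs => ?_
      rw [Finset.mem_coe, hst]
      simpa using hs
    have := τ.injective.tendsto_cofinite.eventually h1
    rwa [Nat.cofinite_eq_atTop] at this
  let e : ℕ → ℝ := fun t => 2 * ‖F - ∑ s ∈ US t, u s‖ + 2 * ‖u (en t)‖ + (1/2) ^ t + δ (κ t)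
  have helim : Tendsto e atTop (nhds 0) := by
    simpa [e] using (((hrlim.const_mul 2).add (hulim.const_mul 2)).add hpow).add (hδ.comp hκlim)
  refine squeeze_zero (fun _ => norm_nonneg _) (fun n => ?_) (helim.comp hstlim)
  change _ ≤ e (st (τ n))
  set v := τ n with hv
  set t := st v with ht
  have hP : (Finset.range n).map τ.toEmbedding = (US t ∪ (B (κ t)).filter (fun s => s < v)) ∪
      (({en t} : Finset J) \ US t).filter (fun s => s < v) := by
    ext s
    have h1 : s ∈ (Finset.range n).map τ.toEmbedding ↔ key s < key v := by
      rw [Finset.mem_map_equiv, Finset.mem_range]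
      have := hτ.lt_iff_lt (a := τ.symm s) (b := n)
      simpa using this.symm
    have h2 : st s = t ↔ s ∉ US t ∧ s ∈ US (t + 1) := by
      rw [hst, hst]; omega
    rw [h1, key_lt, ← ht, h2, ← hst, USs]
    have h3 : s ∈ B (κ t) → s ∉ US t := fun h h' =>
      Finset.disjoint_left.1 (hκ3 t) (Finset.mem_insert_of_mem h') h
    simp only [Finset.mem_union, Finset.mem_insert, Finset.mem_filter, Finset.mem_sdiff,
      Finset.mem_singleton]
    tauto
  have hd1 : Disjoint (US t) ((B (κ t)).filter (fun s => s < v)) :=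
    (Finset.disjoint_of_subset_left (Finset.subset_insert _ _) (hκ3 t)).mono_right
      (Finset.filter_subset _ _)
  have hd2 : Disjoint (US t ∪ (B (κ t)).filter (fun s => s < v))
      ((({en t} : Finset J) \ US t).filter (fun s => s < v)) := by
    rw [Finset.disjoint_left]
    intro s hs hs'
    simp only [Finset.mem_filter, Finset.mem_sdiff, Finset.mem_singleton] at hs'
    rw [Finset.mem_union, Finset.mem_filter] at hs
    rcases hs with hs | hs
    · exact hs'.1.2 hs
    · exact Finset.disjoint_left.1 (hκ3 t) (by rw [hs'.1.1]; exact Finset.mem_insert_self _ _) hs.1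
  have hsum : ∑ i ∈ Finset.range n, u (τ i) = ∑ s ∈ US t, u s +
      ∑ s ∈ (B (κ t)).filter (fun s => s < v), u s +
      ∑ s ∈ (({en t} : Finset J) \ US t).filter (fun s => s < v), u s := by
    rw [← Finset.sum_union hd1, ← Finset.sum_union hd2, ← hP, Finset.sum_map]; rfl
  have hsmall : ‖∑ s ∈ (({en t} : Finset J) \ US t).filter (fun s => s < v), u s‖ ≤ ‖u (en t)‖ := by
    refine (norm_sum_le _ _).trans ?_
    calc _ ≤ ∑ s ∈ {en t}, ‖u s‖ := Finset.sum_le_sum_of_subset_of_nonneg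
          ((Finset.filter_subset _ _).trans Finset.sdiff_subset) fun _ _ _ => norm_nonneg _
      _ = _ := by simp
  rw [hsum, ← sub_sub, ← sub_sub]
  have h5 := norm_sub_le (F - ∑ s ∈ US t, u s - ∑ s ∈ (B (κ t)).filter (fun s => s < v), u s)
    (∑ s ∈ (({en t} : Finset J) \ US t).filter (fun s => s < v), u s)
  have h6 := norm_sub_le (F - ∑ s ∈ US t, u s) (∑ s ∈ (B (κ t)).filter (fun s => s < v), u s)
  have h7 := hpre (κ t) (hκ2 t) v
  have h8 := hG t
  simp only [e]
  linarith
end WS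


namespace WS

lemma floor_two_mul (y : ℝ) : ⌊2 * y⌋ = 2 * ⌊y⌋ + (if Int.fract y < 1/2 then 0 else 1) := by
  have h0 := Int.fract_nonneg y
  have h1 := Int.fract_lt_one y
  have hy : y = ⌊y⌋ + Int.fract y := (Int.floor_add_fract y).symm
  rw [Int.floor_eq_iff]
  split_ifs with h
  · push_cast; constructor <;> linarith
  · push_cast; constructor <;> linarith

lemma kernel_val (M : ℕ) (x t : ℝ) (hx : x ∈ Set.Ico (0:ℝ) 1) (ht : t ∈ Set.Ico (0:ℝ) 1) :
    ∑ b ∈ Finset.range (2 ^ M), walsh b x * walsh b t =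
      if ⌊2 ^ M * x⌋ = ⌊2 ^ M * t⌋ then 2 ^ M else 0 := by
  rw [kernel_prod]
  induction M with
  | zero =>
    have h1 : ⌊x⌋ = 0 := Int.floor_eq_zero_iff.2 hx
    have h2 : ⌊t⌋ = 0 := Int.floor_eq_zero_iff.2 ht
    simp [h1, h2]
  | succ M ih =>
    rw [Finset.prod_range_succ, ih]
    have e : ∀ z : ℝ, (2:ℝ) ^ (M + 1) * z = 2 * (2 ^ M * z) := fun z => by ring
    rw [e, e, floor_two_mul, floor_two_mul]
    unfold rad rad0
    by_cases h : ⌊2 ^ M * x⌋ = ⌊2 ^ M * t⌋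
    · rw [h]
      split_ifs <;> first | omega | ring
    · rw [if_neg h, zero_mul, if_neg]
      intro h'
      apply h
      split_ifs at h' <;> omega

lemma exists_poly (h : ℝ × ℝ → ℝ) (M : ℕ) : ∃ γ : ℕ × ℕ → ℝ, ∀ q ∈ Set.Ico (0:ℝ) 1 ×ˢ Set.Ico (0:ℝ) 1,
    g M γ q = h (⌊2 ^ M * q.1⌋ / 2 ^ M, ⌊2 ^ M * q.2⌋ / 2 ^ M) := by
  refine ⟨fun s => ∑ w ∈ Sq M, h (w.1 / 2 ^ M, w.2 / 2 ^ M) / (2 ^ M * 2 ^ M) *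
    (walsh s.1 (w.1 / 2 ^ M) * walsh s.2 (w.2 / 2 ^ M)), ?_⟩
  rintro ⟨x, y⟩ ⟨hx, hy⟩
  simp only at hx hy ⊢
  have hpos : (0:ℝ) < 2 ^ M := by positivity
  have key : ∀ x ∈ Set.Ico (0:ℝ) 1, ∃ a : ℕ, a < 2 ^ M ∧ ((a:ℤ) = ⌊2 ^ M * x⌋) := by
    intro x hx
    have h0 : 0 ≤ ⌊2 ^ M * x⌋ := Int.floor_nonneg.2 (mul_nonneg hpos.le hx.1)
    obtain ⟨a, ha⟩ := Int.eq_ofNat_of_zero_le h0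
    refine ⟨a, ?_, ha.symm⟩
    have h2 : ⌊(2:ℝ) ^ M * x⌋ < ((2 ^ M : ℕ) : ℤ) := by
      rw [Int.floor_lt]; push_cast
      nlinarith [hx.2]
    rw [ha] at h2
    exact_mod_cast h2
  obtain ⟨a, ha, hax⟩ := key x hx
  obtain ⟨b, hb, hby⟩ := key y hy
  have kv : ∀ x ∈ Set.Ico (0:ℝ) 1, ∀ a : ℕ, (a:ℤ) = ⌊2 ^ M * x⌋ → ∀ u : ℕ, u < 2 ^ M →
      ∑ b ∈ Finset.range (2 ^ M), walsh b x * walsh b (u / 2 ^ M) = if u = a then 2 ^ M else 0 := by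
    intro x hx a ha u hu
    have hu' : (u:ℝ) < 2 ^ M := by exact_mod_cast hu
    rw [kernel_val M x _ hx ⟨by positivity, by rw [div_lt_one hpos]; exact hu'⟩]
    rw [mul_div_cancel₀ _ hpos.ne', Int.floor_natCast, ← ha]
    simp only [Nat.cast_inj]
    congr 1
    exact propext eq_comm
  unfold g
  simp_rw [Finset.sum_mul]
  rw [Finset.sum_comm]
  have : ∀ w ∈ Sq M, ∑ s ∈ Sq M, h (w.1 / 2 ^ M, w.2 / 2 ^ M) / (2 ^ M * 2 ^ M) *
      (walsh s.1 (w.1 / 2 ^ M) * walsh s.2 (w.2 / 2 ^ M)) * phi s (x, y) =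
      if w = (a, b) then h (w.1 / 2 ^ M, w.2 / 2 ^ M) else 0 := by
    intro w hw
    simp only [Sq, Finset.mem_product, Finset.mem_range] at hw
    have e : ∀ s : ℕ × ℕ, h (w.1 / 2 ^ M, w.2 / 2 ^ M) / (2 ^ M * 2 ^ M) *
      (walsh s.1 (w.1 / 2 ^ M) * walsh s.2 (w.2 / 2 ^ M)) * phi s (x, y) =
      h (w.1 / 2 ^ M, w.2 / 2 ^ M) / (2 ^ M * 2 ^ M) *
      ((walsh s.1 x * walsh s.1 (w.1 / 2 ^ M)) * (walsh s.2 y * walsh s.2 (w.2 / 2 ^ M))) := by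
      intro s; simp only [phi]; ring
    simp_rw [e]
    rw [← Finset.mul_sum, Sq, Finset.sum_product]
    simp only
    rw [← Finset.sum_mul_sum, kv x hx a hax w.1 hw.1, kv y hy b hby w.2 hw.2]
    by_cases h1 : w.1 = a <;> by_cases h2 : w.2 = b <;> simp [h1, h2, Prod.ext_iff]
  rw [Finset.sum_congr rfl this, Finset.sum_ite_eq' _ (a, b)]
  rw [if_pos (by simp [Sq, ha, hb]), ← hax, ← hby]
  simp

lemma measurable_g (M : ℕ) (γ : ℕ × ℕ → ℝ) : Measurable (g M γ) := measurable_sum_phi _ _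

lemma abs_g_le (M : ℕ) (γ : ℕ × ℕ → ℝ) (q : ℝ × ℝ) : |g M γ q| ≤ ∑ s ∈ Sq M, |γ s| :=
  abs_sum_phi_le _ _ _

lemma integrable_g {ν : Measure (ℝ × ℝ)} [IsFiniteMeasure ν] (M : ℕ) (γ : ℕ × ℕ → ℝ) :
    Integrable (g M γ) ν := integrable_sum_phi _ _

/-- Countable family of Walsh polynomials. -/
noncomputable def gq (z : ℕ × ((ℕ × ℕ) →₀ ℚ)) : ℝ × ℝ → ℝ := g z.1 (fun s => (z.2 s : ℝ))

lemma rat_approx (M : ℕ) (γ : ℕ × ℕ → ℝ) (η : ℝ) (hη : 0 < η) :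
    ∃ z : ℕ × ((ℕ × ℕ) →₀ ℚ), ∀ q, |g M γ q - gq z q| ≤ η := by
  have hc : 0 < η / ((Sq M).card + 1) := by positivity
  have : ∀ s, ∃ r : ℚ, |γ s - r| < η / ((Sq M).card + 1) := by
    intro s
    obtain ⟨r, hr⟩ := exists_rat_near (γ s) hc
    exact ⟨r, hr⟩
  choose r hr using this
  refine ⟨(M, Finsupp.indicator (Sq M) (fun s _ => r s)), fun q => ?_⟩
  unfold gq g
  simp only
  rw [← Finset.sum_sub_distrib]
  refine (Finset.abs_sum_le_sum_abs _ _).trans ?_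
  calc _ ≤ ∑ s ∈ Sq M, η / ((Sq M).card + 1) := by
        refine Finset.sum_le_sum fun s hs => ?_
        rw [← sub_mul, abs_mul, abs_phi, mul_one, Finsupp.indicator_of_mem hs]
        exact (hr s).le
    _ ≤ η := by
        rw [Finset.sum_const, nsmul_eq_mul, mul_div_assoc', div_le_iff₀ (by positivity)]
        nlinarith

lemma ae_Ico : ∀ᵐ q ∂(volume.restrict T), q ∈ Set.Ico (0:ℝ) 1 ×ˢ Set.Ico (0:ℝ) 1 := by
  have h : (Set.Ico (0:ℝ) 1 ×ˢ Set.Ico (0:ℝ) 1 : Set (ℝ × ℝ)) =ᵐ[volume] T := by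
    rw [Measure.volume_eq_prod]
    exact Measure.set_prod_ae_eq Ico_ae_eq_Icc Ico_ae_eq_Icc
  rw [← Measure.restrict_congr_set h]
  exact ae_restrict_mem (measurableSet_Ico.prod measurableSet_Ico)

lemma density (ν : Measure (ℝ × ℝ)) [IsFiniteMeasure ν] (hν : ν ≪ volume.restrict T)
    (f : ℝ × ℝ → ℝ) (hf : Integrable f ν) (ε : ℝ) (hε : 0 < ε) :
    ∃ z, ∫ q, |f q - gq z q| ∂ν < ε := by
  obtain ⟨h, hcs, hfh, hc, hi⟩ := hf.exists_hasCompactSupport_integral_sub_le (ε := ε / 4) (by positivity)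
  have huc := hcs.uniformContinuous_of_continuous hc
  set η := ε / (4 * (ν.real Set.univ + 1)) with hη
  have hν0 : 0 ≤ ν.real Set.univ := measureReal_nonneg
  have hηpos : 0 < η := by positivity
  obtain ⟨d, hd, hdist⟩ := Metric.uniformContinuous_iff.1 huc η hηpos
  obtain ⟨M, hM⟩ := exists_pow_lt_of_lt_one hd (show (1/2:ℝ) < 1 by norm_num)
  obtain ⟨γ, hγ⟩ := exists_poly h M
  obtain ⟨z, hz⟩ := rat_approx M γ η hηpos
  have hpos : (0:ℝ) < 2 ^ M := by positivity
  have hfl : ∀ x : ℝ, |x - ⌊2 ^ M * x⌋ / 2 ^ M| < d := by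
    intro x
    have h1 := Int.floor_le (2 ^ M * x)
    have h2 := Int.lt_floor_add_one (2 ^ M * x)
    have : x - ⌊2 ^ M * x⌋ / 2 ^ M = (2 ^ M * x - ⌊2 ^ M * x⌋) / 2 ^ M := by field_simp
    rw [this, abs_of_nonneg (div_nonneg (by linarith) hpos.le)]
    refine lt_of_le_of_lt ?_ hM
    rw [one_div, inv_pow, div_le_iff₀ hpos, inv_mul_cancel₀ hpos.ne']
    linarith
  have hae : ∀ᵐ q ∂ν, |h q - gq z q| ≤ 2 * η := by
    filter_upwards [hν.ae_le ae_Ico] with q hq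
    have h1 : |h q - g M γ q| ≤ η := by
      rw [hγ q hq, ← Real.dist_eq]
      refine (hdist ?_).le
      rw [Prod.dist_eq]
      exact max_lt (by rw [Real.dist_eq]; exact hfl _) (by rw [Real.dist_eq]; exact hfl _)
    have := abs_sub_le (h q) (g M γ q) (gq z q)
    linarith [hz q]
  refine ⟨z, ?_⟩
  have hgi : Integrable (gq z) ν := integrable_g _ _
  calc ∫ q, |f q - gq z q| ∂ν ≤ ∫ q, (‖f q - h q‖ + |h q - gq z q|) ∂ν := by
        refine integral_mono (hf.sub hgi).abs ((hf.sub hi).norm.add (hi.sub hgi).abs) fun q => ?_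
        exact abs_sub_le _ _ _
    _ = ∫ q, ‖f q - h q‖ ∂ν + ∫ q, |h q - gq z q| ∂ν :=
        integral_add (hf.sub hi).norm (hi.sub hgi).abs
    _ ≤ ε / 4 + ∫ q, 2 * η ∂ν := by
        refine add_le_add hfh (integral_mono_ae (hi.sub hgi).abs (integrable_const _) hae)
    _ < ε := by
        rw [integral_const, smul_eq_mul, hη]
        have : ν.real Set.univ * (2 * (ε / (4 * (ν.real Set.univ + 1)))) ≤ ε / 2 := by
          rw [mul_div_assoc', mul_div_assoc', div_le_div_iff₀ (by positivity) (by positivity)]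
          nlinarith
        linarith
end WS


namespace WS

lemma exists_surj_io (W : Type*) [Countable W] [Nonempty W] :
    ∃ z : ℕ → W, ∀ w K, ∃ k ≥ K, z k = w := by
  obtain ⟨e, he⟩ := exists_surjective_nat W
  refine ⟨fun k => e k.unpair.1, fun w K => ?_⟩
  obtain ⟨i, hi⟩ := he w
  refine ⟨Nat.pair i K, Nat.right_le_pair _ _, by simp [hi]⟩

theorem system : ∃ (c : ℕ × ℕ → ℝ) (B : ℕ → Finset (ℕ × ℕ)) (z : ℕ → ℕ × ((ℕ × ℕ) →₀ ℚ))
    (E : ℕ → Set (ℝ × ℝ)),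
    (∀ w K, ∃ k ≥ K, z k = w) ∧ (∀ i j, i ≠ j → Disjoint (B i) (B j)) ∧
    (∀ k, ∀ s ∈ B k, s.1 ≠ 0) ∧ (∀ s, (∀ k, s ∉ B k) → c s = 0) ∧
    (∀ k, ∑ s ∈ B k, |c s| ^ (2 + (1/2 : ℝ) ^ k) ≤ (1/2 : ℝ) ^ k) ∧
    (∀ k, MeasurableSet (E k)) ∧
    (∀ k, (volume.restrict T) (E k) ≤ ENNReal.ofReal ((1/2 : ℝ) ^ k)) ∧
    (∀ k, ∀ q ∉ E k, ∑ s ∈ B k, c s * phi s q = gq (z k) q) ∧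
    (∀ k (v : ℕ ×ₗ ℕ), ∃ (θ : ℝ) (R : ℝ × ℝ → ℝ), 0 ≤ θ ∧ θ ≤ 1 ∧
      Integrable R (volume.restrict T) ∧ ∫ q in T, |R q| ≤ (1/2 : ℝ) ^ k ∧
      ∀ q ∉ E k, ∑ s ∈ (B k).filter (fun s => toLex s < v), c s * phi s q =
          θ * gq (z k) q + R q) := by
  classical
  obtain ⟨z, hz⟩ := exists_surj_io (ℕ × ((ℕ × ℕ) →₀ ℚ))
  have hb := fun (k M0 : ℕ) => block (z k).1 M0 (fun s => ((z k).2 s : ℝ)) ((1/2 : ℝ) ^ k) (by positivity)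
  choose Bf cf Ef h1 h2 h3 h4 h5 h6 using hb
  obtain ⟨lev, hlev⟩ : ∃ lev : ℕ → ℕ, ∀ k, lev (k + 1) = lev k + ∑ s ∈ Bf k (lev k), s.1 :=
    ⟨fun n => Nat.rec 0 (fun k l => l + ∑ s ∈ Bf k l, s.1) n, fun k => rfl⟩
  have levmono : Monotone lev := monotone_nat_of_le_succ fun k => by rw [hlev]; omega
  obtain ⟨B, hB⟩ : ∃ B : ℕ → Finset (ℕ × ℕ), ∀ k, B k = Bf k (lev k) := ⟨_, fun _ => rfl⟩
  have hlt : ∀ i j, i < j → ∀ s ∈ B i, ∀ t ∈ B j, s.1 < t.1 := by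
    intro i j hij s hs t ht
    rw [hB] at hs ht
    have e1 : s.1 ≤ ∑ s ∈ Bf i (lev i), s.1 :=
      Finset.single_le_sum (f := fun s : ℕ × ℕ => s.1) (fun _ _ => Nat.zero_le _) hs
    have e2 : s.1 ≤ lev (i + 1) := by rw [hlev]; omega
    calc s.1 < 2 ^ s.1 := Nat.lt_two_pow_self
      _ ≤ 2 ^ lev j := Nat.pow_le_pow_right (by norm_num) (e2.trans (levmono hij))
      _ ≤ t.1 := h3 _ _ _ ht
  have hdisj : ∀ i j, i ≠ j → Disjoint (B i) (B j) := by
    intro i j hij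
    rw [Finset.disjoint_left]
    intro s hs hs'
    rcases lt_or_gt_of_ne hij with h | h
    · exact lt_irrefl _ (hlt _ _ h s hs s hs')
    · exact lt_irrefl _ (hlt _ _ h s hs' s hs)
  obtain ⟨c, hc, hc0⟩ : ∃ c : ℕ × ℕ → ℝ, (∀ k, ∀ s ∈ B k, c s = cf k (lev k) s) ∧
      ∀ s, (∀ k, s ∉ B k) → c s = 0 := by
    refine ⟨fun s => if h : ∃ k, s ∈ B k then cf h.choose (lev h.choose) s else 0, ?_, ?_⟩
    · intro k s hs
      have h : ∃ k, s ∈ B k := ⟨k, hs⟩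
      have : h.choose = k := by
        by_contra hne
        exact Finset.disjoint_left.1 (hdisj _ _ hne) h.choose_spec hs
      simp only [dif_pos h]
      rw [this]
    · intro s hs
      simp [hs]
  have hsum : ∀ k (A : Finset (ℕ × ℕ)) q, A ⊆ B k →
      ∑ s ∈ A, c s * phi s q = ∑ s ∈ A, cf k (lev k) s * phi s q := by
    intro k A q hA
    exact Finset.sum_congr rfl fun s hs => by rw [hc k s (hA hs)]
  refine ⟨c, B, z, fun k => Ef k (lev k), hz, hdisj, ?_, hc0, ?_, fun k => h1 _ _, fun k => h2 _ _,
    ?_, ?_⟩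
  · intro k s hs
    rw [hB] at hs
    have := h3 _ _ s hs
    have : 0 < 2 ^ lev k := by positivity
    omega
  · intro k
    refine le_trans (le_of_eq ?_) (h4 k (lev k))
    rw [← hB]
    exact Finset.sum_congr rfl fun s hs => by rw [hc k s hs]
  · intro k q hq
    rw [hsum k _ q (le_refl _), hB, h5 k (lev k) q hq]
    rfl
  · intro k v
    obtain ⟨θ, t0, t1, V, hV, hq⟩ := h6 k (lev k) v
    refine ⟨θ, fun q => ∑ s ∈ V, cf k (lev k) s * phi s q, t0, t1, integrable_sum_phi _ _, hV, ?_⟩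
    intro q hqE
    rw [hsum k _ q (Finset.filter_subset _ _), hB, hq q hqE]
    rfl

lemma summable_of_blocks (c : ℕ × ℕ → ℝ) (B : ℕ → Finset (ℕ × ℕ))
    (hdisj : ∀ i j, i ≠ j → Disjoint (B i) (B j))
    (hc0 : ∀ s, (∀ k, s ∉ B k) → c s = 0)
    (hb : ∀ k, ∑ s ∈ B k, |c s| ^ (2 + (1/2 : ℝ) ^ k) ≤ (1/2 : ℝ) ^ k) (q : ℝ) (hq : 2 < q) :
    Summable (fun s => |c s| ^ q) := by
  classical
  have hle1 : ∀ k, ∀ s ∈ B k, |c s| ≤ 1 := by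
    intro k s hs
    by_contra hcon
    push Not at hcon
    have h1 : |c s| ^ (2 + (1/2 : ℝ) ^ k) ≤ (1/2 : ℝ) ^ k :=
      (Finset.single_le_sum (f := fun s => |c s| ^ (2 + (1/2 : ℝ) ^ k))
        (fun _ _ => by positivity) hs).trans (hb k)
    have h2 : 1 < |c s| ^ (2 + (1/2 : ℝ) ^ k) := Real.one_lt_rpow hcon (by positivity)
    have h3 : (1/2 : ℝ) ^ k ≤ 1 := pow_le_one₀ (by norm_num) (by norm_num)
    linarith
  obtain ⟨k0, hk0⟩ := exists_pow_lt_of_lt_one (show 0 < q - 2 by linarith) (show (1/2:ℝ) < 1 by norm_num)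
  have hS : Summable (fun k => ∑ s ∈ B k, |c s| ^ q) := by
    rw [← summable_nat_add_iff k0]
    refine Summable.of_nonneg_of_le (fun k => Finset.sum_nonneg fun _ _ => by positivity) (fun k => ?_)
      ((summable_nat_add_iff k0).2 summable_geometric_two)
    refine le_trans (Finset.sum_le_sum fun s hs => ?_) (hb (k + k0))
    have e : (1/2 : ℝ) ^ (k + k0) ≤ (1/2) ^ k0 := pow_le_pow_of_le_one (by norm_num) (by norm_num) (by omega)
    rcases (abs_nonneg (c s)).eq_or_lt with h | h
    · rw [← h, Real.zero_rpow (by linarith), Real.zero_rpow (by positivity)]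
    · exact Real.rpow_le_rpow_of_exponent_ge h (hle1 _ s hs) (by linarith)
  refine summable_of_sum_le (c := ∑' k, ∑ s ∈ B k, |c s| ^ q) (fun _ => by positivity) fun U => ?_
  have : ∀ s, ∃ k, s ∈ B k ∨ c s = 0 := by
    intro s
    by_cases h : ∃ k, s ∈ B k
    · exact ⟨h.choose, Or.inl h.choose_spec⟩
    · push Not at h
      exact ⟨0, Or.inr (hc0 s h)⟩
  choose κ hκ using this
  calc ∑ s ∈ U, |c s| ^ q ≤ ∑ s ∈ (U.image κ).biUnion B, |c s| ^ q := by
        rw [← Finset.sum_filter_add_sum_filter_not U (fun s => c s = 0)]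
        rw [Finset.sum_eq_zero, zero_add]
        · refine Finset.sum_le_sum_of_subset_of_nonneg (fun s hs => ?_) fun _ _ _ => by positivity
          rw [Finset.mem_filter] at hs
          exact Finset.mem_biUnion.2 ⟨κ s, Finset.mem_image_of_mem _ hs.1, (hκ s).resolve_right hs.2⟩
        · intro s hs
          rw [(Finset.mem_filter.1 hs).2, abs_zero, Real.zero_rpow (by linarith)]
    _ ≤ ∑ k ∈ U.image κ, ∑ s ∈ B k, |c s| ^ q :=
        (Finset.sum_biUnion (fun i _ j _ h => hdisj i j h)).le
    _ ≤ _ := hS.sum_le_tsum _ fun k _ => Finset.sum_nonneg fun _ _ => by positivity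

lemma weight (E : ℕ → Set (ℝ × ℝ)) (hE : ∀ k, MeasurableSet (E k))
    (hEm : ∀ k, (volume.restrict T) (E k) ≤ ENNReal.ofReal ((1/2 : ℝ) ^ k)) (b : ℕ → ℝ)
    (ε : ℝ) (hε : 0 < ε) :
    ∃ (μ : ℝ × ℝ → ℝ) (m0 : ℕ), Measurable μ ∧ (∀ p, 0 < μ p ∧ μ p ≤ 1) ∧
      volume {p ∈ T | μ p ≠ 1} < ENNReal.ofReal ε ∧
      ∀ k ≥ m0, ∀ᵐ p ∂(volume.restrict T), p ∈ E k → b k * μ p ≤ 1 := by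
  obtain ⟨m0, hm0⟩ := exists_pow_lt_of_lt_one (show 0 < ε / 2 by linarith) (show (1/2:ℝ) < 1 by norm_num)
  have hgeo : HasSum (fun k : ℕ => (1/2 : ℝ) ^ (k + m0)) (2 * (1/2) ^ m0) := by
    simp_rw [pow_add]
    exact hasSum_geometric_two.mul_right _
  have htsum : ∑' k, (volume.restrict T) (E (k + m0)) ≤ ENNReal.ofReal (2 * (1/2) ^ m0) := by
    rw [← hgeo.tsum_eq, ENNReal.ofReal_tsum_of_nonneg (fun _ => by positivity) hgeo.summable]
    exact ENNReal.tsum_le_tsum fun k => hEm _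
  let w : ℝ × ℝ → ℝ≥0∞ := fun p => ∑' k, (E (k + m0)).indicator (fun _ => ENNReal.ofReal (b (k + m0))) p
  have hw : Measurable w := Measurable.tsum fun k => measurable_const.indicator (hE _)
  have hwfin : ∀ᵐ p ∂(volume.restrict T), w p ≠ ⊤ := by
    have := ae_eventually_notMem (μ := volume.restrict T) (s := fun k => E (k + m0))
      (ne_top_of_le_ne_top ENNReal.ofReal_ne_top htsum)
    filter_upwards [this] with p hp
    obtain ⟨N, hN⟩ := Filter.eventually_atTop.1 hp
    have : w p = ∑ k ∈ Finset.range N, (E (k + m0)).indicator (fun _ => ENNReal.ofReal (b (k + m0))) p := by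
      refine tsum_eq_sum fun k hk => ?_
      exact Set.indicator_of_notMem (hN k (by simpa using hk)) _
    rw [this]
    refine (ENNReal.sum_lt_top.2 fun k _ => ?_).ne
    refine lt_of_le_of_lt (Set.indicator_le_self' (fun _ _ => bot_le) p) ENNReal.ofReal_lt_top
  refine ⟨fun p => (1 + (w p).toReal)⁻¹, m0, (hw.ennreal_toReal.const_add 1).inv, ?_, ?_, ?_⟩
  · intro p
    have : 0 ≤ (w p).toReal := ENNReal.toReal_nonneg
    exact ⟨by positivity, inv_le_one_of_one_le₀ (by linarith)⟩
  · have hsub : {p ∈ T | (1 + (w p).toReal)⁻¹ ≠ 1} ⊆ (⋃ k, E (k + m0)) ∩ T := by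
      rintro p ⟨hpT, hp⟩
      refine ⟨?_, hpT⟩
      by_contra hcon
      apply hp
      have : w p = 0 := by
        simp only [w, ENNReal.tsum_eq_zero]
        intro k
        exact Set.indicator_of_notMem (fun h => hcon (Set.mem_iUnion.2 ⟨k, h⟩)) _
      simp [this]
    calc _ ≤ volume ((⋃ k, E (k + m0)) ∩ T) := measure_mono hsub
      _ = (volume.restrict T) (⋃ k, E (k + m0)) :=
        (Measure.restrict_apply (MeasurableSet.iUnion fun k => hE _)).symm
      _ ≤ ∑' k, (volume.restrict T) (E (k + m0)) := measure_iUnion_le _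
      _ ≤ ENNReal.ofReal (2 * (1/2) ^ m0) := htsum
      _ < _ := (ENNReal.ofReal_lt_ofReal_iff hε).2 (by linarith)
  · intro k hk
    filter_upwards [hwfin] with p hp hpE
    obtain ⟨j, rfl⟩ := Nat.exists_eq_add_of_le' hk
    have h1 : ENNReal.ofReal (b (j + m0)) ≤ w p := by
      refine le_trans (le_of_eq ?_) (ENNReal.le_tsum j)
      rw [Set.indicator_of_mem hpE]
    have h2 : b (j + m0) ≤ (w p).toReal := (ENNReal.ofReal_le_iff_le_toReal hp).1 h1
    have : 0 ≤ (w p).toReal := ENNReal.toReal_nonneg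
    rw [← div_eq_mul_inv, div_le_one (by linarith)]
    linarith
end WS

namespace WS

/-- The weighted measure on the square. -/
noncomputable def nu (μ : ℝ × ℝ → ℝ) : Measure (ℝ × ℝ) :=
  (volume.restrict T).withDensity (fun p => ENNReal.ofReal (μ p))

lemma nu_finite (μ : ℝ × ℝ → ℝ) (hμ : ∀ p, 0 < μ p ∧ μ p ≤ 1) : IsFiniteMeasure (nu μ) := by
  refine isFiniteMeasure_withDensity ?_
  refine ne_top_of_le_ne_top (b := ∫⁻ _ in T, 1) ?_ (lintegral_mono fun p => ?_)
  · simp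
  · exact ENNReal.ofReal_le_one.2 (hμ p).2

lemma nu_ac (μ : ℝ × ℝ → ℝ) : nu μ ≪ volume.restrict T := withDensity_absolutelyContinuous _ _

lemma integral_nu (μ : ℝ × ℝ → ℝ) (hm : Measurable μ) (hμ : ∀ p, 0 < μ p ∧ μ p ≤ 1)
    (h : ℝ × ℝ → ℝ) : ∫ p, h p ∂(nu μ) = ∫ p in T, h p * μ p := by
  unfold nu
  rw [integral_withDensity_eq_integral_toReal_smul hm.ennreal_ofReal
    (Filter.Eventually.of_forall fun _ => ENNReal.ofReal_lt_top)]
  refine integral_congr_ae (Filter.Eventually.of_forall fun p => ?_)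
  simp only [smul_eq_mul]
  rw [ENNReal.toReal_ofReal (hμ p).1.le, mul_comm]

lemma integrable_nu (μ : ℝ × ℝ → ℝ) (hm : Measurable μ) (hμ : ∀ p, 0 < μ p ∧ μ p ≤ 1)
    (f : ℝ × ℝ → ℝ) (hf : Measurable f) (hi : IntegrableOn (fun p => |f p| * μ p) T) :
    Integrable f (nu μ) := by
  unfold nu
  rw [integrable_withDensity_iff hm.ennreal_ofReal
    (Filter.Eventually.of_forall fun _ => ENNReal.ofReal_lt_top)]
  refine Integrable.mono' hi (hf.mul hm.ennreal_ofReal.ennreal_toReal).aestronglyMeasurable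
    (Filter.Eventually.of_forall fun p => ?_)
  rw [ENNReal.toReal_ofReal (hμ p).1.le, Real.norm_eq_abs, abs_mul, abs_of_pos (hμ p).1]

lemma est (μ : ℝ × ℝ → ℝ) (hm : Measurable μ) (hμ : ∀ p, 0 < μ p ∧ μ p ≤ 1)
    (E : Set (ℝ × ℝ)) (M d : ℝ) (hd : 0 ≤ d)
    (hM : ∀ᵐ p ∂(volume.restrict T), p ∈ E → M * μ p ≤ d) (H R : ℝ × ℝ → ℝ)
    (hH : ∀ p, |H p| ≤ M) (hR : Integrable R (volume.restrict T))
    (hHR : ∀ p ∉ E, H p = R p) : ∫ p, |H p| ∂(nu μ) ≤ (∫ p in T, |R p|) + d := by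
  rw [integral_nu μ hm hμ]
  calc ∫ p in T, |H p| * μ p ≤ ∫ p in T, (|R p| + d) := by
        refine integral_mono_of_nonneg (Filter.Eventually.of_forall fun p => ?_)
          (hR.abs.add (integrable_const _)) ?_
        · exact mul_nonneg (abs_nonneg _) (hμ p).1.le
        · filter_upwards [hM] with p hp
          by_cases hpE : p ∈ E
          · have h1 := hp hpE
            have h2 := mul_le_mul_of_nonneg_right (hH p) (hμ p).1.le
            have := abs_nonneg (R p)
            linarith
          · rw [hHR p hpE]
            have := mul_le_of_le_one_right (abs_nonneg (R p)) (hμ p).2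
            linarith
    _ = _ := by
        rw [integral_add hR.abs (integrable_const _)]
        simp

lemma sum_toL1 {ν : Measure (ℝ × ℝ)} {ι : Type*} (A : Finset ι) (h : ι → ℝ × ℝ → ℝ)
    (hh : ∀ i, Integrable (h i) ν) (hs : Integrable (fun p => ∑ i ∈ A, h i p) ν) :
    ∑ i ∈ A, (hh i).toL1 (h i) = hs.toL1 (fun p => ∑ i ∈ A, h i p) := by
  classical
  induction A using Finset.induction_on with
  | empty =>
    simp only [Finset.sum_empty]
    exact (Integrable.toL1_zero _).symm
  | insert a A ha ih =>
    have hA : Integrable (fun p => ∑ i ∈ A, h i p) ν := integrable_finsetSum _ fun i _ => hh i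
    rw [Finset.sum_insert ha, ih hA, ← Integrable.toL1_add]
    exact (Integrable.toL1_eq_toL1_iff _ _ _ _).2
      (Filter.Eventually.of_forall fun p => by simp [Finset.sum_insert ha])

theorem main_rearr (c : ℕ × ℕ → ℝ) (B : ℕ → Finset (ℕ × ℕ)) (z : ℕ → ℕ × ((ℕ × ℕ) →₀ ℚ))
    (E : ℕ → Set (ℝ × ℝ)) (hz : ∀ w K, ∃ k ≥ K, z k = w)
    (hdisj : ∀ i j, i ≠ j → Disjoint (B i) (B j))
    (hB0 : ∀ k, ∀ s ∈ B k, s.1 ≠ 0)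
    (hc3 : Summable (fun s => |c s| ^ (3 : ℝ)))
    (hful : ∀ k, ∀ q ∉ E k, ∑ s ∈ B k, c s * phi s q = gq (z k) q)
    (hpre : ∀ k (v : ℕ ×ₗ ℕ), ∃ (θ : ℝ) (R : ℝ × ℝ → ℝ), 0 ≤ θ ∧ θ ≤ 1 ∧
      Integrable R (volume.restrict T) ∧ ∫ q in T, |R q| ≤ (1/2 : ℝ) ^ k ∧
      ∀ q ∉ E k, ∑ s ∈ (B k).filter (fun s => toLex s < v), c s * phi s q =
          θ * gq (z k) q + R q)
    (μ : ℝ × ℝ → ℝ) (hm : Measurable μ) (hμ : ∀ p, 0 < μ p ∧ μ p ≤ 1) (m0 : ℕ)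
    (hM : ∀ k ≥ m0, ∀ᵐ p ∂(volume.restrict T), p ∈ E k →
      (∑ s ∈ B k, |c s| + ∑ s ∈ Sq (z k).1, |((z k).2 s : ℝ)|) * μ p ≤ (1/2 : ℝ) ^ k)
    (f : ℝ × ℝ → ℝ) (hf : Integrable f (nu μ)) :
    ∃ τ : ℕ ≃ {s : ℕ ×ₗ ℕ // (ofLex s).1 ≠ 0},
      Filter.Tendsto (fun n => ∫ p, |(∑ i ∈ Finset.range n,
        c (ofLex (τ i).1) * phi (ofLex (τ i).1) p) - f p| ∂(nu μ)) Filter.atTop (nhds 0) := by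
  have := nu_finite μ hμ
  have hU : ∀ s : ℕ × ℕ, Integrable (fun p => c s * phi s p) (nu μ) := fun s =>
    (integrable_of_bdd (measurable_phi s) 1 (fun p => (abs_phi s p).le)).const_mul _
  have hA : ∀ A : Finset (ℕ × ℕ), Integrable (fun p => ∑ s ∈ A, c s * phi s p) (nu μ) :=
    fun A => integrable_finsetSum _ fun s _ => hU s
  have hg : ∀ w, Integrable (gq w) (nu μ) := fun w => integrable_g _ _
  let U : ℕ × ℕ → Lp ℝ 1 (nu μ) := fun s => (hU s).toL1 _
  let u : {s : ℕ ×ₗ ℕ // (ofLex s).1 ≠ 0} → Lp ℝ 1 (nu μ) := fun s => U (ofLex s.1)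
  let G : ℕ → Lp ℝ 1 (nu μ) := fun k => (hg (z k)).toL1 _
  have hinj : Function.Injective (fun s : {s : ℕ ×ₗ ℕ // (ofLex s).1 ≠ 0} => ofLex s.1) :=
    fun a b h => Subtype.ext (ofLex.injective h)
  let B' : ℕ → Finset {s : ℕ ×ₗ ℕ // (ofLex s).1 ≠ 0} := fun k =>
    (B k).preimage (fun s => ofLex s.1) hinj.injOn
  have hmemB' : ∀ k s, s ∈ B' k ↔ ofLex s.1 ∈ B k := fun k s => Finset.mem_preimage
  have hUsum : ∀ A : Finset (ℕ × ℕ), ∑ s ∈ A, U s = (hA A).toL1 _ := fun A => sum_toL1 A _ hU (hA A)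
  have hnorm : ∀ (A : Finset (ℕ × ℕ)) (θ : ℝ) k, ‖∑ s ∈ A, U s - θ • G k‖ =
      ∫ p, |∑ s ∈ A, c s * phi s p - θ * gq (z k) p| ∂(nu μ) := by
    intro A θ k
    have : ∑ s ∈ A, U s - θ • G k = ((hA A).sub ((hg (z k)).smul θ)).toL1 _ := by
      rw [hUsum, Integrable.toL1_sub _ _ (hA A) ((hg (z k)).smul θ), Integrable.toL1_smul' _ (hg (z k))]
    rw [this, L1.norm_of_fun_eq_integral_norm]
    rfl
  have hbdd : ∀ k (A : Finset (ℕ × ℕ)), A ⊆ B k → ∀ θ : ℝ, 0 ≤ θ → θ ≤ 1 → ∀ p,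
      |∑ s ∈ A, c s * phi s p - θ * gq (z k) p| ≤
      ∑ s ∈ B k, |c s| + ∑ s ∈ Sq (z k).1, |((z k).2 s : ℝ)| := by
    intro k A hAB θ t0 t1 p
    refine (abs_sub _ _).trans (add_le_add ?_ ?_)
    · exact (abs_sum_phi_le A c p).trans
        (Finset.sum_le_sum_of_subset_of_nonneg hAB fun _ _ _ => abs_nonneg _)
    · rw [abs_mul, abs_of_nonneg t0]
      exact (mul_le_of_le_one_left (abs_nonneg _) t1).trans (abs_g_le _ _ _)
  have hJ : Infinite {s : ℕ ×ₗ ℕ // (ofLex s).1 ≠ 0} :=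
    Infinite.of_injective (fun n : ℕ => (⟨toLex (n + 1, 0), by simp⟩ :
      {s : ℕ ×ₗ ℕ // (ofLex s).1 ≠ 0})) (fun a b h => by
        have := congrArg (fun s => (ofLex s.1).1) h
        simpa using this)
  have hC : Countable {s : ℕ ×ₗ ℕ // (ofLex s).1 ≠ 0} := hinj.countable
  have hδ : Filter.Tendsto (fun k : ℕ => 2 * (1/2 : ℝ) ^ k) Filter.atTop (nhds 0) := by
    simpa using (tendsto_pow_atTop_nhds_zero_of_lt_one (r := (1/2 : ℝ)) (by norm_num)
      (by norm_num)).const_mul 2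
  have hsub : ∀ A : Finset {s : ℕ ×ₗ ℕ // (ofLex s).1 ≠ 0}, ∀ A' : Finset (ℕ × ℕ),
      (∀ s, s ∈ A ↔ ofLex s.1 ∈ A') → (∀ s ∈ A', s.1 ≠ 0) → ∑ s ∈ A, u s = ∑ s ∈ A', U s := by
    intro A A' h1 h2
    refine Finset.sum_nbij (fun s => ofLex s.1) (fun s hs => (h1 s).1 hs) hinj.injOn ?_
      (fun _ _ => rfl)
    intro s hs
    exact ⟨⟨toLex s, h2 s hs⟩, (h1 _).2 hs, rfl⟩
  obtain ⟨τ, hτ⟩ : ∃ τ : ℕ ≃ {s : ℕ ×ₗ ℕ // (ofLex s).1 ≠ 0}, Filter.Tendsto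
      (fun n => ‖hf.toL1 f - ∑ i ∈ Finset.range n, u (τ i)‖) Filter.atTop (nhds 0) := by
    refine rearr u B' G (fun k => 2 * (1/2 : ℝ) ^ k) hδ m0 ?_ ?_ ?_ ?_ ?_ (hf.toL1 f)
    · intro i j hij
      rw [Finset.disjoint_left]
      intro s hs hs'
      exact Finset.disjoint_left.1 (hdisj i j hij) ((hmemB' _ _).1 hs) ((hmemB' _ _).1 hs')
    · intro k hk v
      obtain ⟨θ, R, t0, t1, hR, hRi, hq⟩ := hpre k v.1
      rw [hsub _ ((B k).filter (fun s => toLex s < v.1)) (fun s => by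
          rw [Finset.mem_filter, Finset.mem_filter, hmemB']; rfl)
        (fun s hs => hB0 k s (Finset.mem_filter.1 hs).1)]
      have h1 := est μ hm hμ (E k) _ _ (by positivity) (hM k hk)
        (fun p => ∑ s ∈ (B k).filter (fun s => toLex s < v.1), c s * phi s p - θ * gq (z k) p) R
        (hbdd k _ (Finset.filter_subset _ _) θ t0 t1) hR (fun p hp => by
          rw [hq p hp]; ring)
      rw [← hnorm] at h1
      have h2 : ‖θ • G k‖ ≤ ‖G k‖ := by
        rw [norm_smul, Real.norm_eq_abs, abs_of_nonneg t0]
        exact mul_le_of_le_one_left (norm_nonneg _) t1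
      have h3 := norm_sub_norm_le (∑ s ∈ (B k).filter (fun s => toLex s < v.1), U s) (θ • G k)
      linarith
    · intro k hk
      rw [hsub _ (B k) (hmemB' k) (hB0 k)]
      have h1 := est μ hm hμ (E k) _ _ (by positivity) (hM k hk)
        (fun p => ∑ s ∈ B k, c s * phi s p - 1 * gq (z k) p) (fun _ => 0)
        (hbdd k _ (le_refl _) 1 zero_le_one le_rfl) (integrable_const _) (fun p hp => by
          rw [hful k p hp]; ring)
      rw [← hnorm, one_smul] at h1
      have : (0:ℝ) < (1/2 : ℝ) ^ k := by positivity
      simp only [abs_zero, integral_zero] at h1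
      linarith
    · intro x ε hε K
      obtain ⟨w, hw⟩ := density (nu μ) (nu_ac μ) (⇑x) (L1.integrable_coeFn x) ε hε
      obtain ⟨k, hk, rfl⟩ := hz w K
      refine ⟨k, hk, ?_⟩
      have : x - G k = ((L1.integrable_coeFn x).sub (hg (z k))).toL1 _ := by
        rw [Integrable.toL1_sub _ _ (L1.integrable_coeFn x) (hg (z k)), Integrable.toL1_coeFn]
      rw [this, L1.norm_of_fun_eq_integral_norm]
      exact hw
    · have hc : Filter.Tendsto (fun s => |c s|) Filter.cofinite (nhds 0) := by
        have := (hc3.tendsto_cofinite_zero).rpow_const (p := (1/3 : ℝ)) (Or.inr (by norm_num))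
        rw [Real.zero_rpow (by norm_num)] at this
        refine this.congr fun s => ?_
        rw [← Real.rpow_mul (abs_nonneg _)]
        norm_num
      have h2 : Filter.Tendsto (fun s => |c s| * (nu μ).real Set.univ) Filter.cofinite (nhds 0) := by
        simpa using hc.mul_const ((nu μ).real Set.univ)
      refine (h2.comp hinj.tendsto_cofinite).congr fun s => ?_
      change _ = ‖(hU (ofLex s.1)).toL1 _‖
      rw [L1.norm_of_fun_eq_integral_norm]
      simp only [Real.norm_eq_abs, abs_mul, abs_phi, mul_one, integral_const, smul_eq_mul,
        Function.comp]
      ring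
  refine ⟨τ, hτ.congr fun n => ?_⟩
  have e1 : ∑ i ∈ Finset.range n, u (τ i) =
      (integrable_finsetSum (Finset.range n) fun i _ => hU (ofLex (τ i).1)).toL1 _ :=
    sum_toL1 (Finset.range n) (fun i p => c (ofLex (τ i).1) * phi (ofLex (τ i).1) p) _ _
  rw [norm_sub_rev, e1, ← Integrable.toL1_sub, L1.norm_of_fun_eq_integral_norm]
  rfl

lemma diag_perm (τ : ℕ ≃ {s : ℕ ×ₗ ℕ // (ofLex s).1 ≠ 0}) :
    ∃ σ : (ℕ × ℕ) ≃ (ℕ × ℕ), (∀ i, σ (i, i) = ofLex (τ i).1) ∧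
      ∀ j : ℕ × ℕ, j.1 ≠ j.2 → (σ j).1 = 0 := by
  classical
  let d : {j : ℕ × ℕ // j.1 = j.2} ≃ ℕ :=
    ⟨fun j => j.1.1, fun i => ⟨(i, i), rfl⟩, fun j => Subtype.ext (Prod.ext rfl j.2), fun i => rfl⟩
  let l : {s : ℕ ×ₗ ℕ // (ofLex s).1 ≠ 0} ≃ {s : ℕ × ℕ // s.1 ≠ 0} :=
    ⟨fun s => ⟨ofLex s.1, s.2⟩, fun s => ⟨toLex s.1, s.2⟩, fun _ => rfl, fun _ => rfl⟩
  have i1 : Infinite {j : ℕ × ℕ // ¬ j.1 = j.2} :=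
    Infinite.of_injective (fun n : ℕ => (⟨(n, n + 1), by simp⟩ : {j : ℕ × ℕ // ¬ j.1 = j.2}))
      (fun a b h => by simpa using h)
  have i2 : Infinite {s : ℕ × ℕ // ¬ s.1 ≠ 0} :=
    Infinite.of_injective (fun n : ℕ => (⟨(0, n), by simp⟩ : {s : ℕ × ℕ // ¬ s.1 ≠ 0}))
      (fun a b h => by simpa using h)
  obtain ⟨f⟩ : Nonempty ({j : ℕ × ℕ // ¬ j.1 = j.2} ≃ {s : ℕ × ℕ // ¬ s.1 ≠ 0}) :=
    nonempty_equiv_of_countable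
  let e : {j : ℕ × ℕ // j.1 = j.2} ≃ {s : ℕ × ℕ // s.1 ≠ 0} := (d.trans τ).trans l
  refine ⟨Equiv.subtypeCongr e f, fun i => ?_, fun j hj => ?_⟩
  · simp [Equiv.subtypeCongr, e, d]
    rfl
  · have : Equiv.subtypeCongr e f j = (f ⟨j, hj⟩ : ℕ × ℕ) := by
      have h : (Equiv.sumCompl fun x : ℕ × ℕ => x.1 = x.2).symm j = Sum.inr ⟨j, hj⟩ := by
        rw [Equiv.symm_apply_eq]; rfl
      simp [Equiv.subtypeCongr, h]
    rw [this]
    exact not_not.1 (f _).2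

lemma sum_diag (F : ℕ × ℕ → ℝ) (h0 : ∀ j : ℕ × ℕ, j.1 ≠ j.2 → F j = 0) (A : Finset (ℕ × ℕ)) (n : ℕ)
    (hA : ∀ i, (i, i) ∈ A ↔ i < n) : ∑ j ∈ A, F j = ∑ i ∈ Finset.range n, F (i, i) := by
  classical
  symm
  rw [← Finset.sum_image (s := Finset.range n) (g := fun i : ℕ => (i, i)) (f := F)
    (fun a _ b _ h => (Prod.ext_iff.1 h).1)]
  refine Finset.sum_subset ?_ ?_
  · intro j hj
    obtain ⟨i, hi, rfl⟩ := Finset.mem_image.1 hj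
    exact (hA i).2 (Finset.mem_range.1 hi)
  · rintro ⟨a, b⟩ hj hn
    refine h0 _ fun h => hn ?_
    simp only at h
    subst h
    exact Finset.mem_image.2 ⟨a, Finset.mem_range.2 ((hA a).1 hj), rfl⟩

lemma sphere_mem (R : ℝ) (hR : 0 ≤ R) (i : ℕ) :
    (i, i) ∈ (Finset.range (⌊R⌋₊ + 1) ×ˢ Finset.range (⌊R⌋₊ + 1)).filter
      (fun j : ℕ × ℕ => ((j.1 ^ 2 + j.2 ^ 2 : ℕ) : ℝ) ≤ R ^ 2) ↔ i < ⌊R / √2⌋₊ + 1 := by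
  have h2 : (0:ℝ) < √2 := by positivity
  have h22 : √2 * √2 = 2 := Real.mul_self_sqrt (by norm_num)
  have key : ((i ^ 2 + i ^ 2 : ℕ) : ℝ) ≤ R ^ 2 ↔ (i : ℝ) * √2 ≤ R := by
    have e : ((i ^ 2 + i ^ 2 : ℕ) : ℝ) = ((i : ℝ) * √2) ^ 2 := by
      push_cast
      linear_combination (-(i : ℝ) ^ 2) * h22
    rw [e]
    exact sq_le_sq₀ (by positivity) hR
  rw [Finset.mem_filter, key, Nat.lt_add_one_iff, Nat.le_floor_iff (by positivity),
    le_div_iff₀ h2, Finset.mem_product, Finset.mem_range, Nat.lt_add_one_iff,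
    Nat.le_floor_iff hR]
  refine ⟨fun h => h.2, fun h => ?_⟩
  have h1 : (1:ℝ) ≤ √2 := Real.one_le_sqrt.2 (by norm_num)
  have h3 : (i : ℝ) ≤ R := le_trans (le_mul_of_one_le_right (by positivity) h1) h
  exact ⟨⟨h3, h3⟩, h⟩

end WS

/-- Theorem 4: there exists a double Walsh series, with coefficients in `ℓ^q` for every
`q > 2`, which is universal concerning rearrangements in every weighted space
`L¹_μ([0,1]²)` for suitable weights `μ` equal to `1` off a set of measure `< ε`,
with convergence of the rearranged series in the sense of both rectangular and spherical
partial sums. The rearrangement is given by a bijection `σ` of `ℕ × ℕ`, the term placed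
at position `(n,k)` being `c_{σ(n,k)} W_{σ₁(n,k)}(x) W_{σ₂(n,k)}(y)`. -/
theorem theorem_four : ∃ c : ℕ → ℕ → ℝ,
    (∀ q : ℝ, 2 < q → Summable (fun p : ℕ × ℕ => |c p.1 p.2| ^ q)) ∧
    ∀ ε : ℝ, 0 < ε → ∃ μ : ℝ × ℝ → ℝ, Measurable μ ∧
      (∀ p ∈ T, 0 < μ p ∧ μ p ≤ 1) ∧
      volume {p ∈ T | μ p ≠ 1} < ENNReal.ofReal ε ∧
      ∀ f : ℝ × ℝ → ℝ, Measurable f →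
        IntegrableOn (fun p => |f p| * μ p) T →
        ∃ σ : (ℕ × ℕ) ≃ (ℕ × ℕ),
          Filter.Tendsto (fun nm : ℕ × ℕ =>
            ∫ p in T, |(∑ j ∈ Finset.range nm.1 ×ˢ Finset.range nm.2,
              c (σ j).1 (σ j).2 * walsh (σ j).1 p.1 * walsh (σ j).2 p.2) - f p| * μ p)
            Filter.atTop (nhds 0) ∧
          Filter.Tendsto (fun R : ℝ =>
            ∫ p in T, |(∑ j ∈ (Finset.range (⌊R⌋₊ + 1) ×ˢ Finset.range (⌊R⌋₊ + 1)).filter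
                (fun j => ((j.1 ^ 2 + j.2 ^ 2 : ℕ) : ℝ) ≤ R ^ 2),
              c (σ j).1 (σ j).2 * walsh (σ j).1 p.1 * walsh (σ j).2 p.2) - f p| * μ p)
            Filter.atTop (nhds 0) := by
  obtain ⟨c, B, z, E, hz, hdisj, hB0, hc0, hb, hE, hEm, hful, hpre⟩ := WS.system
  have hsum := WS.summable_of_blocks c B hdisj hc0 hb
  have hcz : ∀ s : ℕ × ℕ, s.1 = 0 → c s = 0 := fun s hs => hc0 s fun k hk => hB0 k s hk hs
  refine ⟨fun n m => c (n, m), fun q hq => hsum q hq, fun ε hε => ?_⟩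
  obtain ⟨μ, m0, hm, hμ, hvol, hM⟩ := WS.weight E hE hEm (fun k => 2 ^ k *
    (∑ s ∈ B k, |c s| + ∑ s ∈ WS.Sq (z k).1, |((z k).2 s : ℝ)|)) ε hε
  refine ⟨μ, hm, fun p _ => hμ p, hvol, fun f hf hfi => ?_⟩
  obtain ⟨τ, hτ⟩ := WS.main_rearr c B z E hz hdisj hB0 (hsum 3 (by norm_num)) hful hpre μ hm hμ m0
    (fun k hk => by
      filter_upwards [hM k hk] with p hp hpE
      have h1 := hp hpE
      have h2 : (0:ℝ) < 2 ^ k := by positivity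
      rw [one_div, inv_pow, ← one_div, le_div_iff₀ h2]
      linarith) f (WS.integrable_nu μ hm hμ f hf hfi)
  obtain ⟨σ, hσ1, hσ2⟩ := WS.diag_perm τ
  refine ⟨σ, ?_⟩
  have key : ∀ (A : Finset (ℕ × ℕ)) (n : ℕ), (∀ i, (i, i) ∈ A ↔ i < n) →
      ∫ p, |(∑ i ∈ Finset.range n, c (ofLex (τ i).1) * WS.phi (ofLex (τ i).1) p) - f p|
        ∂(WS.nu μ) =
      ∫ p in T, |(∑ j ∈ A, c ((σ j).1, (σ j).2) * walsh (σ j).1 p.1 * walsh (σ j).2 p.2)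
        - f p| * μ p := by
    intro A n hA
    rw [WS.integral_nu μ hm hμ]
    refine integral_congr_ae (Filter.Eventually.of_forall fun p => ?_)
    have := WS.sum_diag
      (fun j => c ((σ j).1, (σ j).2) * walsh (σ j).1 p.1 * walsh (σ j).2 p.2)
      (fun j hj => by
        have h0 : c ((σ j).1, (σ j).2) = 0 := hcz _ (hσ2 j hj)
        simp only [h0, zero_mul]) A n hA
    beta_reduce
    rw [this]
    simp only [hσ1, WS.phi, mul_assoc]
  constructor
  · have hmin : Filter.Tendsto (fun nm : ℕ × ℕ => min nm.1 nm.2) Filter.atTop Filter.atTop := by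
      rw [Filter.tendsto_atTop]
      intro b
      filter_upwards [Filter.eventually_ge_atTop ((b, b) : ℕ × ℕ)] with nm h
      exact le_min h.1 h.2
    refine (hτ.comp hmin).congr fun nm => ?_
    exact key (Finset.range nm.1 ×ˢ Finset.range nm.2) (min nm.1 nm.2) (fun i => by
      simp [Finset.mem_product])
  · have hfl : Filter.Tendsto (fun R : ℝ => ⌊R / √2⌋₊ + 1) Filter.atTop Filter.atTop :=
      (Filter.tendsto_add_atTop_nat 1).comp ((tendsto_nat_floor_atTop (α := ℝ)).comp
        (Filter.tendsto_id.atTop_div_const (show (0:ℝ) < √2 by positivity)))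
    refine (hτ.comp hfl).congr' ?_
    filter_upwards [Filter.eventually_ge_atTop (0:ℝ)] with R hR
    exact key _ _ (WS.sphere_mem R hR)
end
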